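/- arXiv:2007.05668 — 3 statements merged into one kernel-verified Lean document; each statement's English description precedes it below -/
import Mathlib

section
/- General one-dimensional weighted interpolation (Proposition 2.13 in the one-dimensional case to which the paper reduces it): Let m ≥ 2 be an integer, σ₀, σ_m ∈ ℝ and p₀, p_m ∈ [1,∞]. For 0 < j < m set θ_j = j/m, 1/p_j = (1−θ_j)/p₀ + θ_j/p_m, σ_j = (1−θ_j)σ₀ + θ_j σ_m, and assume m − σ_m − (1/p_m − 1/p₀) > −σ₀ and σ_j > −1/p_j for every 0 < j < m. Then there is a constant C, depending only on m and the exponents, such that for every f ∈ C^m((0,∞)) with ‖x^{σ₀} f‖_{L^{p₀}(0,∞)} < ∞ and ‖x^{σ_m} f^{(m)}‖_{L^{p_m}(0,∞)} < ∞, and every 0 < j < m, ‖x^{σ_j} f^{(j)}‖_{L^{p_j}(0,∞)} ≤ C ‖x^{σ₀} f‖_{L^{p₀}(0,∞)}^{1−θ_j} ‖x^{σ_m} f^{(m)}‖_{L^{p_m}(0,∞)}^{θ_j}. -/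
open MeasureTheory Set
open scoped ENNReal

/-- The weighted Lebesgue norm `‖x^σ f‖_{L^p(0,∞)}`. -/
noncomputable def wLp (σ : ℝ) (p : ℝ≥0∞) (f : ℝ → ℝ) : ℝ≥0∞ :=
  eLpNorm (fun x => x ^ σ * f x) p (volume.restrict (Set.Ioi 0))

/-- `F 0, F 1, …, F m` are successive derivatives of one `C^m` function on `(0, ∞)`. -/
structure DerivChain (m : ℕ) (F : ℕ → ℝ → ℝ) : Prop where
  deriv : ∀ i < m, ∀ x, 0 < x → HasDerivAt (F i) (F (i + 1) x) x
  cont : ContinuousOn (F m) (Ioi 0)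

namespace DerivChain

variable {m : ℕ} {F : ℕ → ℝ → ℝ}

lemma continuousOn (h : DerivChain m F) {i : ℕ} (hi : i ≤ m) : ContinuousOn (F i) (Ioi 0) := by
  rcases hi.lt_or_eq with hi | rfl
  · exact fun x hx => (h.deriv i hi x hx).continuousAt.continuousWithinAt
  · exact h.cont

end DerivChain

lemma uIcc_subset_Ioi_zero {a b : ℝ} (ha : 0 < a) (hb : 0 < b) : uIcc a b ⊆ Ioi 0 :=
  fun _ ht => lt_of_lt_of_le (lt_min ha hb) ht.1

lemma ContinuousOn.intervalIntegrable_of_pos {g : ℝ → ℝ} (hg : ContinuousOn g (Ioi 0)) {a b : ℝ}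
    (ha : 0 < a) (hb : 0 < b) : IntervalIntegrable g volume a b :=
  (hg.mono (uIcc_subset_Ioi_zero ha hb)).intervalIntegrable

lemma hasDerivAt_taylor_sum (F : ℕ → ℝ → ℝ) (x s : ℝ) (j n : ℕ)
    (h : ∀ i ≤ n, HasDerivAt (F (j + i)) (F (j + i + 1) s) s) :
    HasDerivAt (fun s => ∑ i ∈ Finset.range (n + 1), F (j + i) s * (x - s) ^ i / i.factorial)
      (F (j + n + 1) s * (x - s) ^ n / n.factorial) s := by
  induction n with
  | zero => simpa using h 0 le_rfl
  | succ n ih =>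
    have h1 := ih fun i hi => h i (by omega)
    have h2 : HasDerivAt (fun s => (x - s) ^ (n + 1)) (((n + 1 : ℕ) : ℝ) * (x - s) ^ n * (-1)) s :=
      ((hasDerivAt_id s).const_sub x).pow (n + 1)
    have h3 := ((h (n + 1) le_rfl).mul h2).div_const ((n + 1).factorial : ℝ)
    have h4 := h1.add h3
    simp_rw [Finset.sum_range_succ _ (n + 1)]
    refine h4.congr_deriv ?_
    rw [Nat.factorial_succ]
    have : (n.factorial : ℝ) ≠ 0 := by positivity
    push_cast
    field_simp
    ring_nf

lemma DerivChain.taylor {F : ℕ → ℝ → ℝ} {j n : ℕ} (h : DerivChain (j + n + 1) F) {c x : ℝ}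
    (hc : 0 < c) (hx : 0 < x) :
    F j x - ∑ i ∈ Finset.range (n + 1), F (j + i) c * (x - c) ^ i / i.factorial
      = ∫ s in c..x, F (j + n + 1) s * (x - s) ^ n / n.factorial := by
  have hsub := uIcc_subset_Ioi_zero hc hx
  rw [intervalIntegral.integral_eq_sub_of_hasDerivAt (f := fun s =>
    ∑ i ∈ Finset.range (n + 1), F (j + i) s * (x - s) ^ i / i.factorial)]
  · simp [Finset.sum_range_succ']
  · exact fun s hs => hasDerivAt_taylor_sum F x s j n fun i hi => h.deriv _ (by omega) s (hsub hs)
  · refine ContinuousOn.intervalIntegrable_of_pos (ContinuousOn.div_const ?_ _) hc hx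
    exact h.cont.mul (by fun_prop)

lemma abs_mul_div_factorial_le {a b : ℝ} (n : ℕ) : |a * b / n.factorial| ≤ |a| * |b| := by
  rw [abs_div, abs_mul, Nat.abs_cast]
  exact div_le_self (by positivity) (by exact_mod_cast Nat.factorial_pos n)

lemma DerivChain.taylor_right {F : ℕ → ℝ → ℝ} {j n : ℕ} (h : DerivChain (j + n + 1) F) {c x : ℝ}
    (hc : 0 < c) (hx : c ≤ x) :
    |F j x - ∑ i ∈ Finset.range (n + 1), F (j + i) c * (x - c) ^ i / i.factorial|
      ≤ (x - c) ^ n * ∫ s in c..x, |F (j + n + 1) s| := by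
  have hx0 := hc.trans_le hx
  rw [h.taylor hc hx0, ← intervalIntegral.integral_const_mul]
  refine (intervalIntegral.abs_integral_le_integral_abs hx).trans
    (intervalIntegral.integral_mono_on hx ?_ ?_ fun s hs => ?_)
  · refine ContinuousOn.intervalIntegrable_of_pos (ContinuousOn.abs ?_) hc hx0
    exact (h.cont.mul (by fun_prop)).div_const _
  · exact ContinuousOn.intervalIntegrable_of_pos (h.cont.abs.const_mul _) hc hx0
  · refine (abs_mul_div_factorial_le n).trans ?_
    rw [mul_comm, abs_pow, abs_of_nonneg (by linarith [hs.2] : 0 ≤ x - s)]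
    gcongr
    · linarith [hs.2]
    · exact hs.1

lemma DerivChain.taylor_left {F : ℕ → ℝ → ℝ} {j n : ℕ} (h : DerivChain (j + n + 1) F) {c x : ℝ}
    (hx : 0 < x) (hxc : x ≤ c) :
    |F j x - ∑ i ∈ Finset.range (n + 1), F (j + i) c * (x - c) ^ i / i.factorial|
      ≤ ∫ s in x..c, s ^ n * |F (j + n + 1) s| := by
  have hc := hx.trans_le hxc
  rw [h.taylor hc hx, intervalIntegral.integral_symm, abs_neg]
  refine (intervalIntegral.abs_integral_le_integral_abs hxc).trans
    (intervalIntegral.integral_mono_on hxc ?_ ?_ fun s hs => ?_)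
  · refine ContinuousOn.intervalIntegrable_of_pos (ContinuousOn.abs ?_) hx hc
    exact (h.cont.mul (by fun_prop)).div_const _
  · exact ContinuousOn.intervalIntegrable_of_pos ((by fun_prop : ContinuousOn _ _).mul h.cont.abs)
      hx hc
  · refine (abs_mul_div_factorial_le n).trans ?_
    rw [mul_comm, abs_pow, abs_sub_comm, abs_of_nonneg (by linarith [hs.1] : 0 ≤ s - x)]
    gcongr
    · linarith [hs.1]
    · linarith

lemma exists_coeff_le_integral_abs (n : ℕ) :
    ∃ C : ℝ, 0 < C ∧ ∀ c : ℕ → ℝ, ∀ i < n,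
      |c i| ≤ C * ∫ t in (0 : ℝ)..1, |∑ k ∈ Finset.range n, c k * t ^ k| := by
  let N : (Fin n → ℝ) → ℝ := fun c => ∫ t in (0 : ℝ)..1, |∑ k, c k * t ^ (k : ℕ)|
  have hNc : Continuous N := by
    apply intervalIntegral.continuous_parametric_intervalIntegral_of_continuous'
    fun_prop
  have hNhom : ∀ (r : ℝ) c, N (r • c) = |r| * N c := fun r c => by
    simp only [N, ← intervalIntegral.integral_const_mul, ← abs_mul, Finset.mul_sum, Pi.smul_apply,
      smul_eq_mul, mul_assoc]
  have hNpos : ∀ c, c ≠ 0 → 0 < N c := by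
    intro c hc
    refine lt_of_le_of_ne (intervalIntegral.integral_nonneg zero_le_one fun _ _ => abs_nonneg _)
      fun h0 => hc ?_
    let P : Polynomial ℝ := ∑ k : Fin n, Polynomial.monomial (k : ℕ) (c k)
    have hP : ∀ t, P.eval t = ∑ k, c k * t ^ (k : ℕ) := fun t => by
      simp [P, Polynomial.eval_finsetSum]
    have hz : ∀ t ∈ Icc (0 : ℝ) 1, P.eval t = 0 := by
      intro t ht
      by_contra hne
      refine absurd h0.symm (ne_of_gt ?_)
      refine intervalIntegral.integral_pos zero_lt_one (by fun_prop) (fun _ _ => abs_nonneg _)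
        ⟨t, ht, ?_⟩
      rw [← hP]
      exact abs_pos.2 hne
    have hP0 : P = 0 := Polynomial.eq_zero_of_infinite_isRoot P
      ((Icc_infinite (zero_lt_one (α := ℝ))).mono hz)
    funext k
    have : P.coeff k = c k := by
      simp only [P, Polynomial.finsetSum_coeff, Polynomial.coeff_monomial]
      rw [Finset.sum_eq_single k]
      · simp
      · intro b _ hb
        simp [Fin.val_injective.ne hb]
      · simp
    rw [← this, hP0]; simp
  obtain ⟨C, hC, hCN⟩ : ∃ C : ℝ, 0 < C ∧ ∀ c, ‖c‖ ≤ C * N c := by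
    rcases (Metric.sphere (0 : Fin n → ℝ) 1).eq_empty_or_nonempty with he | hne
    · refine ⟨1, one_pos, fun c => ?_⟩
      have hc : c = 0 := by
        by_contra hc
        have : ‖c‖⁻¹ • c ∈ Metric.sphere (0 : Fin n → ℝ) 1 := by
          simp [norm_smul, hc]
        rw [he] at this
        exact this
      simp [hc, N]
    · obtain ⟨c₀, hc₀, hmin⟩ := (isCompact_sphere (0 : Fin n → ℝ) 1).exists_isMinOn hne
        hNc.continuousOn
      have h0 : 0 < N c₀ := hNpos c₀ fun h => by simp [h] at hc₀
      refine ⟨(N c₀)⁻¹, inv_pos.2 h0, fun c => ?_⟩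
      rw [inv_mul_eq_div, le_div_iff₀ h0]
      rcases eq_or_ne c 0 with rfl | hc
      · simp [N]
      have h1 := hmin (show ‖c‖⁻¹ • c ∈ Metric.sphere (0 : Fin n → ℝ) 1 by simp [norm_smul, hc])
      have hcn : 0 < ‖c‖ := norm_pos_iff.2 hc
      simp only [mem_ofPred_eq, hNhom, abs_inv, abs_norm] at h1
      rwa [inv_mul_eq_div, le_div_iff₀ hcn, mul_comm] at h1
  refine ⟨C, hC, fun c i hi => ?_⟩
  have h1 := hCN fun k => c k
  have h2 := norm_le_pi_norm (fun k : Fin n => c k) ⟨i, hi⟩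
  simp only [Real.norm_eq_abs] at h2
  refine h2.trans (h1.trans_eq ?_)
  simp only [N, Finset.sum_range]

lemma integral_abs_nonneg (g : ℝ → ℝ) {a b : ℝ} (hab : a ≤ b) : 0 ≤ ∫ s in a..b, |g s| :=
  intervalIntegral.integral_nonneg hab fun _ _ => abs_nonneg _

lemma integral_abs_mono {g : ℝ → ℝ} (hg : ContinuousOn g (Ioi 0)) {a b c : ℝ} (ha : 0 < a)
    (hab : a ≤ b) (hbc : b ≤ c) : ∫ s in a..b, |g s| ≤ ∫ s in a..c, |g s| :=
  intervalIntegral.integral_mono_interval le_rfl hab hbc (Filter.Eventually.of_forall fun _ => abs_nonneg _)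
    (hg.abs.intervalIntegrable_of_pos ha (by linarith))

lemma exists_deriv_le_integral_abs (k : ℕ) :
    ∃ C : ℝ, 0 < C ∧ ∀ F : ℕ → ℝ → ℝ, DerivChain (k + 1) F → ∀ x l : ℝ, 0 < x → 0 < l →
      ∀ j ≤ k, ∀ y ∈ Icc x (x + l),
      l ^ j * |F j y| ≤ C * (l⁻¹ * (∫ s in x..x + l, |F 0 s|)
        + l ^ k * ∫ s in x..x + l, |F (k + 1) s|) := by
  obtain ⟨C₀, hC₀, hpoly⟩ := exists_coeff_le_integral_abs (k + 1)
  let K : ℝ := k.factorial * C₀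
  have hK : 0 < K := by positivity
  refine ⟨(k + 1) * K + 1, by positivity, fun F hF x l hx hl j hj y hy => ?_⟩
  set I₀ := ∫ s in x..x + l, |F 0 s|
  set I₁ := ∫ s in x..x + l, |F (k + 1) s|
  have hI₀ : 0 ≤ I₀ := integral_abs_nonneg _ (by linarith)
  have hI₁ : 0 ≤ I₁ := integral_abs_nonneg _ (by linarith)
  set S := l⁻¹ * I₀ + l ^ k * I₁
  have hS : 0 ≤ S := by positivity
  have hx' : 0 < x + l := by linarith
  have base : ∀ i ≤ k, l ^ i * |F i x| ≤ K * S := by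
    intro i hi
    have h1 := hpoly (fun i => F i x * l ^ i / i.factorial) i (by omega)
    have h2 : (∫ t in (0 : ℝ)..1, |∑ i ∈ Finset.range (k + 1), F i x * l ^ i / i.factorial * t ^ i|)
        ≤ S := by
      have hb : ∀ t ∈ Icc (0 : ℝ) 1,
          |∑ i ∈ Finset.range (k + 1), F i x * l ^ i / i.factorial * t ^ i|
            ≤ |F 0 (l * t + x)| + l ^ k * I₁ := by
        intro t ht
        have hlt : 0 ≤ l * t := mul_nonneg hl.le ht.1
        have hlt' : l * t ≤ l := mul_le_of_le_one_right hl.le ht.2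
        have h3 := DerivChain.taylor_right (j := 0) (n := k) (by simpa using hF) hx
          (x := l * t + x) (by linarith)
        simp only [zero_add, add_sub_cancel_right] at h3
        have h4 : ∑ i ∈ Finset.range (k + 1), F i x * l ^ i / i.factorial * t ^ i
            = ∑ i ∈ Finset.range (k + 1), F i x * (l * t) ^ i / i.factorial :=
          Finset.sum_congr rfl fun i _ => by rw [mul_pow]; ring
        have h5 : (l * t) ^ k * (∫ s in x..l * t + x, |F (k + 1) s|) ≤ l ^ k * I₁ := by
          gcongr
          · exact integral_abs_nonneg _ (by linarith)
          · exact integral_abs_mono hF.cont hx (by linarith) (by linarith)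
        rw [h4]
        have h6 := abs_sub_abs_le_abs_sub
          (∑ i ∈ Finset.range (k + 1), F i x * (l * t) ^ i / i.factorial) (F 0 (l * t + x))
        rw [abs_sub_comm] at h6
        linarith
      have hcomp : ContinuousOn (fun t => |F 0 (l * t + x)|) (uIcc 0 1) := by
        refine ((hF.continuousOn (Nat.zero_le _)).comp (by fun_prop) fun t ht => ?_).abs
        rw [uIcc_of_le zero_le_one] at ht
        have : 0 ≤ l * t := mul_nonneg hl.le ht.1
        exact show 0 < l * t + x by linarith
      calc _ ≤ ∫ t in (0 : ℝ)..1, (|F 0 (l * t + x)| + l ^ k * I₁) := by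
            refine intervalIntegral.integral_mono_on zero_le_one ?_ ?_ hb
            · exact Continuous.intervalIntegrable (by fun_prop) _ _
            · exact hcomp.intervalIntegrable.add intervalIntegrable_const
        _ = S := by
            rw [intervalIntegral.integral_add hcomp.intervalIntegrable intervalIntegrable_const,
              intervalIntegral.integral_comp_mul_add (fun s => |F 0 s|) hl.ne' x]
            simp [S, I₀, add_comm]
    have hfac : (0 : ℝ) < i.factorial := by positivity
    rw [abs_div, abs_mul, abs_of_pos hfac, abs_of_pos (pow_pos hl i), div_le_iff₀ hfac] at h1
    calc l ^ i * |F i x| = |F i x| * l ^ i := mul_comm _ _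
      _ ≤ C₀ * S * k.factorial := by
          refine h1.trans ?_
          gcongr
      _ = K * S := by simp only [K]; ring
  obtain ⟨n, rfl⟩ := Nat.exists_eq_add_of_le hj
  have h1 := hF.taylor_right hx hy.1
  have h2 : (y - x) ^ n * (∫ s in x..y, |F (j + n + 1) s|) ≤ l ^ n * I₁ := by
    gcongr
    · exact integral_abs_nonneg _ hy.1
    · linarith [hy.1]
    · linarith [hy.2]
    · exact integral_abs_mono hF.cont hx hy.1 hy.2
  have h3 : l ^ j * |∑ i ∈ Finset.range (n + 1), F (j + i) x * (y - x) ^ i / i.factorial|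
      ≤ (n + 1) * (K * S) := by
    calc _ ≤ l ^ j * ∑ i ∈ Finset.range (n + 1), |F (j + i) x| * l ^ i := by
          gcongr
          refine (Finset.abs_sum_le_sum_abs _ _).trans (Finset.sum_le_sum fun i _ => ?_)
          refine (abs_mul_div_factorial_le i).trans ?_
          rw [abs_pow, abs_of_nonneg (by linarith [hy.1] : 0 ≤ y - x)]
          gcongr
          · linarith [hy.1]
          · linarith [hy.2]
      _ = ∑ i ∈ Finset.range (n + 1), l ^ (j + i) * |F (j + i) x| := by
          rw [Finset.mul_sum]
          exact Finset.sum_congr rfl fun i _ => by rw [pow_add]; ring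
      _ ≤ ∑ i ∈ Finset.range (n + 1), K * S :=
          Finset.sum_le_sum fun i hi => base _ (by have := Finset.mem_range.1 hi; omega)
      _ = (n + 1) * (K * S) := by simp
  have h4 := abs_sub_abs_le_abs_sub (F j y)
    (∑ i ∈ Finset.range (n + 1), F (j + i) x * (y - x) ^ i / i.factorial)
  have h5 : l ^ (j + n) * I₁ ≤ S := by
    have : 0 ≤ l⁻¹ * I₀ := by positivity
    simp only [S]; linarith
  have h6 : ((n : ℝ) + 1) * (K * S) ≤ (((j + n : ℕ) : ℝ) + 1) * (K * S) := by
    gcongr; omega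
  have h7 : |F j y| ≤ |∑ i ∈ Finset.range (n + 1), F (j + i) x * (y - x) ^ i / i.factorial|
      + l ^ n * I₁ := by linarith
  calc l ^ j * |F j y| ≤ l ^ j * (|∑ i ∈ Finset.range (n + 1),
        F (j + i) x * (y - x) ^ i / i.factorial| + l ^ n * I₁) := by gcongr
    _ = l ^ j * |∑ i ∈ Finset.range (n + 1), F (j + i) x * (y - x) ^ i / i.factorial|
        + l ^ (j + n) * I₁ := by rw [pow_add]; ring
    _ ≤ _ := by linarith

/-- A positive continuous density on `(0, ∞)` of total mass at most one. -/
structure SubDensity (U : ℝ → ℝ) : Prop where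
  cont : ContinuousOn U (Ioi 0)
  pos : ∀ x, 0 < x → 0 < U x
  integrable : IntegrableOn U (Ioi 0)
  integral_le : ∫ x in Ioi 0, U x ≤ 1

namespace SubDensity

variable {U : ℝ → ℝ}

lemma integral_nonneg (h : SubDensity U) {a b : ℝ} (ha : 0 < a) (hab : a ≤ b) :
    0 ≤ ∫ s in a..b, U s :=
  intervalIntegral.integral_nonneg hab fun s hs => (h.pos s (ha.trans_le hs.1)).le

lemma integral_le_one (h : SubDensity U) {a b : ℝ} (ha : 0 < a) (hab : a ≤ b) :
    ∫ s in a..b, U s ≤ 1 := by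
  rw [intervalIntegral.integral_of_le hab]
  refine (setIntegral_mono_set h.integrable ?_ ?_).trans h.integral_le
  · exact (ae_restrict_iff' measurableSet_Ioi).2 (.of_forall fun x hx => (h.pos x hx).le)
  · exact LE.le.eventuallyLE (show Ioc a b ⊆ Ioi 0 from fun s hs => ha.trans hs.1)

lemma lintegral_le_one (h : SubDensity U) : ∫⁻ x in Ioi 0, ENNReal.ofReal (U x) ≤ 1 := by
  rw [← ofReal_integral_eq_lintegral_ofReal h.integrable
    ((ae_restrict_iff' measurableSet_Ioi).2 (.of_forall fun x hx => (h.pos x hx).le))]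
  exact ENNReal.ofReal_le_one.2 h.integral_le

lemma ofReal_integral (h : SubDensity U) {a b : ℝ} (ha : 0 < a) (hab : a ≤ b) :
    ENNReal.ofReal (∫ s in a..b, U s) = ∫⁻ s in Ico a b, ENNReal.ofReal (U s) := by
  have hsub : Ioc a b ⊆ Ioi 0 := fun s hs => ha.trans hs.1
  rw [intervalIntegral.integral_of_le hab, ofReal_integral_eq_lintegral_ofReal
    (h.integrable.mono_set hsub)
    ((ae_restrict_iff' measurableSet_Ioc).2 (.of_forall fun x hx => (h.pos x (hsub hx)).le)),
    restrict_Ico_eq_restrict_Ioc]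

end SubDensity

/-- The weighted mean of order `q` on `[x, x + l]` attached to the density `U`. -/
noncomputable def weightedMean (σ q A : ℝ) (U : ℝ → ℝ) (x l : ℝ) : ℝ :=
  A * x ^ (-σ) * ((∫ s in x..x + l, U s) / l) ^ q

lemma rpow_le_two_rpow_mul {x y : ℝ} (hx : 0 < x) (hxy : x ≤ y) (hy : y ≤ 2 * x) (e : ℝ) :
    y ^ e ≤ 2 ^ |e| * x ^ e := by
  have hy0 := hx.trans_le hxy
  rcases le_total 0 e with he | he
  · rw [abs_of_nonneg he, ← Real.mul_rpow zero_le_two hx.le]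
    exact Real.rpow_le_rpow hy0.le hy he
  · have h1 : y ^ e ≤ x ^ e := Real.rpow_le_rpow_of_nonpos hx hxy he
    have h2 : (1 : ℝ) ≤ 2 ^ |e| := Real.one_le_rpow one_le_two (abs_nonneg e)
    exact h1.trans (le_mul_of_one_le_left (by positivity) h2)

lemma rpow_le_two_rpow_mul' {x y : ℝ} (hx : 0 < x) (hxy : x ≤ y) (hy : y ≤ 2 * x) (e : ℝ) :
    x ^ e ≤ 2 ^ |e| * y ^ e := by
  have hy0 := hx.trans_le hxy
  have h := rpow_le_two_rpow_mul hx hxy hy (-e)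
  rw [abs_neg, Real.rpow_neg hx.le, Real.rpow_neg hy0.le, ← div_eq_mul_inv,
    le_div_iff₀ (by positivity), inv_mul_le_iff₀ (by positivity), mul_comm] at h
  exact h

/-- The `L¹` means of `t ^ σ * g` are controlled as if `‖t ^ σ g‖_{L^{1/q}} ≤ A`. -/
def MeanControl (σ q A : ℝ) (U g : ℝ → ℝ) : Prop :=
  ∀ x l, 0 < x → 0 < l →
    ∫ s in x..x + l, s ^ σ * |g s| ≤ A * l ^ (1 - q) * (∫ s in x..x + l, U s) ^ q

lemma MeanControl.integral_rpow_mul_le {σ q A : ℝ} {U g : ℝ → ℝ} (h : MeanControl σ q A U g)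
    (hg : ContinuousOn g (Ioi 0)) (hU : SubDensity U) (e : ℝ) {x l : ℝ} (hl : 0 < l)
    (hlx : l ≤ x) :
    ∫ s in x..x + l, s ^ e * |g s|
      ≤ 2 ^ |e - σ| * (x ^ e * (l * weightedMean σ q A U x l)) := by
  have hx := hl.trans_le hlx
  have hxl : 0 < x + l := by linarith
  have hcont : ∀ e : ℝ, ContinuousOn (fun s => s ^ e * |g s|) (Ioi 0) := fun e =>
    (continuousOn_id.rpow_const fun s hs => Or.inl (ne_of_gt hs)).mul hg.abs
  calc ∫ s in x..x + l, s ^ e * |g s|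
      ≤ ∫ s in x..x + l, 2 ^ |e - σ| * x ^ (e - σ) * (s ^ σ * |g s|) := by
        refine intervalIntegral.integral_mono_on (by linarith)
          ((hcont e).intervalIntegrable_of_pos hx hxl)
          (((hcont σ).const_mul _).intervalIntegrable_of_pos hx hxl) fun s hs => ?_
        have hs0 := hx.trans_le hs.1
        have h1 := rpow_le_two_rpow_mul hx hs.1 (by linarith [hs.2]) (e - σ)
        have h2 : s ^ e = s ^ (e - σ) * s ^ σ := by rw [← Real.rpow_add hs0]; ring_nf
        rw [h2, mul_assoc]
        gcongr
    _ ≤ 2 ^ |e - σ| * x ^ (e - σ) * (A * l ^ (1 - q) * (∫ s in x..x + l, U s) ^ q) := by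
        rw [intervalIntegral.integral_const_mul]
        gcongr
        exact h x l hx hl
    _ = _ := by
        have hu := hU.integral_nonneg hx (by linarith : x ≤ x + l)
        rw [weightedMean, Real.div_rpow hu hl.le, Real.rpow_sub hl, Real.rpow_one,
          Real.rpow_sub hx, Real.rpow_neg hx.le]
        field_simp

section weightedMean

variable {σ q A : ℝ} {U : ℝ → ℝ}

lemma weightedMean_nonneg (hU : SubDensity U) (hA : 0 < A) {x l : ℝ} (hx : 0 < x) (hl : 0 < l) :
    0 ≤ weightedMean σ q A U x l := by
  have := hU.integral_nonneg hx (by linarith : x ≤ x + l)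
  unfold weightedMean
  positivity

lemma weightedMean_self_le (hU : SubDensity U) (hA : 0 < A) (hq : 0 ≤ q) {x : ℝ} (hx : 0 < x) :
    weightedMean σ q A U x x ≤ A * x ^ (-(σ + q)) := by
  have h0 := hU.integral_nonneg hx (by linarith : x ≤ x + x)
  have h1 := hU.integral_le_one hx (by linarith : x ≤ x + x)
  calc weightedMean σ q A U x x ≤ A * x ^ (-σ) * (1 / x) ^ q := by
        unfold weightedMean; gcongr
    _ = _ := by
        rw [one_div, Real.inv_rpow hx.le, ← Real.rpow_neg hx.le, mul_assoc, ← Real.rpow_add hx]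
        ring_nf

lemma exists_weightedMean_bounds (hU : SubDensity U) (hA : 0 < A) (hq : 0 ≤ q) {R T : ℝ}
    (hR : 0 < R) (hRT : R ≤ T) :
    ∃ c C : ℝ, 0 < c ∧ 0 < C ∧ ∀ x ∈ Icc R T, ∀ l, 0 < l → l ≤ x →
      c ≤ weightedMean σ q A U x l ∧ weightedMean σ q A U x l ≤ C := by
  have hsub : Icc R (2 * T) ⊆ Ioi 0 := fun s hs => hR.trans_le hs.1
  have hne : (Icc R (2 * T)).Nonempty := nonempty_Icc.2 (by linarith)
  have hpow : ContinuousOn (fun x : ℝ => x ^ (-σ)) (Icc R (2 * T)) :=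
    continuousOn_id.rpow_const fun s hs => Or.inl (ne_of_gt (hsub hs))
  obtain ⟨y₁, hy₁, h₁⟩ := isCompact_Icc.exists_isMinOn hne (hU.cont.mono hsub)
  obtain ⟨y₂, hy₂, h₂⟩ := isCompact_Icc.exists_isMaxOn hne (hU.cont.mono hsub)
  obtain ⟨y₃, hy₃, h₃⟩ := isCompact_Icc.exists_isMinOn hne hpow
  obtain ⟨y₄, hy₄, h₄⟩ := isCompact_Icc.exists_isMaxOn hne hpow
  have p₁ := hU.pos y₁ (hsub hy₁)
  have p₂ := hU.pos y₂ (hsub hy₂)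
  have p₃ : 0 < y₃ ^ (-σ) := Real.rpow_pos_of_pos (hsub hy₃) _
  have p₄ : 0 < y₄ ^ (-σ) := Real.rpow_pos_of_pos (hsub hy₄) _
  refine ⟨A * y₃ ^ (-σ) * U y₁ ^ q, A * y₄ ^ (-σ) * U y₂ ^ q, by positivity, by positivity,
    fun x hx l hl hlx => ?_⟩
  have hx0 := hR.trans_le hx.1
  have hUint := hU.cont.intervalIntegrable_of_pos hx0 (by linarith : 0 < x + l)
  have hmem : ∀ s ∈ Icc x (x + l), s ∈ Icc R (2 * T) := fun s hs =>
    ⟨hx.1.trans hs.1, by linarith [hs.2, hx.2]⟩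
  have hlow : U y₁ ≤ (∫ s in x..x + l, U s) / l := by
    rw [le_div_iff₀ hl]
    calc U y₁ * l = ∫ _ in x..x + l, U y₁ := by simp [mul_comm]
      _ ≤ _ := intervalIntegral.integral_mono_on (by linarith) (by simp) hUint
        fun s hs => h₁ (hmem s hs)
  have hupp : (∫ s in x..x + l, U s) / l ≤ U y₂ := by
    rw [div_le_iff₀ hl]
    calc _ ≤ ∫ _ in x..x + l, U y₂ := intervalIntegral.integral_mono_on (by linarith) hUint
          (by simp) fun s hs => h₂ (hmem s hs)
      _ = U y₂ * l := by simp [mul_comm]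
  have hxm : x ∈ Icc R (2 * T) := hmem x ⟨le_rfl, by linarith⟩
  have h3 : y₃ ^ (-σ) ≤ x ^ (-σ) := h₃ hxm
  have h4 : x ^ (-σ) ≤ y₄ ^ (-σ) := h₄ hxm
  unfold weightedMean
  constructor
  · gcongr
  · have : 0 ≤ (∫ s in x..x + l, U s) / l := p₁.le.trans hlow
    gcongr

lemma continuousOn_weightedMean (hU : SubDensity U) (hq : 0 ≤ q) {x : ℝ} (hx : 0 < x) :
    ContinuousOn (weightedMean σ q A U x) (Ioc 0 x) := by
  have h1 : ContinuousOn (fun b => ∫ s in x..b, U s) (uIcc x (x + x)) :=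
    intervalIntegral.continuousOn_primitive_interval
      ((intervalIntegrable_iff' (by simp)).1 (hU.cont.intervalIntegrable_of_pos hx (by linarith)))
  have h2 : ContinuousOn (fun l => ∫ s in x..x + l, U s) (Ioc 0 x) := by
    refine h1.comp (by fun_prop : ContinuousOn (fun l => x + l) (Ioc 0 x)) fun l hl => ?_
    rw [uIcc_of_le (by linarith)]
    exact ⟨by linarith [hl.1], by linarith [hl.2]⟩
  exact continuousOn_const.mul ((h2.div continuousOn_id fun l hl => hl.1.ne').rpow_const
    fun _ _ => Or.inr hq)

end weightedMean

/-- A chain of derivatives whose extreme terms have weighted means controlled by `A` and `B`. -/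
structure ControlledChain (k : ℕ) (σ₀ σm q₀ qm A B : ℝ) (F : ℕ → ℝ → ℝ) (U V : ℝ → ℝ) :
    Prop where
  chain : DerivChain (k + 1) F
  denU : SubDensity U
  denV : SubDensity V
  posA : 0 < A
  posB : 0 < B
  boundA : MeanControl σ₀ q₀ A U (F 0)
  boundB : MeanControl σm qm B V (F (k + 1))

namespace ControlledChain

variable {k : ℕ} {σ₀ σm q₀ qm A B : ℝ} {F : ℕ → ℝ → ℝ} {U V : ℝ → ℝ}

lemma exists_local_bound (k : ℕ) (σ₀ σm q₀ qm : ℝ) :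
    ∃ C : ℝ, 0 < C ∧ ∀ A B F U V, ControlledChain k σ₀ σm q₀ qm A B F U V →
      ∀ x l : ℝ, 0 < l → l ≤ x → ∀ j ≤ k, ∀ y ∈ Icc x (x + l),
        l ^ j * |F j y| ≤ C * (weightedMean σ₀ q₀ A U x l
          + l ^ (k + 1) * weightedMean σm qm B V x l) := by
  obtain ⟨C, hC, H⟩ := exists_deriv_le_integral_abs k
  refine ⟨C * (2 ^ |σ₀| + 2 ^ |σm|), by positivity, fun A B F U V h x l hl hlx j hj y hy => ?_⟩
  have hx := hl.trans_le hlx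
  refine (H F h.chain x l hx hl j hj y hy).trans ?_
  have h0 := h.boundA.integral_rpow_mul_le (h.chain.continuousOn (Nat.zero_le _)) h.denU 0 hl hlx
  have h1 := h.boundB.integral_rpow_mul_le h.chain.cont h.denV 0 hl hlx
  simp only [Real.rpow_zero, one_mul, zero_sub, abs_neg] at h0 h1
  set a := weightedMean σ₀ q₀ A U x l
  set b := weightedMean σm qm B V x l
  have ha : 0 ≤ a := weightedMean_nonneg h.denU h.posA hx hl
  have hb : 0 ≤ b := weightedMean_nonneg h.denV h.posB hx hl
  rw [mul_assoc]
  gcongr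
  calc _ ≤ l⁻¹ * (2 ^ |σ₀| * (l * a)) + l ^ k * (2 ^ |σm| * (l * b)) := by gcongr
    _ = 2 ^ |σ₀| * a + 2 ^ |σm| * (l ^ (k + 1) * b) := by field_simp; ring
    _ ≤ (2 ^ |σ₀| + 2 ^ |σm|) * (a + l ^ (k + 1) * b) := by
      have p1 : (0 : ℝ) < 2 ^ |σ₀| := by positivity
      have p2 : (0 : ℝ) < 2 ^ |σm| := by positivity
      have p3 : 0 ≤ l ^ (k + 1) * b := by positivity
      nlinarith [mul_nonneg p1.le p3, mul_nonneg p2.le ha]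

lemma exists_scale_lower_bound (h : ControlledChain k σ₀ σm q₀ qm A B F U V) (hq₀ : 0 ≤ q₀)
    (hqm : 0 ≤ qm) {R T : ℝ} (hR : 0 < R) (hRT : R ≤ T) :
    ∃ c : ℝ, 0 < c ∧ ∀ x ∈ Icc R T, ∀ l, 0 < l → l ≤ x → l < c →
      l ^ (k + 1) * weightedMean σm qm B V x l < weightedMean σ₀ q₀ A U x l := by
  obtain ⟨c₀, _, hc₀, _, H₀⟩ := exists_weightedMean_bounds (σ := σ₀) h.denU h.posA hq₀ hR hRT
  obtain ⟨_, C₁, _, hC₁, H₁⟩ := exists_weightedMean_bounds (σ := σm) h.denV h.posB hqm hR hRT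
  refine ⟨min 1 (c₀ / C₁), by positivity, fun x hx l hl hlx hlc => ?_⟩
  have hl1 : l ≤ 1 := hlc.le.trans (min_le_left _ _)
  have hl2 : l < c₀ / C₁ := hlc.trans_le (min_le_right _ _)
  rw [lt_div_iff₀ hC₁] at hl2
  calc _ ≤ l * C₁ := by
        have hw := weightedMean_nonneg (σ := σm) (q := qm) h.denV h.posB (hl.trans_le hlx) hl
        have := (H₁ x hx l hl hlx).2
        gcongr
        rw [pow_succ]
        exact mul_le_of_le_one_left hl.le (pow_le_one₀ hl.le hl1)
    _ < c₀ := hl2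
    _ ≤ _ := (H₀ x hx l hl hlx).1

lemma exists_scale (h : ControlledChain k σ₀ σm q₀ qm A B F U V) (hq₀ : 0 ≤ q₀)
    (hqm : 0 ≤ qm) {x : ℝ} (hx : 0 < x) :
    ∃ l, 0 < l ∧ l ≤ x ∧
      (l ^ (k + 1) * weightedMean σm qm B V x l = weightedMean σ₀ q₀ A U x l ∨
        l = x ∧ l ^ (k + 1) * weightedMean σm qm B V x l ≤ weightedMean σ₀ q₀ A U x l) := by
  by_cases hle : x ^ (k + 1) * weightedMean σm qm B V x x ≤ weightedMean σ₀ q₀ A U x x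
  · exact ⟨x, hx, le_rfl, Or.inr ⟨rfl, hle⟩⟩
  obtain ⟨c, hc, H⟩ := h.exists_scale_lower_bound hq₀ hqm hx le_rfl
  have hm : 0 < min x (c / 2) := by positivity
  have hmx : min x (c / 2) ≤ x := min_le_left _ _
  have hsub : Icc (min x (c / 2)) x ⊆ Ioc 0 x := fun s hs => ⟨hm.trans_le hs.1, hs.2⟩
  have hlt := H x ⟨le_rfl, le_rfl⟩ _ hm hmx ((min_le_right _ _).trans_lt (by linarith))
  have hcont : ContinuousOn (fun l => weightedMean σ₀ q₀ A U x l
      - l ^ (k + 1) * weightedMean σm qm B V x l) (Icc (min x (c / 2)) x) :=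
    ((continuousOn_weightedMean h.denU hq₀ hx).sub
      ((by fun_prop : ContinuousOn (fun l : ℝ => l ^ (k + 1)) _).mul
        (continuousOn_weightedMean h.denV hqm hx))).mono hsub
  obtain ⟨l, hl, hl0⟩ := intermediate_value_Icc' hmx hcont
    (show (0 : ℝ) ∈ Icc _ _ from ⟨by push Not at hle; linarith, by linarith⟩)
  exact ⟨l, (hsub hl).1, hl.2, Or.inl (by simp only at hl0; linarith)⟩

lemma exists_partition (h : ControlledChain k σ₀ σm q₀ qm A B F U V) (hq₀ : 0 ≤ q₀)
    (hqm : 0 ≤ qm) {R : ℝ} (hR : 0 < R) :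
    ∃ x l : ℕ → ℝ, x 0 = R ∧ (∀ n, R ≤ x n) ∧ (∀ n, x (n + 1) = x n + l n) ∧
      (∀ n, 0 < l n) ∧ (∀ n, l n ≤ x n) ∧ (∀ T, ∃ n, T < x n) ∧
      ∀ n, (l n ^ (k + 1) * weightedMean σm qm B V (x n) (l n)
          = weightedMean σ₀ q₀ A U (x n) (l n) ∨
        l n = x n ∧ l n ^ (k + 1) * weightedMean σm qm B V (x n) (l n)
          ≤ weightedMean σ₀ q₀ A U (x n) (l n)) := by
  choose! L hL0 hLx hL using fun (x : ℝ) (hx : 0 < x) => h.exists_scale hq₀ hqm hx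
  let x : ℕ → ℝ := fun n => n.rec R fun _ y => y + L y
  have hsucc : ∀ n, x (n + 1) = x n + L (x n) := fun n => rfl
  have hx : ∀ n, R ≤ x n := by
    intro n
    induction n with
    | zero => exact le_rfl
    | succ n ih => rw [hsucc]; linarith [hL0 _ (hR.trans_le ih)]
  have hx0 : ∀ n, 0 < x n := fun n => hR.trans_le (hx n)
  refine ⟨x, fun n => L (x n), rfl, hx, hsucc, fun n => hL0 _ (hx0 n), fun n => hLx _ (hx0 n),
    fun T => ?_, fun n => hL _ (hx0 n)⟩
  by_contra! hT
  obtain ⟨c, hc, H⟩ := h.exists_scale_lower_bound hq₀ hqm hR ((hx 0).trans (hT 0))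
  have hstep : ∀ n, min c R ≤ L (x n) := by
    intro n
    rcases hL _ (hx0 n) with he | ⟨he, -⟩
    · refine (min_le_left _ _).trans (not_lt.1 fun hlt => ?_)
      exact (H _ ⟨hx n, hT n⟩ _ (hL0 _ (hx0 n)) (hLx _ (hx0 n)) hlt).ne he
    · rw [he]; exact (min_le_right _ _).trans (hx n)
  have hgrow : ∀ n : ℕ, n * min c R ≤ x n := by
    intro n
    induction n with
    | zero => simpa using (hx0 0).le
    | succ n ih => rw [hsucc]; push_cast; linarith [hstep n]
  obtain ⟨n, hn⟩ := exists_nat_gt (T / min c R)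
  rw [div_lt_iff₀ (by positivity)] at hn
  linarith [hgrow n, hT n]

lemma exists_balanced_bound (σ₀ σm : ℝ) {q₀ qm θ : ℝ} {k j : ℕ} (hj : j ≤ k)
    (hq₀ : 0 ≤ q₀) (hqm : 0 ≤ qm) (hθ0 : 0 ≤ θ) (hθ1 : θ ≤ 1) (hθ : θ * (k + 1) = j) :
    ∃ C : ℝ, 0 < C ∧ ∀ A B F U V, ControlledChain k σ₀ σm q₀ qm A B F U V →
      ∀ x l : ℝ, 0 < l → l ≤ x →
        l ^ (k + 1) * weightedMean σm qm B V x l = weightedMean σ₀ q₀ A U x l →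
        ∀ y ∈ Icc x (x + l), y ^ ((1 - θ) * σ₀ + θ * σm) * |F j y| ≤ C * (A ^ (1 - θ) * B ^ θ) *
          (((∫ s in x..x + l, U s) + ∫ s in x..x + l, V s) / l) ^ ((1 - θ) * q₀ + θ * qm) := by
  obtain ⟨C, hC, H⟩ := exists_local_bound k σ₀ σm q₀ qm
  set σ := (1 - θ) * σ₀ + θ * σm with hσ
  refine ⟨2 ^ |σ| * (2 * C), by positivity, fun A B F U V h x l hl hlx hbal y hy => ?_⟩
  have hx := hl.trans_le hlx
  have h1 := H A B F U V h x l hl hlx j hj y hy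
  have hu := h.denU.integral_nonneg hx (by linarith : x ≤ x + l)
  have hv := h.denV.integral_nonneg hx (by linarith : x ≤ x + l)
  set u := ∫ s in x..x + l, U s with hu_def
  set v := ∫ s in x..x + l, V s with hv_def
  have hA := h.posA
  have hB := h.posB
  have hθ1' : 0 ≤ 1 - θ := by linarith
  set w := (u + v) / l with hw_def
  have hw : 0 ≤ w := by positivity
  set a := weightedMean σ₀ q₀ A U x l with ha_def
  set b := weightedMean σm qm B V x l with hb_def
  have ha : 0 ≤ a := weightedMean_nonneg h.denU hA hx hl
  have hb : 0 ≤ b := weightedMean_nonneg h.denV hB hx hl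
  have haw : a ≤ A * x ^ (-σ₀) * w ^ q₀ := by
    rw [ha_def, weightedMean, ← hu_def, hw_def]
    gcongr
    linarith
  have hbw : b ≤ B * x ^ (-σm) * w ^ qm := by
    rw [hb_def, weightedMean, ← hv_def, hw_def]
    gcongr
    linarith
  have hgeom : a ≤ l ^ j * x ^ (-σ) * (A ^ (1 - θ) * B ^ θ) * w ^ ((1 - θ) * q₀ + θ * qm) := by
    calc a = a ^ (1 - θ) * (l ^ (k + 1) * b) ^ θ := by
          rw [hbal, ← Real.rpow_add_of_nonneg ha hθ1' hθ0]; simp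
      _ ≤ (A * x ^ (-σ₀) * w ^ q₀) ^ (1 - θ) * (l ^ (k + 1) * (B * x ^ (-σm) * w ^ qm)) ^ θ := by
          gcongr
      _ = _ := by
          have e1 : (l ^ (k + 1) : ℝ) ^ θ = l ^ j := by
            rw [← Real.rpow_natCast, ← Real.rpow_mul hl.le, ← Real.rpow_natCast l j, ← hθ]
            push_cast; ring_nf
          have e2 : x ^ (-σ) = x ^ (-σ₀ * (1 - θ)) * x ^ (-σm * θ) := by
            rw [← Real.rpow_add hx, hσ]; ring_nf
          have e3 : w ^ ((1 - θ) * q₀ + θ * qm) = w ^ (q₀ * (1 - θ)) * w ^ (qm * θ) := by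
            rw [← Real.rpow_add_of_nonneg hw (by positivity) (by positivity)]; ring_nf
          rw [Real.mul_rpow (by positivity) (by positivity),
            Real.mul_rpow (by positivity) (by positivity),
            Real.mul_rpow (by positivity) (by positivity),
            Real.mul_rpow (by positivity) (by positivity),
            Real.mul_rpow (by positivity) (by positivity), e1, e2, e3, ← Real.rpow_mul hx.le,
            ← Real.rpow_mul hx.le, ← Real.rpow_mul hw, ← Real.rpow_mul hw]
          ring
  have hlj : 0 < l ^ j := by positivity
  have h2 : |F j y| ≤ 2 * C * (x ^ (-σ) * (A ^ (1 - θ) * B ^ θ) * w ^ ((1 - θ) * q₀ + θ * qm)) := by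
    refine le_of_mul_le_mul_left ?_ hlj
    rw [hbal] at h1
    calc _ ≤ C * (a + a) := h1
      _ = 2 * C * a := by ring
      _ ≤ 2 * C * (l ^ j * x ^ (-σ) * (A ^ (1 - θ) * B ^ θ) * w ^ ((1 - θ) * q₀ + θ * qm)) := by
          gcongr
      _ = _ := by ring
  have h3 := rpow_le_two_rpow_mul hx hy.1 (by linarith [hy.2]) σ
  have hy0 := hx.trans_le hy.1
  calc y ^ σ * |F j y| ≤ (2 ^ |σ| * x ^ σ) *
        (2 * C * (x ^ (-σ) * (A ^ (1 - θ) * B ^ θ) * w ^ ((1 - θ) * q₀ + θ * qm))) := by gcongr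
    _ = (x ^ σ * x ^ (-σ)) * (2 ^ |σ| * (2 * C) * (A ^ (1 - θ) * B ^ θ) *
        w ^ ((1 - θ) * q₀ + θ * qm)) := by ring
    _ = _ := by rw [← Real.rpow_add hx, add_neg_cancel, Real.rpow_zero, one_mul]

lemma exists_unbalanced_bound (σ₀ σm σ : ℝ) {q₀ : ℝ} (qm : ℝ) {k j : ℕ} (hj : j ≤ k)
    (hq₀ : 0 ≤ q₀) :
    ∃ C : ℝ, 0 < C ∧ ∀ A B F U V, ControlledChain k σ₀ σm q₀ qm A B F U V →
      ∀ x : ℝ, 0 < x →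
        x ^ (k + 1) * weightedMean σm qm B V x x ≤ weightedMean σ₀ q₀ A U x x →
        ∀ y ∈ Icc x (x + x), y ^ σ * |F j y| ≤ C * A * y ^ (σ - j - σ₀ - q₀) := by
  obtain ⟨C, hC, H⟩ := exists_local_bound k σ₀ σm q₀ qm
  refine ⟨2 ^ |-j - (σ₀ + q₀)| * (2 * C), by positivity, fun A B F U V h x hx hle y hy => ?_⟩
  have h1 := H A B F U V h x x hx le_rfl j hj y hy
  have hA := h.posA
  have hy0 := hx.trans_le hy.1
  have ha := weightedMean_self_le (σ := σ₀) h.denU hA hq₀ hx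
  have h2 : |F j y| ≤ 2 * C * A * x ^ (-j - (σ₀ + q₀)) := by
    refine le_of_mul_le_mul_left ?_ (pow_pos hx j)
    calc _ ≤ C * (A * x ^ (-(σ₀ + q₀)) + A * x ^ (-(σ₀ + q₀))) := by
          refine h1.trans ?_
          exact mul_le_mul_of_nonneg_left (add_le_add ha (hle.trans ha)) hC.le
      _ = _ := by
          have : x ^ (-(j : ℝ) - (σ₀ + q₀)) = (x ^ j)⁻¹ * x ^ (-(σ₀ + q₀)) := by
            rw [← Real.rpow_natCast, ← Real.rpow_neg hx.le, ← Real.rpow_add hx]; ring_nf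
          rw [this]
          field_simp
          ring
  have h3 := rpow_le_two_rpow_mul' hx hy.1 (by linarith [hy.2]) (-j - (σ₀ + q₀))
  calc y ^ σ * |F j y|
      ≤ y ^ σ * (2 * C * A * (2 ^ |-j - (σ₀ + q₀)| * y ^ (-j - (σ₀ + q₀)))) := by
        gcongr
        exact h2.trans (by gcongr)
    _ = 2 ^ |-j - (σ₀ + q₀)| * (2 * C) * A * (y ^ σ * y ^ (-j - (σ₀ + q₀))) := by ring
    _ = _ := by rw [← Real.rpow_add hy0]; ring_nf

end ControlledChain

lemma lintegral_Ici_rpow_eq {R η : ℝ} (hR : 0 < R) (hη : 0 < η) :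
    ∫⁻ y in Ici R, ENNReal.ofReal (R ^ η * y ^ (-1 - η)) = ENNReal.ofReal η⁻¹ := by
  rw [← restrict_Ioi_eq_restrict_Ici, ← ofReal_integral_eq_lintegral_ofReal
    ((integrableOn_Ioi_rpow_of_lt (by linarith) hR).const_mul _), integral_const_mul,
    integral_Ioi_rpow_of_lt (by linarith) hR]
  · congr 1
    rw [show -1 - η + 1 = -η by ring, neg_div_neg_eq, mul_div_assoc', ← Real.rpow_add hR]
    simp
  · refine (ae_restrict_iff' measurableSet_Ioi).2 (.of_forall fun y hy => ?_)
    have : 0 < y := hR.trans hy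
    exact show 0 ≤ R ^ η * y ^ (-1 - η) by positivity

lemma lintegral_Ioc_rpow_eq {R η : ℝ} (hR : 0 < R) (hη : 0 < η) :
    ∫⁻ y in Ioc 0 R, ENNReal.ofReal (R ^ (-η) * y ^ (η - 1)) = ENNReal.ofReal η⁻¹ := by
  have hUint : IntervalIntegrable (fun y : ℝ => y ^ (η - 1)) volume 0 R :=
    intervalIntegral.intervalIntegrable_rpow' (by linarith)
  rw [← ofReal_integral_eq_lintegral_ofReal
    (((intervalIntegrable_iff_integrableOn_Ioc_of_le hR.le).1 hUint).const_mul _),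
    integral_const_mul, ← intervalIntegral.integral_of_le hR.le,
    integral_rpow (Or.inl (by linarith))]
  · congr 1
    rw [sub_add_cancel, Real.zero_rpow hη.ne', sub_zero, mul_div_assoc', ← Real.rpow_add hR]
    simp
  · refine (ae_restrict_iff' measurableSet_Ioc).2 (.of_forall fun y hy => ?_)
    have : 0 < y := hy.1
    exact show 0 ≤ R ^ (-η) * y ^ (η - 1) by positivity

lemma ofReal_le_ofReal_mul_rpow {a K w q : ℝ} {W : ℝ≥0∞} (hK : 0 ≤ K) (hw : 0 ≤ w) (hq : 0 ≤ q)
    (h : a ≤ K * w ^ q) (hW : ENNReal.ofReal w ≤ W) :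
    ENNReal.ofReal a ≤ ENNReal.ofReal K * W ^ q := by
  calc ENNReal.ofReal a ≤ ENNReal.ofReal (K * w ^ q) := ENNReal.ofReal_le_ofReal h
    _ = ENNReal.ofReal K * ENNReal.ofReal w ^ q := by
        rw [ENNReal.ofReal_mul hK, ENNReal.ofReal_rpow_of_nonneg hw hq]
    _ ≤ _ := by gcongr

namespace ControlledChain

variable {k : ℕ} {σ₀ σm q₀ qm A B : ℝ} {F : ℕ → ℝ → ℝ} {U V : ℝ → ℝ}

lemma exists_bound_above (σ₀ σm : ℝ) {q₀ qm θ : ℝ} {k j : ℕ} (hj : j ≤ k)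
    (hq₀ : 0 ≤ q₀) (hqm : 0 ≤ qm) (hq₀' : q₀ ≤ 1) (hqm' : qm ≤ 1)
    (hθ0 : 0 ≤ θ) (hθ1 : θ ≤ 1) (hθ : θ * (k + 1) = j)
    (hη : 0 < j + σ₀ + q₀ - ((1 - θ) * σ₀ + θ * σm) - ((1 - θ) * q₀ + θ * qm)) :
    ∃ C : ℝ, 0 < C ∧ ∃ K : ℝ≥0∞, K ≠ ⊤ ∧
      ∀ A B F U V, ControlledChain k σ₀ σm q₀ qm A B F U V → ∀ R : ℝ, 0 < R →
        A * R ^ (-(j + σ₀ + q₀ - ((1 - θ) * σ₀ + θ * σm) - ((1 - θ) * q₀ + θ * qm)))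
          ≤ A ^ (1 - θ) * B ^ θ →
        ∃ W : ℝ → ℝ≥0∞, Measurable W ∧ ∫⁻ y in Ioi 0, W y ≤ K ∧
          ∀ y, R ≤ y → ENNReal.ofReal (y ^ ((1 - θ) * σ₀ + θ * σm) * |F j y|)
            ≤ ENNReal.ofReal (C * (A ^ (1 - θ) * B ^ θ)) * W y ^ ((1 - θ) * q₀ + θ * qm) := by
  obtain ⟨C₁, hC₁, H₁⟩ := exists_balanced_bound σ₀ σm hj hq₀ hqm hθ0 hθ1 hθ
  obtain ⟨C₂, hC₂, H₂⟩ := exists_unbalanced_bound σ₀ σm ((1 - θ) * σ₀ + θ * σm) qm hj hq₀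
  have hq : 0 ≤ (1 - θ) * q₀ + θ * qm := by
    have : 0 ≤ 1 - θ := by linarith
    positivity
  have hq1 : (1 - θ) * q₀ + θ * qm ≤ 1 := by nlinarith
  set σ := (1 - θ) * σ₀ + θ * σm with hσ
  set q := (1 - θ) * q₀ + θ * qm with hq_def
  set η := j + σ₀ + q₀ - σ - q with hη_def
  refine ⟨C₁ + C₂, by positivity, 2 + ENNReal.ofReal η⁻¹, by finiteness,
    fun A B F U V h R hR hAR => ?_⟩
  obtain ⟨x, l, hx0, hxR, hxs, hl, hlx, hunb, hxl⟩ := h.exists_partition hq₀ hqm hR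
  have hA := h.posA
  have hB := h.posB
  have hxpos : ∀ n, 0 < x n := fun n => hR.trans_le (hxR n)
  have hmono : Monotone x := monotone_nat_of_le_succ fun n => by rw [hxs]; linarith [hl n]
  let w : ℕ → ℝ := fun n => ((∫ s in x n..x n + l n, U s) + ∫ s in x n..x n + l n, V s) / l n
  have hw : ∀ n, 0 ≤ w n := fun n => by
    have h1 := h.denU.integral_nonneg (hxpos n) (by linarith [hl n] : x n ≤ x n + l n)
    have h2 := h.denV.integral_nonneg (hxpos n) (by linarith [hl n] : x n ≤ x n + l n)
    have := hl n
    positivity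
  let W₁ : ℝ → ℝ≥0∞ := fun y => ∑' n, (Ico (x n) (x (n + 1))).indicator
    (fun _ => ENNReal.ofReal (w n)) y
  let W₂ : ℝ → ℝ≥0∞ := (Ici R).indicator fun y => ENNReal.ofReal (R ^ η * y ^ (-1 - η))
  have hW₁m : Measurable W₁ :=
    Measurable.tsum fun n => measurable_const.indicator measurableSet_Ico
  have hW₂m : Measurable W₂ := by
    refine Measurable.indicator ?_ measurableSet_Ici
    fun_prop
  have hW₁ : ∫⁻ y in Ioi 0, W₁ y ≤ 2 := by
    have hpart : ∀ G : ℝ → ℝ, SubDensity G →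
        ∑' n, ENNReal.ofReal (∫ s in x n..x n + l n, G s) ≤ 1 := by
      intro G hG
      calc _ = ∑' n, ∫⁻ s in Ico (x n) (x (n + 1)), ENNReal.ofReal (G s) := by
            congr with n
            rw [hG.ofReal_integral (hxpos n) (by linarith [hl n]), hxs]
        _ = ∫⁻ s in ⋃ n, Ico (x n) (x (n + 1)), ENNReal.ofReal (G s) :=
            (lintegral_iUnion (fun _ => measurableSet_Ico)
              hmono.pairwise_disjoint_on_Ico_succ _).symm
        _ ≤ ∫⁻ s in Ioi 0, ENNReal.ofReal (G s) :=
            lintegral_mono_set (iUnion_subset fun n s hs => (hxpos n).trans_le hs.1)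
        _ ≤ 1 := hG.lintegral_le_one
    calc ∫⁻ y in Ioi 0, W₁ y ≤ ∫⁻ y, W₁ y := setLIntegral_le_lintegral _ _
      _ = ∑' n, (ENNReal.ofReal (∫ s in x n..x n + l n, U s)
          + ENNReal.ofReal (∫ s in x n..x n + l n, V s)) := by
          rw [lintegral_tsum fun n => (measurable_const.indicator measurableSet_Ico).aemeasurable]
          congr with n
          rw [lintegral_indicator_const measurableSet_Ico, hxs, Real.volume_Ico,
            add_sub_cancel_left, ← ENNReal.ofReal_mul (hw n), div_mul_cancel₀ _ (hl n).ne',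
            ENNReal.ofReal_add (h.denU.integral_nonneg (hxpos n) (by linarith [hl n]))
              (h.denV.integral_nonneg (hxpos n) (by linarith [hl n]))]
      _ ≤ 1 + 1 := by
          rw [ENNReal.tsum_add]
          exact add_le_add (hpart U h.denU) (hpart V h.denV)
      _ = 2 := one_add_one_eq_two
  have hW₂ : ∫⁻ y in Ioi 0, W₂ y ≤ ENNReal.ofReal η⁻¹ := by
    refine (setLIntegral_le_lintegral _ _).trans ?_
    rw [lintegral_indicator measurableSet_Ici, lintegral_Ici_rpow_eq hR hη]
  refine ⟨fun y => W₁ y + W₂ y, hW₁m.add hW₂m, ?_, fun y hy => ?_⟩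
  · rw [lintegral_add_left hW₁m]
    exact add_le_add hW₁ hW₂
  have hy0 := hR.trans_le hy
  obtain ⟨n, hn, hn'⟩ : ∃ n, x n ≤ y ∧ y < x (n + 1) := by
    classical
    have hex := hunb y
    obtain ⟨n, hn⟩ : ∃ n, Nat.find hex = n + 1 := Nat.exists_eq_succ_of_ne_zero fun h0 => by
      have := Nat.find_spec hex
      rw [h0, hx0] at this
      linarith
    refine ⟨n, not_lt.1 (Nat.find_min hex (m := n) (by omega)), ?_⟩
    rw [← hn]; exact Nat.find_spec hex
  have hyI : y ∈ Icc (x n) (x n + l n) := ⟨hn, by rw [← hxs]; exact hn'.le⟩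
  have hD : 0 ≤ A ^ (1 - θ) * B ^ θ := by positivity
  rcases hxl n with hbal | ⟨heq, hle⟩
  · refine ofReal_le_ofReal_mul_rpow (w := w n) (by positivity) (hw n) hq ?_ ?_
    · refine (H₁ A B F U V h _ _ (hl n) (hlx n) hbal y hyI).trans ?_
      have := Real.rpow_nonneg (hw n) q
      gcongr
      linarith
    · refine le_trans ?_ le_self_add
      refine le_trans ?_ (ENNReal.le_tsum n)
      rw [indicator_of_mem (show y ∈ Ico (x n) (x (n + 1)) from ⟨hn, hn'⟩)]
  · rw [heq] at hle hyI
    refine ofReal_le_ofReal_mul_rpow (w := R ^ η * y ^ (-1 - η)) (by positivity) (by positivity)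
      hq ?_ ?_
    · refine (H₂ A B F U V h _ (hxpos n) hle y hyI).trans ?_
      have e1 : y ^ (σ - j - σ₀ - q₀) ≤ R ^ (-η) * (R ^ η * y ^ (-1 - η)) ^ q := by
        rw [Real.mul_rpow (by positivity) (by positivity), ← Real.rpow_mul hR.le,
          ← Real.rpow_mul hy0.le, ← mul_assoc, ← Real.rpow_add hR]
        have e2 : y ^ (σ - j - σ₀ - q₀) = y ^ (-(η * (1 - q))) * y ^ ((-1 - η) * q) := by
          rw [← Real.rpow_add hy0, hη_def]; ring_nf
        rw [e2, show -η + η * q = -(η * (1 - q)) by ring]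
        have : y ^ (-(η * (1 - q))) ≤ R ^ (-(η * (1 - q))) := by
          refine Real.rpow_le_rpow_of_nonpos hR hy ?_
          have : 0 ≤ η * (1 - q) := mul_nonneg hη.le (by linarith)
          linarith
        gcongr
      calc _ ≤ C₂ * A * (R ^ (-η) * (R ^ η * y ^ (-1 - η)) ^ q) := by gcongr
        _ = C₂ * (A * R ^ (-η)) * (R ^ η * y ^ (-1 - η)) ^ q := by ring
        _ ≤ _ := by
            gcongr
            linarith
    · refine le_trans ?_ le_add_self
      simp only [W₂]
      rw [indicator_of_mem (show y ∈ Ici R from hy)]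

end ControlledChain

lemma integral_le_of_dyadic {g : ℝ → ℝ} (hg : ContinuousOn g (Ioi 0)) (hg0 : ∀ s, 0 < s → 0 ≤ g s)
    {K e : ℝ} (he : 0 < e) (hK : 0 ≤ K) (h : ∀ y, 0 < y → ∫ s in y..y + y, g s ≤ K * y ^ e)
    {x R : ℝ} (hx : 0 < x) (hxR : x ≤ R) : ∫ s in x..R, g s ≤ K / (2 ^ e - 1) * R ^ e := by
  have h2 : 0 < (2 : ℝ) ^ e - 1 := sub_pos.2 (Real.one_lt_rpow one_lt_two he)
  have key : ∀ n : ℕ, ∀ R x : ℝ, 0 < x → x ≤ R → R ≤ 2 ^ n * x →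
      ∫ s in x..R, g s ≤ K / (2 ^ e - 1) * R ^ e := by
    intro n
    induction n with
    | zero =>
      intro R x hx hxR hR
      obtain rfl : x = R := le_antisymm hxR (by simpa using hR)
      rw [intervalIntegral.integral_same]
      positivity
    | succ n ih =>
      intro R x hx hxR hR
      have hR0 : 0 < R := hx.trans_le hxR
      have hR2 : 0 < R / 2 := by positivity
      have hhalf := h (R / 2) hR2
      rw [add_halves] at hhalf
      have hsplit : K / (2 ^ e - 1) * (R / 2) ^ e + K * (R / 2) ^ e = K / (2 ^ e - 1) * R ^ e := by
        rw [Real.div_rpow hR0.le zero_le_two]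
        field_simp
        ring
      rcases le_total x (R / 2) with hc | hc
      · rw [← intervalIntegral.integral_add_adjacent_intervals
          (hg.intervalIntegrable_of_pos hx hR2) (hg.intervalIntegrable_of_pos hR2 hR0), ← hsplit]
        refine add_le_add (ih _ _ hx hc ?_) hhalf
        rw [pow_succ] at hR
        linarith
      · refine (?_ : _ ≤ ∫ s in R / 2..R, g s).trans (hhalf.trans ?_)
        · refine intervalIntegral.integral_mono_interval hc hxR le_rfl ?_
            (hg.intervalIntegrable_of_pos hR2 hR0)
          exact (ae_restrict_iff' measurableSet_Ioc).2
            (.of_forall fun s hs => hg0 s (hR2.trans hs.1))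
        · rw [← hsplit]
          have : 0 ≤ K / (2 ^ e - 1) * (R / 2) ^ e := by positivity
          linarith
  obtain ⟨n, hn⟩ := pow_unbounded_of_one_lt (R / x) one_lt_two
  exact key n R x hx hxR ((div_lt_iff₀ hx).1 hn).le

namespace ControlledChain

variable {k : ℕ} {σ₀ σm q₀ qm A B : ℝ} {F : ℕ → ℝ → ℝ} {U V : ℝ → ℝ}

lemma exists_bound_below (σ₀ σm σ : ℝ) {q₀ qm q : ℝ} {k j : ℕ} (hj : j ≤ k)
    (hq₀ : 0 ≤ q₀) (hqm : 0 ≤ qm) (hq : 0 ≤ q) (hq1 : q ≤ 1) (hs : 0 < σ + q)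
    (hδ : σm + qm - (k + 1 - j) < σ + q) :
    ∃ C : ℝ, 0 < C ∧ ∃ K : ℝ≥0∞, K ≠ ⊤ ∧
      ∀ A B F U V, ControlledChain k σ₀ σm q₀ qm A B F U V → ∀ R : ℝ, 0 < R →
        R ^ (k + 1) * (B * R ^ (-(σm + qm))) = A * R ^ (-(σ₀ + q₀)) →
        ∃ W : ℝ → ℝ≥0∞, Measurable W ∧ ∫⁻ y in Ioi 0, W y ≤ K ∧
          ∀ y, 0 < y → y ≤ R → ENNReal.ofReal (y ^ σ * |F j y|)
            ≤ ENNReal.ofReal (C * (A * R ^ (-(j + σ₀ + q₀ - σ - q)))) * W y ^ q := by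
  obtain ⟨C₁, hC₁, H⟩ := exists_local_bound k σ₀ σm q₀ qm
  obtain ⟨γ, hγ, hγs⟩ := exists_between (max_lt hs hδ)
  obtain ⟨hγ0, hγm⟩ := max_lt_iff.1 hγ
  obtain ⟨n, rfl⟩ := Nat.exists_eq_add_of_le hj
  set e := n + 1 + γ - (σm + qm) with he_def
  have he : 0 < e := by push_cast at hγm; linarith
  set η := σ + q - γ with hη_def
  have hη : 0 < η := by linarith
  have h2e : 0 < (2 : ℝ) ^ e - 1 := sub_pos.2 (Real.one_lt_rpow one_lt_two he)
  set C₂ : ℝ := 2 ^ |n + γ - σm| / (2 ^ e - 1) with hC₂_def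
  have hC₂ : 0 < C₂ := by positivity
  refine ⟨(n + 1) * (2 * C₁) + C₂, by positivity, ENNReal.ofReal η⁻¹, by finiteness,
    fun A B F U V h R hR hbal => ?_⟩
  have hA := h.posA
  have hB := h.posB
  have hend : ∀ i ≤ j + n, R ^ i * |F i R| ≤ 2 * C₁ * (A * R ^ (-(σ₀ + q₀))) := by
    intro i hi
    refine (H A B F U V h R R hR le_rfl i hi R ⟨le_rfl, by linarith⟩).trans ?_
    have ha := weightedMean_self_le (σ := σ₀) h.denU hA hq₀ hR
    have hb := weightedMean_self_le (σ := σm) h.denV hB hqm hR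
    calc _ ≤ C₁ * (A * R ^ (-(σ₀ + q₀)) + R ^ (j + n + 1) * (B * R ^ (-(σm + qm)))) := by gcongr
      _ = _ := by rw [hbal]; ring
  have htail : ∀ y, 0 < y → y ≤ R →
      ∫ s in y..R, s ^ n * |F (j + n + 1) s| ≤ C₂ * (A * R ^ (-j - (σ₀ + q₀)) * (y / R) ^ (-γ)) := by
    intro y hy hyR
    have hcont : ∀ r : ℝ, ContinuousOn (fun s => s ^ r * |F (j + n + 1) s|) (Ioi 0) := fun r =>
      (continuousOn_id.rpow_const fun s hs => Or.inl (ne_of_gt hs)).mul h.chain.cont.abs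
    have hdy : ∫ s in y..R, s ^ (n + γ) * |F (j + n + 1) s|
        ≤ 2 ^ |n + γ - σm| * B / (2 ^ e - 1) * R ^ e := by
      refine integral_le_of_dyadic (hcont _) (fun s hs => ?_) he (by positivity) (fun z hz => ?_)
        hy hyR
      · have := Real.rpow_nonneg (le_of_lt hs) (n + γ); positivity
      refine (h.boundB.integral_rpow_mul_le h.chain.cont h.denV (n + γ) hz le_rfl).trans ?_
      rw [mul_assoc]
      refine mul_le_mul_of_nonneg_left ?_ (by positivity)
      calc _ ≤ z ^ (n + γ) * (z * (B * z ^ (-(σm + qm)))) := by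
            have := weightedMean_self_le (σ := σm) h.denV hB hqm hz
            gcongr
        _ = B * (z ^ (n + γ) * z ^ (1 : ℝ) * z ^ (-(σm + qm))) := by rw [Real.rpow_one]; ring
        _ = _ := by
            rw [← Real.rpow_add hz, ← Real.rpow_add hz, he_def]; ring_nf
    calc _ ≤ ∫ s in y..R, y ^ (-γ) * (s ^ (n + γ) * |F (j + n + 1) s|) := by
          refine intervalIntegral.integral_mono_on hyR ?_ ?_ fun s hs => ?_
          · exact ContinuousOn.intervalIntegrable_of_pos
              ((by fun_prop : ContinuousOn _ _).mul h.chain.cont.abs) hy hR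
          · exact ((hcont _).const_mul _).intervalIntegrable_of_pos hy hR
          · have hs0 := hy.trans_le hs.1
            rw [← mul_assoc, Real.rpow_add hs0, Real.rpow_natCast, Real.rpow_neg hy.le]
            have : 1 ≤ (y ^ γ)⁻¹ * s ^ γ := by
              rw [inv_mul_eq_div, one_le_div (by positivity)]
              exact Real.rpow_le_rpow hy.le hs.1 hγ0.le
            gcongr
            calc s ^ n = s ^ n * 1 := (mul_one _).symm
              _ ≤ s ^ n * ((y ^ γ)⁻¹ * s ^ γ) := by gcongr
              _ = _ := by ring
      _ ≤ y ^ (-γ) * (2 ^ |n + γ - σm| * B / (2 ^ e - 1) * R ^ e) := by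
          rw [intervalIntegral.integral_const_mul]
          gcongr
      _ = C₂ * (B * R ^ e * y ^ (-γ)) := by rw [hC₂_def]; ring
      _ = _ := by
          congr 1
          have e1 : A * R ^ (-j - (σ₀ + q₀)) = B * R ^ (n + 1 - (σm + qm)) := by
            rw [show (-(j : ℝ) - (σ₀ + q₀)) = -j + -(σ₀ + q₀) by ring, Real.rpow_add hR,
              mul_left_comm, ← hbal, ← Real.rpow_natCast, mul_left_comm _ B, mul_left_comm _ B,
              ← Real.rpow_add hR, ← Real.rpow_add hR]
            push_cast
            ring_nf
          rw [e1, Real.div_rpow hy.le hR.le, he_def,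
            show (n : ℝ) + 1 + γ - (σm + qm) = n + 1 - (σm + qm) + γ by ring, Real.rpow_add hR,
            Real.rpow_neg hR.le γ]
          field_simp
  have hmain : ∀ y, 0 < y → y ≤ R →
      |F j y| ≤ ((n + 1) * (2 * C₁) + C₂) * (A * R ^ (-j - (σ₀ + q₀)) * (y / R) ^ (-γ)) := by
    intro y hy hyR
    have h1 := h.chain.taylor_left hy hyR
    have h2 := htail y hy hyR
    have h3 := abs_sub_abs_le_abs_sub (F j y)
      (∑ i ∈ Finset.range (n + 1), F (j + i) R * (y - R) ^ i / i.factorial)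
    have hone : 1 ≤ (y / R) ^ (-γ) :=
      Real.one_le_rpow_of_pos_of_le_one_of_nonpos (by positivity) ((div_le_one hR).2 hyR)
        (by linarith)
    have h4 : |∑ i ∈ Finset.range (n + 1), F (j + i) R * (y - R) ^ i / i.factorial|
        ≤ (n + 1) * (2 * C₁) * (A * R ^ (-j - (σ₀ + q₀)) * 1) := by
      calc _ ≤ ∑ i ∈ Finset.range (n + 1), 2 * C₁ * (A * R ^ (-j - (σ₀ + q₀))) := by
            refine (Finset.abs_sum_le_sum_abs _ _).trans (Finset.sum_le_sum fun i hi => ?_)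
            refine (abs_mul_div_factorial_le i).trans ?_
            have hb := hend (j + i) (by have := Finset.mem_range.1 hi; omega)
            refine le_of_mul_le_mul_left ?_ (pow_pos hR j)
            calc _ ≤ R ^ j * (|F (j + i) R| * R ^ i) := by
                  rw [abs_pow, abs_sub_comm, abs_of_nonneg (by linarith : 0 ≤ R - y)]
                  gcongr
                  linarith
              _ = R ^ (j + i) * |F (j + i) R| := by rw [pow_add]; ring
              _ ≤ _ := hb
              _ = _ := by
                  rw [sub_eq_add_neg, Real.rpow_add hR, Real.rpow_neg hR.le (j : ℝ), Real.rpow_natCast]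
                  field_simp
        _ = _ := by simp; ring
    have h5 : (n + 1) * (2 * C₁) * (A * R ^ (-j - (σ₀ + q₀)) * 1)
        ≤ (n + 1) * (2 * C₁) * (A * R ^ (-j - (σ₀ + q₀)) * (y / R) ^ (-γ)) := by gcongr
    rw [add_mul]
    linarith
  refine ⟨(Ioc 0 R).indicator fun y => ENNReal.ofReal (R ^ (-η) * y ^ (η - 1)), ?_, ?_,
    fun y hy hyR => ?_⟩
  · refine Measurable.indicator ?_ measurableSet_Ioc
    fun_prop
  · refine (setLIntegral_le_lintegral _ _).trans ?_
    rw [lintegral_indicator measurableSet_Ioc, lintegral_Ioc_rpow_eq hR hη]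
  refine ofReal_le_ofReal_mul_rpow (w := R ^ (-η) * y ^ (η - 1)) (by positivity) (by positivity)
    hq ?_ (by rw [indicator_of_mem (show y ∈ Ioc 0 R from ⟨hy, hyR⟩)])
  calc y ^ σ * |F j y| ≤ y ^ σ * (((n + 1) * (2 * C₁) + C₂) *
        (A * R ^ (-j - (σ₀ + q₀)) * (y / R) ^ (-γ))) := by
        gcongr
        exact hmain y hy hyR
    _ = ((n + 1) * (2 * C₁) + C₂) * A *
        (R ^ (-j - (σ₀ + q₀)) * (y / R) ^ (-γ) * y ^ σ) := by ring
    _ ≤ ((n + 1) * (2 * C₁) + C₂) * A *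
        (R ^ (-(j + σ₀ + q₀ - σ - q)) * (R ^ (-η) * y ^ (η - 1)) ^ q) := by
        gcongr ?_ * ?_
        rw [Real.div_rpow hy.le hR.le, Real.mul_rpow (by positivity) (by positivity),
          ← Real.rpow_mul hR.le, ← Real.rpow_mul hy.le, div_eq_mul_inv, ← Real.rpow_neg hR.le]
        have e1 : R ^ (-j - (σ₀ + q₀)) * (y ^ (-γ) * R ^ (- -γ)) * y ^ σ
            = R ^ (-j - (σ₀ + q₀) + γ) * y ^ ((η - 1) * q) * y ^ (η * (1 - q)) := by
          rw [mul_assoc, mul_assoc, mul_assoc, ← Real.rpow_add hy, Real.rpow_add hR, neg_neg]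
          rw [show y ^ ((η - 1) * q + η * (1 - q)) = y ^ (-γ) * y ^ σ by
            rw [← Real.rpow_add hy, hη_def]; ring_nf]
          ring
        have e2 : R ^ (-(j + σ₀ + q₀ - σ - q)) * (R ^ (-η * q) * y ^ ((η - 1) * q))
            = R ^ (-j - (σ₀ + q₀) + γ) * y ^ ((η - 1) * q) * R ^ (η * (1 - q)) := by
          rw [← mul_assoc, ← Real.rpow_add hR, mul_right_comm, ← Real.rpow_add hR, hη_def]
          ring_nf
        rw [e1, e2]
        have : 0 ≤ η * (1 - q) := mul_nonneg hη.le (by linarith)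
        gcongr
    _ = _ := by ring

/-- The pointwise form of the interpolation inequality: the `j`-th derivative is dominated by a
power of a density of controlled mass. -/
theorem exists_bound (σ₀ σm : ℝ) {q₀ qm θ : ℝ} {k j : ℕ} (hj : j ≤ k)
    (hq₀ : 0 ≤ q₀) (hqm : 0 ≤ qm) (hq₀' : q₀ ≤ 1) (hqm' : qm ≤ 1)
    (hθ0 : 0 < θ) (hθ1 : θ < 1) (hθ : θ * (k + 1) = j)
    (hδ : 0 < k + 1 - (σm + qm) + (σ₀ + q₀))
    (hs : 0 < (1 - θ) * σ₀ + θ * σm + ((1 - θ) * q₀ + θ * qm)) :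
    ∃ C : ℝ, 0 < C ∧ ∃ K : ℝ≥0∞, K ≠ ⊤ ∧
      ∀ A B F U V, ControlledChain k σ₀ σm q₀ qm A B F U V →
        ∃ W : ℝ → ℝ≥0∞, ∫⁻ y in Ioi 0, W y ≤ K ∧
          ∀ y, 0 < y → ENNReal.ofReal (y ^ ((1 - θ) * σ₀ + θ * σm) * |F j y|)
            ≤ ENNReal.ofReal (C * (A ^ (1 - θ) * B ^ θ)) * W y ^ ((1 - θ) * q₀ + θ * qm) := by
  have hη : j + σ₀ + q₀ - ((1 - θ) * σ₀ + θ * σm) - ((1 - θ) * q₀ + θ * qm)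
      = θ * (k + 1 - (σm + qm) + (σ₀ + q₀)) := by rw [← hθ]; ring
  have hη0 : 0 < j + σ₀ + q₀ - ((1 - θ) * σ₀ + θ * σm) - ((1 - θ) * q₀ + θ * qm) := by
    rw [hη]; positivity
  have hθ' : 0 < 1 - θ := by linarith
  have hq : 0 ≤ (1 - θ) * q₀ + θ * qm := by positivity
  have hq1 : (1 - θ) * q₀ + θ * qm ≤ 1 := by nlinarith
  obtain ⟨C₁, hC₁, K₁, hK₁, H₁⟩ :=
    exists_bound_above σ₀ σm hj hq₀ hqm hq₀' hqm' hθ0.le hθ1.le hθ hη0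
  obtain ⟨C₂, hC₂, K₂, hK₂, H₂⟩ := exists_bound_below σ₀ σm ((1 - θ) * σ₀ + θ * σm) hj hq₀ hqm hq
    hq1 hs (by
      have : 0 < (1 - θ) * (k + 1 - (σm + qm) + (σ₀ + q₀)) := by positivity
      rw [← hθ]; linarith)
  set σ := (1 - θ) * σ₀ + θ * σm
  set q := (1 - θ) * q₀ + θ * qm
  set d := k + 1 - (σm + qm) + (σ₀ + q₀) with hd_def
  refine ⟨C₁ + C₂, by positivity, K₁ + K₂, by finiteness, fun A B F U V h => ?_⟩
  have hA := h.posA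
  have hB := h.posB
  have hD : 0 < A ^ (1 - θ) * B ^ θ := by positivity
  set R := (A / B) ^ (1 / d)
  have hR : 0 < R := by positivity
  have hRd : R ^ d = A / B := by
    rw [← Real.rpow_mul (by positivity), one_div, inv_mul_cancel₀ hδ.ne', Real.rpow_one]
  have hAR : A * R ^ (-(j + σ₀ + q₀ - σ - q)) = A ^ (1 - θ) * B ^ θ := by
    rw [hη, show -(θ * d) = d * -θ by ring, Real.rpow_mul hR.le, hRd,
      Real.rpow_neg (by positivity), Real.div_rpow hA.le hB.le, Real.rpow_sub hA, Real.rpow_one]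
    field_simp
  have hbal : R ^ (k + 1) * (B * R ^ (-(σm + qm))) = A * R ^ (-(σ₀ + q₀)) := by
    have e1 : R ^ (k + 1) * R ^ (-(σm + qm)) = R ^ d * R ^ (-(σ₀ + q₀)) := by
      rw [← Real.rpow_natCast, ← Real.rpow_add hR, ← Real.rpow_add hR, hd_def]
      push_cast
      ring_nf
    rw [mul_left_comm, e1, hRd]
    field_simp
  obtain ⟨W₁, hW₁m, hW₁, hb₁⟩ := H₁ A B F U V h R hR hAR.le
  obtain ⟨W₂, -, hW₂, hb₂⟩ := H₂ A B F U V h R hR hbal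
  refine ⟨fun y => W₁ y + W₂ y, ?_, fun y hy => ?_⟩
  · rw [lintegral_add_left hW₁m]
    exact add_le_add hW₁ hW₂
  rcases le_total R y with hy' | hy'
  · refine (hb₁ y hy').trans ?_
    gcongr
    · linarith
    · exact le_self_add
  · refine (hb₂ y hy hy').trans ?_
    rw [hAR]
    gcongr
    · linarith
    · exact le_add_self

end ControlledChain

lemma continuousOn_rpow_mul {g : ℝ → ℝ} (hg : ContinuousOn g (Ioi 0)) (σ : ℝ) :
    ContinuousOn (fun x => x ^ σ * g x) (Ioi 0) :=
  (continuousOn_id.rpow_const fun _ hs => Or.inl (ne_of_gt hs)).mul hg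

lemma MeanControl.of_eLpNorm_le {σ A : ℝ} {p : ℝ≥0∞} {U g : ℝ → ℝ} (hp : 1 ≤ p) (hA : 0 < A)
    (hU : SubDensity U) (hg : ContinuousOn g (Ioi 0))
    (H : ∀ x l, 0 < x → 0 < l →
      eLpNorm (fun s => s ^ σ * g s) p (volume.restrict (Ioc x (x + l)))
        ≤ ENNReal.ofReal (A * (∫ s in x..x + l, U s) ^ (1 / p).toReal)) :
    MeanControl σ (1 / p).toReal A U g := by
  intro x l hx hl
  have hsub : Ioc x (x + l) ⊆ Ioi 0 := fun s hs => hx.trans hs.1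
  have hmeas : AEStronglyMeasurable (fun s => s ^ σ * g s) (volume.restrict (Ioc x (x + l))) :=
    ((continuousOn_rpow_mul hg σ).mono hsub).aestronglyMeasurable measurableSet_Ioc
  have hu := hU.integral_nonneg hx (by linarith : x ≤ x + l)
  have h1 := (eLpNorm_le_eLpNorm_mul_rpow_measure_univ hp hmeas).trans
    (mul_le_mul_left (H x l hx hl) _)
  have h2 : (1 : ℝ≥0∞).toReal = 1 := rfl
  rw [Measure.restrict_apply_univ, Real.volume_Ioc, add_sub_cancel_left,
    ENNReal.ofReal_rpow_of_pos hl, ← ENNReal.ofReal_mul (by positivity),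
    eLpNorm_one_eq_lintegral_enorm, h2, one_div_one] at h1
  have h3 : ∫ s in x..x + l, s ^ σ * |g s| = ∫ s in Ioc x (x + l), ‖s ^ σ * g s‖ := by
    rw [intervalIntegral.integral_of_le (by linarith)]
    refine setIntegral_congr_fun measurableSet_Ioc fun s hs => ?_
    simp only [Real.norm_eq_abs, abs_mul, abs_of_pos (Real.rpow_pos_of_pos (hsub hs) σ)]
  rw [h3, integral_norm_eq_lintegral_enorm hmeas]
  refine (ENNReal.toReal_le_of_le_ofReal (by positivity) h1).trans_eq ?_
  simp only [one_div, ENNReal.toReal_inv]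
  ring

lemma subDensity_exp_neg : SubDensity fun x => Real.exp (-x) where
  cont := by fun_prop
  pos x _ := Real.exp_pos _
  integrable := by simpa using exp_neg_integrableOn_Ioi 0 one_pos
  integral_le := integral_exp_neg_Ioi_zero.le

lemma exists_subDensity_meanControl {σ A : ℝ} {p : ℝ≥0∞} {g : ℝ → ℝ} (hp : 1 ≤ p) (hA : 0 < A)
    (hg : ContinuousOn g (Ioi 0)) (h : wLp σ p g < ENNReal.ofReal A) :
    ∃ U, SubDensity U ∧ MeanControl σ (1 / p).toReal A U g := by
  rcases eq_or_ne p ⊤ with rfl | hp'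
  · refine ⟨_, subDensity_exp_neg, .of_eLpNorm_le hp hA subDensity_exp_neg hg fun x l hx hl => ?_⟩
    simp only [one_div, ENNReal.inv_top, ENNReal.toReal_zero, Real.rpow_zero, mul_one]
    refine (eLpNorm_mono_measure _ (Measure.restrict_mono_set _ ?_)).trans h.le
    exact fun s hs => hx.trans hs.1
  have hp0 : p ≠ 0 := (zero_lt_one.trans_le hp).ne'
  set r := p.toReal with hr
  have hr0 : 0 < r := ENNReal.toReal_pos hp0 hp'
  set φ : ℝ → ℝ := fun x => |x ^ σ * g x| ^ r with hφ
  have hφc : ContinuousOn φ (Ioi 0) :=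
    (continuousOn_rpow_mul hg σ).abs.rpow_const fun _ _ => Or.inr hr0.le
  have hφ0 : ∀ x, 0 ≤ φ x := fun x => by positivity
  have henorm : ∀ x, ‖x ^ σ * g x‖ₑ ^ r = ENNReal.ofReal (φ x) := fun x => by
    rw [Real.enorm_eq_ofReal_abs, ENNReal.ofReal_rpow_of_nonneg (abs_nonneg _) hr0.le]
  have hnorm : ∀ s : Set ℝ, eLpNorm (fun x => x ^ σ * g x) p (volume.restrict s)
      = (∫⁻ x in s, ENNReal.ofReal (φ x)) ^ (1 / r) := fun s => by
    rw [eLpNorm_eq_lintegral_rpow_enorm_toReal hp0 hp']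
    simp_rw [← hr, henorm]
  have hlt : ∫⁻ x in Ioi 0, ENNReal.ofReal (φ x) < ENNReal.ofReal (A ^ r) := by
    rw [wLp, hnorm, one_div, ENNReal.rpow_inv_lt_iff hr0, ENNReal.ofReal_rpow_of_pos hA] at h
    exact h
  have hφi : IntegrableOn φ (Ioi 0) :=
    ⟨hφc.aestronglyMeasurable measurableSet_Ioi,
      (hasFiniteIntegral_iff_ofReal (.of_forall hφ0)).2 (hlt.trans ENNReal.ofReal_lt_top)⟩
  have hI : ∫ x in Ioi 0, φ x < A ^ r := by
    rw [← ofReal_integral_eq_lintegral_ofReal hφi (.of_forall hφ0)] at hlt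
    exact (ENNReal.ofReal_lt_ofReal_iff (by positivity)).1 hlt
  set c := 1 - (A ^ r)⁻¹ * ∫ x in Ioi 0, φ x with hc
  have hc0 : 0 < c := by
    rw [hc, sub_pos, inv_mul_lt_iff₀ (by positivity), mul_one]
    exact hI
  have hE := subDensity_exp_neg
  have hU : SubDensity fun x => (A ^ r)⁻¹ * φ x + c * Real.exp (-x) :=
    { cont := (hφc.const_mul _).add (hE.cont.const_mul _)
      pos x _ := by have := hφ0 x; positivity
      integrable := (hφi.const_mul _).add (hE.integrable.const_mul _)
      integral_le := by
        rw [integral_add (hφi.const_mul _) (hE.integrable.const_mul _), integral_const_mul,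
          integral_const_mul, integral_exp_neg_Ioi_zero, hc]
        linarith }
  refine ⟨_, hU, .of_eLpNorm_le hp hA hU hg fun x l hx hl => ?_⟩
  have hsub : Ioc x (x + l) ⊆ Ioi 0 := fun s hs => hx.trans hs.1
  have hle : x ≤ x + l := by linarith
  rw [hnorm, ← ofReal_integral_eq_lintegral_ofReal (hφi.mono_set hsub) (.of_forall hφ0),
    ENNReal.ofReal_rpow_of_nonneg (integral_nonneg hφ0) (by positivity), one_div, one_div,
    ENNReal.toReal_inv, ← hr]
  refine ENNReal.ofReal_le_ofReal ?_
  have hu := hU.integral_nonneg hx hle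
  have hA' : ∀ u : ℝ, 0 ≤ u → A * u ^ r⁻¹ = (A ^ r * u) ^ r⁻¹ := fun u hu => by
    rw [Real.mul_rpow (by positivity) hu, ← Real.rpow_mul hA.le, mul_inv_cancel₀ hr0.ne',
      Real.rpow_one]
  rw [hA' _ hu]
  refine Real.rpow_le_rpow (integral_nonneg hφ0) ?_ (by positivity)
  rw [intervalIntegral.integral_of_le hle, ← integral_const_mul]
  refine setIntegral_mono_on (hφi.mono_set hsub) ((hU.integrable.mono_set hsub).const_mul _)
    measurableSet_Ioc fun s _ => ?_
  have : A ^ r * ((A ^ r)⁻¹ * φ s + c * Real.exp (-s)) = φ s + A ^ r * (c * Real.exp (-s)) := by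
    field_simp
  rw [this]
  have : 0 ≤ A ^ r * (c * Real.exp (-s)) := by positivity
  linarith

lemma eLpNorm_inv_le_of_enorm_le {h : ℝ → ℝ} {W : ℝ → ℝ≥0∞} {M K Q : ℝ≥0∞} (hM : M ≠ ⊤)
    (hQ : Q ≠ ⊤) (hW : ∫⁻ y in Ioi 0, W y ≤ K)
    (H : ∀ y, 0 < y → ‖h y‖ₑ ≤ M * W y ^ Q.toReal) :
    eLpNorm h Q⁻¹ (volume.restrict (Ioi 0)) ≤ M * K ^ Q.toReal := by
  have hae : ∀ᵐ y ∂volume.restrict (Ioi (0 : ℝ)), ‖h y‖ₑ ≤ M * W y ^ Q.toReal :=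
    (ae_restrict_iff' measurableSet_Ioi).2 (.of_forall H)
  rcases eq_or_ne Q 0 with rfl | hQ0
  · simp only [ENNReal.toReal_zero, ENNReal.rpow_zero, mul_one, ENNReal.inv_zero,
      eLpNorm_exponent_top] at hae ⊢
    exact eLpNormEssSup_le_of_ae_enorm_bound hae
  have hq := ENNReal.toReal_pos hQ0 hQ
  have hMq : M ^ Q.toReal⁻¹ ≠ ⊤ := ENNReal.rpow_ne_top_of_nonneg (by positivity) hM
  rw [eLpNorm_eq_lintegral_rpow_enorm_toReal (ENNReal.inv_ne_zero.2 hQ) (ENNReal.inv_ne_top.2 hQ0),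
    ENNReal.toReal_inv, one_div, inv_inv]
  calc (∫⁻ y in Ioi 0, ‖h y‖ₑ ^ Q.toReal⁻¹) ^ Q.toReal
      ≤ (∫⁻ y in Ioi 0, M ^ Q.toReal⁻¹ * W y) ^ Q.toReal := by
        refine ENNReal.rpow_le_rpow (lintegral_mono_ae ?_) hq.le
        filter_upwards [hae] with y hy
        refine (ENNReal.rpow_le_rpow hy (by positivity)).trans_eq ?_
        rw [ENNReal.mul_rpow_of_nonneg _ _ (by positivity), ENNReal.rpow_rpow_inv hq.ne']
    _ ≤ (M ^ Q.toReal⁻¹ * K) ^ Q.toReal := by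
        rw [lintegral_const_mul' _ _ hMq]
        gcongr
    _ = M * K ^ Q.toReal := by
        rw [ENNReal.mul_rpow_of_nonneg _ _ hq.le, ENNReal.rpow_inv_rpow hq.ne']

lemma ContDiffOn.derivChain_iteratedDeriv {m : ℕ} {f : ℝ → ℝ} (hf : ContDiffOn ℝ m f (Ioi 0)) :
    DerivChain m fun i => iteratedDeriv i f where
  deriv i hi x hx := by
    have h1 := (hf.differentiableOn_iteratedDerivWithin (m := i) (by exact_mod_cast hi)
      isOpen_Ioi.uniqueDiffOn).congr fun y hy => (iteratedDerivWithin_of_isOpen isOpen_Ioi hy).symm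
    have h2 := (h1.differentiableAt (Ioi_mem_nhds hx)).hasDerivAt
    rwa [← iteratedDeriv_succ] at h2
  cont := (hf.continuousOn_iteratedDerivWithin le_rfl isOpen_Ioi.uniqueDiffOn).congr
    fun _ hy => (iteratedDerivWithin_of_isOpen isOpen_Ioi hy).symm

lemma toReal_add_ofReal_lt {a : ℝ≥0∞} (ha : a < ⊤) {ε : ℝ} (hε : 0 < ε) :
    a < ENNReal.ofReal (a.toReal + ε) := by
  rw [ENNReal.lt_ofReal_iff_toReal_lt ha.ne]
  linarith

/-- The multiplicative estimate for a single intermediate derivative. -/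
lemma exists_wLp_iteratedDeriv_le {k j : ℕ} (hj : j ≤ k) {σ₀ σm θ : ℝ} {p₀ pm Q : ℝ≥0∞}
    (hp₀ : 1 ≤ p₀) (hpm : 1 ≤ pm) (hQ : Q ≠ ⊤)
    (hQq : Q.toReal = (1 - θ) * (1 / p₀).toReal + θ * (1 / pm).toReal)
    (hθ0 : 0 < θ) (hθ1 : θ < 1) (hθ : θ * (k + 1) = j)
    (hδ : 0 < k + 1 - (σm + (1 / pm).toReal) + (σ₀ + (1 / p₀).toReal))
    (hs : 0 < (1 - θ) * σ₀ + θ * σm + Q.toReal) :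
    ∃ C : ℝ≥0∞, C ≠ ⊤ ∧ ∀ f : ℝ → ℝ, ContDiffOn ℝ (k + 1 : ℕ) f (Ioi 0) →
      wLp σ₀ p₀ f < ⊤ → wLp σm pm (iteratedDeriv (k + 1) f) < ⊤ →
      wLp ((1 - θ) * σ₀ + θ * σm) Q⁻¹ (iteratedDeriv j f)
        ≤ C * wLp σ₀ p₀ f ^ (1 - θ) * wLp σm pm (iteratedDeriv (k + 1) f) ^ θ := by
  have hle : ∀ {p : ℝ≥0∞}, 1 ≤ p → (1 / p).toReal ≤ 1 := fun hp => by
    simpa using ENNReal.toReal_mono ENNReal.one_ne_top (ENNReal.inv_le_one.2 hp)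
  rw [hQq] at hs
  obtain ⟨C, hC, K, hK, H⟩ := ControlledChain.exists_bound σ₀ σm hj ENNReal.toReal_nonneg
    ENNReal.toReal_nonneg (hle hp₀) (hle hpm) hθ0 hθ1 hθ hδ hs
  rw [← hQq] at H
  refine ⟨ENNReal.ofReal C * K ^ Q.toReal, ENNReal.mul_ne_top ENNReal.ofReal_ne_top
    (ENNReal.rpow_ne_top_of_nonneg ENNReal.toReal_nonneg hK), fun f hf ha hb => ?_⟩
  set a := wLp σ₀ p₀ f
  set b := wLp σm pm (iteratedDeriv (k + 1) f)
  have hchain := hf.derivChain_iteratedDeriv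
  have hbound : ∀ ε : ℝ, 0 < ε → wLp ((1 - θ) * σ₀ + θ * σm) Q⁻¹ (iteratedDeriv j f)
      ≤ ENNReal.ofReal C * K ^ Q.toReal * ENNReal.ofReal (a.toReal + ε) ^ (1 - θ)
        * ENNReal.ofReal (b.toReal + ε) ^ θ := fun ε hε => by
    have hA : 0 < a.toReal + ε := add_pos_of_nonneg_of_pos ENNReal.toReal_nonneg hε
    have hB : 0 < b.toReal + ε := add_pos_of_nonneg_of_pos ENNReal.toReal_nonneg hε
    have hf0 : ContinuousOn (iteratedDeriv 0 f) (Ioi 0) := hchain.continuousOn (Nat.zero_le _)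
    obtain ⟨U, hU, hUf⟩ := exists_subDensity_meanControl hp₀ hA hf0
      (by simpa using toReal_add_ofReal_lt ha hε)
    obtain ⟨V, hV, hVf⟩ := exists_subDensity_meanControl hpm hB hchain.cont
      (toReal_add_ofReal_lt hb hε)
    obtain ⟨W, hW, hWy⟩ := H _ _ _ U V ⟨hchain, hU, hV, hA, hB, hUf, hVf⟩
    refine (eLpNorm_inv_le_of_enorm_le
      (M := ENNReal.ofReal (C * ((a.toReal + ε) ^ (1 - θ) * (b.toReal + ε) ^ θ)))
      ENNReal.ofReal_ne_top hQ hW fun y hy => ?_).trans_eq ?_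
    · rw [Real.enorm_eq_ofReal_abs, abs_mul, abs_of_pos (Real.rpow_pos_of_pos hy _)]
      exact hWy y hy
    · rw [ENNReal.ofReal_mul hC.le, ENNReal.ofReal_mul (by positivity),
        ENNReal.ofReal_rpow_of_pos hA, ENNReal.ofReal_rpow_of_pos hB]
      ring
  have hlim : ∀ {c : ℝ≥0∞} {e : ℝ}, c < ⊤ → Filter.Tendsto
      (fun ε : ℝ => ENNReal.ofReal (c.toReal + ε) ^ e) (nhdsWithin 0 (Ioi 0)) (nhds (c ^ e)) := by
    intro c e hc
    have h1 : Continuous fun ε : ℝ => ENNReal.ofReal (c.toReal + ε) ^ e :=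
      (ENNReal.continuous_rpow_const).comp (ENNReal.continuous_ofReal.comp (by fun_prop))
    simpa [ENNReal.ofReal_toReal hc.ne] using (h1.tendsto 0).mono_left nhdsWithin_le_nhds
  have hfin : ∀ {c : ℝ≥0∞} {e : ℝ}, c < ⊤ → 0 ≤ e → c ^ e ≠ ⊤ := fun hc he =>
    ENNReal.rpow_ne_top_of_nonneg he hc.ne
  have hCK : ENNReal.ofReal C * K ^ Q.toReal ≠ ⊤ := ENNReal.mul_ne_top ENNReal.ofReal_ne_top
    (ENNReal.rpow_ne_top_of_nonneg ENNReal.toReal_nonneg hK)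
  have ha' := hfin ha (sub_nonneg.2 hθ1.le)
  refine ge_of_tendsto (ENNReal.Tendsto.mul (ENNReal.Tendsto.const_mul (hlim ha) (Or.inr hCK))
    (Or.inr (hfin hb hθ0.le)) (hlim hb) (Or.inr (ENNReal.mul_ne_top hCK ha'))) ?_
  filter_upwards [self_mem_nhdsWithin] with ε hε using hbound ε hε

/-- **General one-dimensional weighted interpolation** (Proposition 2.13 in the
one-dimensional case): with `θ_j = j/m`, `1/p_j = (1-θ_j)/p₀ + θ_j/p_m` and
`σ_j = (1-θ_j)σ₀ + θ_j σ_m`, under the assumptions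
`m - σ_m - (1/p_m - 1/p₀) > -σ₀` and `σ_j > -1/p_j` for `0 < j < m`, one has
`‖x^{σ_j} f^{(j)}‖_{L^{p_j}} ≤ C ‖x^{σ₀} f‖_{L^{p₀}}^{1-θ_j} ‖x^{σ_m} f^{(m)}‖_{L^{p_m}}^{θ_j}`. -/
theorem weighted_interpolation_general_1d
    (m : ℕ) (hm : 2 ≤ m) (σ₀ σm : ℝ) (p₀ pm : ℝ≥0∞)
    (hp₀ : 1 ≤ p₀) (hpm : 1 ≤ pm)
    (hmain : -σ₀ < (m : ℝ) - σm - ((1 / pm).toReal - (1 / p₀).toReal))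
    (hσ : ∀ j : ℕ, 0 < j → j < m →
      -((1 - (j : ℝ≥0∞) / (m : ℝ≥0∞)) / p₀ + ((j : ℝ≥0∞) / (m : ℝ≥0∞)) / pm).toReal
        < (1 - (j : ℝ) / m) * σ₀ + ((j : ℝ) / m) * σm) :
    ∃ C : ℝ≥0∞, C ≠ ⊤ ∧ ∀ f : ℝ → ℝ, ContDiffOn ℝ m f (Set.Ioi 0) →
      wLp σ₀ p₀ f < ⊤ → wLp σm pm (iteratedDeriv m f) < ⊤ →
      ∀ j : ℕ, 0 < j → j < m →
        wLp ((1 - (j : ℝ) / m) * σ₀ + ((j : ℝ) / m) * σm)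
            (((1 - (j : ℝ≥0∞) / (m : ℝ≥0∞)) / p₀ + ((j : ℝ≥0∞) / (m : ℝ≥0∞)) / pm)⁻¹)
            (iteratedDeriv j f)
          ≤ C * wLp σ₀ p₀ f ^ (1 - (j : ℝ) / m) *
              wLp σm pm (iteratedDeriv m f) ^ ((j : ℝ) / m) := by
  obtain ⟨k, rfl⟩ : ∃ k, m = k + 1 := ⟨m - 1, by omega⟩
  have hsingle : ∀ j : ℕ, ∃ C : ℝ≥0∞, C ≠ ⊤ ∧ (0 < j → j < k + 1 → ∀ f : ℝ → ℝ,
      ContDiffOn ℝ (k + 1 : ℕ) f (Ioi 0) →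
      wLp σ₀ p₀ f < ⊤ → wLp σm pm (iteratedDeriv (k + 1) f) < ⊤ →
      wLp ((1 - (j : ℝ) / (k + 1 : ℕ)) * σ₀ + ((j : ℝ) / (k + 1 : ℕ)) * σm)
          (((1 - (j : ℝ≥0∞) / ((k + 1 : ℕ) : ℝ≥0∞)) / p₀
            + ((j : ℝ≥0∞) / ((k + 1 : ℕ) : ℝ≥0∞)) / pm)⁻¹)
          (iteratedDeriv j f)
        ≤ C * wLp σ₀ p₀ f ^ (1 - (j : ℝ) / (k + 1 : ℕ)) *
            wLp σm pm (iteratedDeriv (k + 1) f) ^ ((j : ℝ) / (k + 1 : ℕ))) := by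
    intro j
    by_cases hj : 0 < j ∧ j < k + 1
    swap
    · exact ⟨0, ENNReal.zero_ne_top, fun h0 h1 => absurd ⟨h0, h1⟩ hj⟩
    obtain ⟨hj0, hjm⟩ := hj
    have hk : (0 : ℝ) < (k + 1 : ℕ) := by positivity
    have hθ0 : (0 : ℝ) < (j : ℝ) / (k + 1 : ℕ) := by positivity
    have hθ1 : (j : ℝ) / (k + 1 : ℕ) < 1 := (div_lt_one hk).2 (by exact_mod_cast hjm)
    have hσj := hσ j hj0 hjm
    have hj1 : (j : ℝ≥0∞) / ((k + 1 : ℕ) : ℝ≥0∞) ≤ 1 :=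
      ENNReal.div_le_of_le_mul (by rw [one_mul]; exact_mod_cast hjm.le)
    have hjt : (j : ℝ≥0∞) / ((k + 1 : ℕ) : ℝ≥0∞) ≠ ⊤ := ne_top_of_le_ne_top ENNReal.one_ne_top hj1
    have hp0 : ∀ {p : ℝ≥0∞}, 1 ≤ p → p ≠ 0 := fun hp => (zero_lt_one.trans_le hp).ne'
    have h1 : (1 - (j : ℝ≥0∞) / ((k + 1 : ℕ) : ℝ≥0∞)) / p₀ ≠ ⊤ :=
      ENNReal.div_ne_top (ENNReal.sub_ne_top ENNReal.one_ne_top) (hp0 hp₀)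
    have h2 : (j : ℝ≥0∞) / ((k + 1 : ℕ) : ℝ≥0∞) / pm ≠ ⊤ := ENNReal.div_ne_top hjt (hp0 hpm)
    obtain ⟨C, hC, H⟩ := exists_wLp_iteratedDeriv_le (Nat.lt_succ_iff.1 hjm) hp₀ hpm
      (ENNReal.add_ne_top.2 ⟨h1, h2⟩) (σ₀ := σ₀) (σm := σm)
      (by rw [ENNReal.toReal_add h1 h2]
          simp only [ENNReal.toReal_div, ENNReal.toReal_sub_of_le hj1 ENNReal.one_ne_top,
            ENNReal.toReal_one, ENNReal.toReal_natCast, mul_one_div])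
      hθ0 hθ1 (by rw [← Nat.cast_succ, div_mul_cancel₀ _ hk.ne'])
      (by push_cast at hmain; linarith) (by linarith)
    exact ⟨C, hC, fun _ _ => H⟩
  choose C hC H using hsingle
  refine ⟨∑ j ∈ Finset.range (k + 1), C j, ENNReal.sum_ne_top.2 fun j _ => hC j,
    fun f hf ha hb j hj0 hjm => (H j hj0 hjm f hf ha hb).trans ?_⟩
  gcongr
  exact Finset.single_le_sum (fun _ _ => zero_le) (Finset.mem_range.2 hjm)
end

section
/- Weighted interpolation between L^∞ and a weighted L² norm of the top derivative (Proposition 2.14 in the one-dimensional case): Let m ≥ 2 be an integer and σ_m > −1/2 with m − σ_m − 1/2 > 0. For 0 < j < m set θ_j = j/m, 1/p_j = θ_j/2, σ_j = σ_m θ_j. Then there is a constant C, depending only on m and σ_m, such that for every f ∈ C^m((0,∞)) with ‖f‖_{L^∞(0,∞)} < ∞ and ‖x^{σ_m} f^{(m)}‖_{L²(0,∞)} < ∞, and every 0 < j < m, ‖x^{σ_j} f^{(j)}‖_{L^{p_j}(0,∞)} ≤ C ‖f‖_{L^∞(0,∞)}^{1−θ_j} ‖x^{σ_m} f^{(m)}‖_{L²(0,∞)}^{θ_j}.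 -/
open MeasureTheory Set
open scoped ENNReal

/-- The quantity `(y - x) ∫_x^y (y - t)^{2n} g(t)² dt`, which dominates the square of the Taylor
remainder of order `n + 1` at every point of `[x, y]`. -/
noncomputable def remainderEnergy (n : ℕ) (g : ℝ → ℝ) (x y : ℝ) : ℝ :=
  (y - x) * ∫ t in x..y, (y - t) ^ (2 * n) * g t ^ 2

lemma continuousOn_iteratedDeriv_Ioi {f : ℝ → ℝ} {m k : ℕ} (hf : ContDiffOn ℝ m f (Ioi 0))
    (hk : k ≤ m) : ContinuousOn (iteratedDeriv k f) (Ioi 0) :=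
  (hf.continuousOn_iteratedDerivWithin (by exact_mod_cast hk) (uniqueDiffOn_Ioi 0)).congr
    fun _ hx => (iteratedDerivWithin_of_isOpen isOpen_Ioi hx).symm

lemma taylor_integral_remainder_Ioi {f : ℝ → ℝ} {n : ℕ}
    (hf : ContDiffOn ℝ (n + 1 : ℕ) f (Ioi 0)) {x y : ℝ} (hx : 0 < x) (hxy : x < y) :
    ∑ i ∈ Finset.range (n + 1), iteratedDeriv i f x * (y - x) ^ i / i.factorial =
      f y - ∫ t in x..y, (y - t) ^ n / n.factorial * iteratedDeriv (n + 1) f t := by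
  have hsub : uIcc x y ⊆ Ioi 0 := by
    rw [uIcc_of_le hxy.le]
    exact fun t ht => hx.trans_le ht.1
  have huniq : UniqueDiffOn ℝ (uIcc x y) := uniqueDiffOn_uIcc hxy.ne
  have hderiv : ∀ k ≤ n + 1, ∀ t ∈ uIcc x y,
      iteratedDerivWithin k f (uIcc x y) t = iteratedDeriv k f t := fun k hk t ht =>
    iteratedDerivWithin_eq_iteratedDeriv huniq
      ((hf.contDiffAt (Ioi_mem_nhds (hsub ht))).of_le (by exact_mod_cast hk)) ht
  have htaylor := taylor_integral_remainder (hf.mono hsub)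
  rw [taylor_within_apply] at htaylor
  have hint : ∫ t in x..y, ((y - t) ^ n / n.factorial) • iteratedDerivWithin (n + 1) f (uIcc x y) t
      = ∫ t in x..y, (y - t) ^ n / n.factorial * iteratedDeriv (n + 1) f t :=
    intervalIntegral.integral_congr fun t ht => by
      simp only [hderiv _ le_rfl t ht, smul_eq_mul]
  rw [hint] at htaylor
  rw [← htaylor, sub_sub_cancel]
  refine Finset.sum_congr rfl fun k hk => ?_
  rw [hderiv k (Finset.mem_range.1 hk).le x left_mem_uIcc, smul_eq_mul]
  ring

lemma continuousOn_energyDensity {g : ℝ → ℝ} (hg : ContinuousOn g (Ioi 0)) (n : ℕ) {x y : ℝ}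
    (hx : 0 < x) (z : ℝ) (hxy : x ≤ y) :
    ContinuousOn (fun t => (z - t) ^ (2 * n) * g t ^ 2) (uIcc x y) := by
  have : ContinuousOn g (uIcc x y) := hg.mono <| by
    rw [uIcc_of_le hxy]
    exact fun t ht => hx.trans_le ht.1
  fun_prop

/-- Enlarging the interval enlarges the energy integral. -/
lemma integral_energyDensity_mono {g : ℝ → ℝ} (hg : ContinuousOn g (Ioi 0)) (n : ℕ)
    {x x' y y' : ℝ} (hx : 0 < x) (hxx : x ≤ x') (hxy : x' ≤ y') (hyy : y' ≤ y) :
    ∫ t in x'..y', (y' - t) ^ (2 * n) * g t ^ 2 ≤ ∫ t in x..y, (y - t) ^ (2 * n) * g t ^ 2 := by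
  have hx' := hx.trans_le hxx
  calc ∫ t in x'..y', (y' - t) ^ (2 * n) * g t ^ 2
      ≤ ∫ t in x'..y', (y - t) ^ (2 * n) * g t ^ 2 := by
        refine intervalIntegral.integral_mono_on hxy
          (continuousOn_energyDensity hg n hx' _ hxy).intervalIntegrable
          (continuousOn_energyDensity hg n hx' _ hxy).intervalIntegrable fun t ht => ?_
        have : 0 ≤ y' - t := sub_nonneg.2 ht.2
        gcongr
    _ ≤ ∫ t in x..y, (y - t) ^ (2 * n) * g t ^ 2 := by
        refine intervalIntegral.integral_mono_interval hxx hxy hyy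
          (Filter.Eventually.of_forall fun t => ?_)
          (continuousOn_energyDensity hg n hx _ (by linarith)).intervalIntegrable
        simp only [Pi.zero_apply, pow_mul]
        positivity

lemma integral_energyDensity_nonneg (n : ℕ) (g : ℝ → ℝ) {x y : ℝ} (hxy : x ≤ y) (z : ℝ) :
    0 ≤ ∫ t in x..y, (z - t) ^ (2 * n) * g t ^ 2 :=
  intervalIntegral.integral_nonneg hxy fun t _ => by
    simp only [pow_mul]
    positivity

lemma remainderEnergy_mono {g : ℝ → ℝ} (hg : ContinuousOn g (Ioi 0)) (n : ℕ)
    {x x' y y' : ℝ} (hx : 0 < x) (hxx : x ≤ x') (hxy : x' ≤ y') (hyy : y' ≤ y) :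
    remainderEnergy n g x' y' ≤ remainderEnergy n g x y :=
  mul_le_mul (by linarith) (integral_energyDensity_mono hg n hx hxx hxy hyy)
    (integral_energyDensity_nonneg n g hxy _) (by linarith)

lemma abs_integral_remainder_le {g : ℝ → ℝ} (hg : ContinuousOn g (Ioi 0)) (n : ℕ) {M x y : ℝ}
    (hM : 0 < M) (hx : 0 < x) (hxy : x < y) (hE : remainderEnergy n g x y ≤ M ^ 2) :
    |∫ t in x..y, (y - t) ^ n / n.factorial * g t| ≤ M := by
  have hgc : ContinuousOn g (uIcc x y) := hg.mono <| by
    rw [uIcc_of_le hxy.le]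
    exact fun t ht => hx.trans_le ht.1
  have hs : 0 < y - x := sub_pos.2 hxy
  have hpt : ∀ t ∈ Icc x y, |(y - t) ^ n / n.factorial * g t| ≤
      (M / (2 * (y - x)) + (y - x) / (2 * M) * ((y - t) ^ (2 * n) * g t ^ 2)) := by
    intro t ht
    have h0 : 0 ≤ (y - t) ^ n := pow_nonneg (sub_nonneg.2 ht.2) n
    have h1 : |(y - t) ^ n / n.factorial * g t| ≤ (y - t) ^ n * |g t| := by
      rw [abs_mul, abs_of_nonneg (by positivity)]
      gcongr
      exact div_le_self h0 (by exact_mod_cast n.factorial_pos)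
    refine h1.trans ?_
    set u := (y - t) ^ n * |g t|
    have hu : (y - t) ^ (2 * n) * g t ^ 2 = u ^ 2 := by
      simp only [u, mul_pow, sq_abs]
      ring
    rw [hu]
    have : M / (2 * (y - x)) + (y - x) / (2 * M) * u ^ 2 - u
        = (M - (y - x) * u) ^ 2 / (2 * M * (y - x)) := by
      field_simp
      ring
    have : 0 ≤ (M - (y - x) * u) ^ 2 / (2 * M * (y - x)) := by positivity
    linarith
  have hI := (continuousOn_energyDensity hg n hx y hxy.le).intervalIntegrable (μ := volume)
  calc |∫ t in x..y, (y - t) ^ n / n.factorial * g t|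
      ≤ ∫ t in x..y, |(y - t) ^ n / n.factorial * g t| :=
        intervalIntegral.abs_integral_le_integral_abs hxy.le
    _ ≤ ∫ t in x..y, (M / (2 * (y - x)) + (y - x) / (2 * M) * ((y - t) ^ (2 * n) * g t ^ 2)) :=
        intervalIntegral.integral_mono_on hxy.le
          (ContinuousOn.intervalIntegrable (by fun_prop))
          (intervalIntegrable_const.add (hI.const_mul _)) hpt
    _ = M / 2 + remainderEnergy n g x y / (2 * M) := by
        rw [intervalIntegral.integral_add intervalIntegrable_const (hI.const_mul _),
          intervalIntegral.integral_const, intervalIntegral.integral_const_mul, remainderEnergy,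
          smul_eq_mul]
        field_simp
    _ ≤ M / 2 + M ^ 2 / (2 * M) := by gcongr
    _ = M := by
        field_simp
        norm_num

/-- The coefficients of a polynomial of degree `< m` are controlled by its values at `k / m`,
`k < m`. -/
lemma exists_coeff_bound (m : ℕ) : ∃ C : ℝ, 0 < C ∧ ∀ (a : ℕ → ℝ) (B : ℝ),
    (∀ k < m, |∑ i ∈ Finset.range m, a i * ((k : ℝ) / m) ^ i| ≤ B) → ∀ i < m, |a i| ≤ C * B := by
  set V : Matrix (Fin m) (Fin m) ℝ := Matrix.vandermonde fun k => (k : ℝ) / m with hV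
  have hdet : IsUnit V.det := by
    rw [isUnit_iff_ne_zero, hV, Matrix.det_vandermonde_ne_zero_iff]
    intro k l hkl
    have hm : (m : ℝ) ≠ 0 := by
      have := k.pos
      positivity
    exact Fin.ext (by exact_mod_cast (div_left_inj' hm).1 hkl)
  refine ⟨1 + ∑ i, ∑ k, |V⁻¹ i k|, by positivity, fun a B hB i hi => ?_⟩
  have hB0 : 0 ≤ B := (abs_nonneg _).trans (hB i hi)
  have hval : ∀ k : Fin m, |V.mulVec (fun i => a i) k| ≤ B := fun k => by
    convert hB k k.2 using 2
    rw [Finset.sum_range fun i => a i * ((k : ℝ) / m) ^ i]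
    simp only [hV, Matrix.mulVec, dotProduct, Matrix.vandermonde_apply]
    exact Finset.sum_congr rfl fun _ _ => mul_comm _ _
  have hinv : V⁻¹.mulVec (V.mulVec fun i => a i) = fun i : Fin m => a i := by
    rw [Matrix.mulVec_mulVec, Matrix.nonsing_inv_mul V hdet, Matrix.one_mulVec]
  calc |a i| = |V⁻¹.mulVec (V.mulVec fun i => a i) ⟨i, hi⟩| := by rw [hinv]
    _ ≤ ∑ k, |V⁻¹ ⟨i, hi⟩ k * V.mulVec (fun i => a i) k| := by
        rw [Matrix.mulVec, dotProduct]
        exact Finset.abs_sum_le_sum_abs _ _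
    _ ≤ ∑ k, |V⁻¹ ⟨i, hi⟩ k| * B := by
        gcongr with k
        rw [abs_mul]
        gcongr
        exact hval k
    _ = (∑ k, |V⁻¹ ⟨i, hi⟩ k|) * B := (Finset.sum_mul _ _ _).symm
    _ ≤ (∑ i, ∑ k, |V⁻¹ i k|) * B :=
        mul_le_mul_of_nonneg_right
          (Finset.single_le_sum (f := fun i => ∑ k, |V⁻¹ i k|)
            (fun _ _ => Finset.sum_nonneg fun _ _ => abs_nonneg _) (Finset.mem_univ _)) hB0
    _ ≤ _ := by
        gcongr
        linarith

/-- Local interpolation on `[x, y]`: if the Taylor remainder is dominated by the supremum of `f`,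
the derivatives at `x` scale like `(y - x)^{-j}`. -/
lemma exists_abs_iteratedDeriv_le (n : ℕ) : ∃ C : ℝ, 0 < C ∧ ∀ (f : ℝ → ℝ) (M : ℝ),
    ContDiffOn ℝ (n + 1 : ℕ) f (Ioi 0) → 0 < M → (∀ x > 0, |f x| ≤ M) →
    ∀ x y, 0 < x → x < y → remainderEnergy n (iteratedDeriv (n + 1) f) x y ≤ M ^ 2 →
    ∀ j ≤ n, |iteratedDeriv j f x| * (y - x) ^ j ≤ C * M := by
  obtain ⟨C, hC, hcoeff⟩ := exists_coeff_bound (n + 1)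
  refine ⟨C * 2 * n.factorial, by positivity, fun f M hf hM hfM x y hx hxy hE j hj => ?_⟩
  have hl : 0 < y - x := sub_pos.2 hxy
  have hg := continuousOn_iteratedDeriv_Ioi hf le_rfl
  have key := hcoeff (fun i => iteratedDeriv i f x * (y - x) ^ i / i.factorial) (2 * M) ?_ j
    (Nat.lt_succ_of_le hj)
  · rw [abs_div, abs_mul, abs_of_pos (pow_pos hl j), Nat.abs_cast, div_le_iff₀ (by positivity)]
      at key
    refine key.trans ?_
    have : (j.factorial : ℝ) ≤ n.factorial := by exact_mod_cast Nat.factorial_le hj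
    calc C * (2 * M) * j.factorial ≤ C * (2 * M) * n.factorial := by gcongr
      _ = _ := by ring
  · intro k hk
    have hkm : (k : ℝ) / (n + 1 : ℕ) ≤ 1 := by
      rw [div_le_one (by positivity)]
      exact_mod_cast hk.le
    set r : ℝ := (k : ℝ) / (n + 1 : ℕ)
    have hr0 : 0 ≤ r := by positivity
    rcases hr0.eq_or_lt with h0 | hrpos
    · have hsum : ∑ i ∈ Finset.range (n + 1),
          iteratedDeriv i f x * (y - x) ^ i / i.factorial * r ^ i = f x := by
        rw [Finset.sum_range_succ', ← h0]
        simp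
      rw [hsum]
      linarith [hfM x hx]
    · have hxz : x < x + (y - x) * r := by
        have := mul_pos hl hrpos
        linarith
      have hzy : x + (y - x) * r ≤ y := by nlinarith
      have htaylor := taylor_integral_remainder_Ioi hf hx hxz
      have hsum : ∑ i ∈ Finset.range (n + 1),
          iteratedDeriv i f x * (y - x) ^ i / i.factorial * r ^ i =
          ∑ i ∈ Finset.range (n + 1),
          iteratedDeriv i f x * (x + (y - x) * r - x) ^ i / i.factorial := by
        refine Finset.sum_congr rfl fun i _ => ?_
        rw [add_sub_cancel_left, mul_pow]
        ring
      rw [hsum, htaylor, two_mul]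
      exact (abs_sub _ _).trans (add_le_add (hfM _ (hx.trans hxz))
        (abs_integral_remainder_le hg n hM hx hxz
          ((remainderEnergy_mono hg n hx le_rfl hxz.le hzy).trans hE)))

/-- For `Y` nondecreasing, `Y x - t` and `t - x` cross at one scale `d` only, and there they are
both comparable to `d`. -/
lemma exists_crossing_kernel_bound {A : Set ℝ} {Y : ℝ → ℝ} (hA : A ⊆ Ioi 0)
    (hAdown : ∀ x ∈ A, ∀ x', 0 < x' → x' < x → x' ∈ A) (hY : MonotoneOn Y A)
    {N : ℕ} (hN : 1 ≤ N) {t : ℝ} (ht : 0 < t) :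
    ∃ d : ℝ, 0 ≤ d ∧ ∀ x ∈ A, x < t →
      max (Y x - t) 0 ^ N / (Y x - x) ^ (N + 1) ≤ 4 * d / (d + (t - x)) ^ 2 := by
  set B : Set ℝ := {x ∈ A | x < t ∧ Y x - t ≤ t - x}
  have hBt : t ∈ upperBounds B := fun x hx => hx.2.1.le
  have hbdd : BddAbove B := ⟨t, hBt⟩
  have hc0 : 0 ≤ sSup B := Real.sSup_nonneg fun x hx => (hA hx.1).le
  have hct : sSup B ≤ t := Real.sSup_le hBt ht.le
  set c := sSup B
  refine ⟨t - c, sub_nonneg.2 hct, fun x hxA hxt => ?_⟩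
  have hx0 : 0 < x := hA hxA
  have hd : 0 < t - x := sub_pos.2 hxt
  rcases le_or_gt (Y x - t) 0 with hu | hu
  · rw [max_eq_right hu, zero_pow (by omega), zero_div]
    have := sub_nonneg.2 hct
    positivity
  rw [max_eq_left hu.le]
  have hYx : Y x - x = (Y x - t) + (t - x) := by ring
  rw [hYx]
  have hcases : (Y x - t ≤ t - c ∧ t - c ≤ t - x) ∨ (t - c ≤ Y x - t ∧ t - x ≤ t - c) := by
    by_cases hxB : x ∈ B
    · have hxc : x ≤ c := le_csSup hbdd hxB
      refine Or.inl ⟨?_, by linarith⟩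
      rcases hxc.eq_or_lt with h | h
      · rw [← h]
        exact hxB.2.2
      refine le_of_forall_pos_le_add fun ε hε => ?_
      obtain ⟨x', hx'B, hx'⟩ := exists_lt_of_lt_csSup ⟨x, hxB⟩
        (max_lt h (by linarith) : max x (c - ε) < sSup B)
      have h1 := hY hxA hx'B.1 (le_of_lt ((le_max_left _ _).trans_lt hx'))
      have h2 := (le_max_right x (c - ε)).trans_lt hx'
      linarith [hx'B.2.2]
    · have hxY : t - x < Y x - t := by
        by_contra! h
        exact hxB ⟨hxA, hxt, h⟩
      have hcx : c ≤ x := Real.sSup_le (fun z hz => by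
        by_contra! h
        linarith [hY hxA hz.1 h.le, hz.2.2]) hx0.le
      refine Or.inr ⟨?_, by linarith⟩
      rcases hcx.eq_or_lt with h | h
      · rw [h]
        exact hxY.le
      refine le_of_forall_pos_le_add fun ε hε => ?_
      have hx'c : c < min x (c + ε) := lt_min h (by linarith)
      obtain ⟨x', hcx', hx'⟩ := exists_between hx'c
      have hx'x := hx'.trans_le (min_le_left _ _)
      have hx'A := hAdown x hxA x' (hc0.trans_lt hcx') hx'x
      have h1 := hY hx'A hxA hx'x.le
      have h2 := hx'.trans_le (min_le_right _ _)
      have h3 : t - x' < Y x' - t := by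
        by_contra! h
        exact hcx'.not_ge (le_csSup hbdd ⟨hx'A, hx'x.trans hxt, h⟩)
      linarith
  set u := Y x - t
  set d := t - x
  set e := t - c
  have hstep : u ^ N / (u + d) ^ (N + 1) ≤ u / (u + d) ^ 2 := by
    obtain ⟨k, rfl⟩ := Nat.exists_eq_add_of_le hN
    have : u ^ (1 + k) / (u + d) ^ (1 + k + 1) = u / (u + d) ^ 2 * (u / (u + d)) ^ k := by
      rw [div_pow, div_mul_div_comm]
      ring_nf
    rw [this]
    exact mul_le_of_le_one_right (by positivity)
      (pow_le_one₀ (by positivity) ((div_le_one (by positivity)).2 (by linarith)))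
  refine hstep.trans ?_
  rcases hcases with ⟨h1, h2⟩ | ⟨h1, h2⟩
  · have he : 0 < e := hu.trans_le h1
    rw [div_le_div_iff₀ (by positivity) (by positivity)]
    have : (e + d) ^ 2 ≤ 4 * (u + d) ^ 2 := by nlinarith
    calc u * (e + d) ^ 2 ≤ e * (4 * (u + d) ^ 2) := by gcongr
      _ = _ := by ring
  · have he : 0 < e := hd.trans_le h2
    rw [div_le_div_iff₀ (by positivity) (by positivity)]
    have h3 : (e + d) ^ 2 ≤ 4 * e ^ 2 := by nlinarith
    have h4 : u * e ≤ (u + d) ^ 2 := by nlinarith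
    calc u * (e + d) ^ 2 ≤ u * (4 * e ^ 2) := by gcongr
      _ = 4 * e * (u * e) := by ring
      _ ≤ _ := by gcongr

lemma integral_crossing_le {d t : ℝ} (hd : 0 ≤ d) (ht : 0 < t) :
    IntervalIntegrable (fun x => 4 * d / (d + (t - x)) ^ 2) volume 0 t ∧
      ∫ x in 0..t, 4 * d / (d + (t - x)) ^ 2 ≤ 4 := by
  rcases hd.eq_or_lt with rfl | hd
  · simp
  have hpos : ∀ x ∈ uIcc 0 t, 0 < d + (t - x) := fun x hx => by
    rw [uIcc_of_le ht.le] at hx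
    linarith [hx.2]
  have hint : IntervalIntegrable (fun x => 4 * d / (d + (t - x)) ^ 2) volume 0 t := by
    refine ContinuousOn.intervalIntegrable ?_
    refine ContinuousOn.div (by fun_prop) (by fun_prop) fun x hx => ?_
    exact (pow_pos (hpos x hx) 2).ne'
  refine ⟨hint, ?_⟩
  rw [intervalIntegral.integral_eq_sub_of_hasDerivAt (f := fun x => 4 * d / (d + (t - x))) _ hint]
  · have : 0 < 4 * d / (d + (t - 0)) := by
      have := hpos 0 left_mem_uIcc
      positivity
    have h4 : 4 * d / (d + (t - t)) = 4 := by
      field_simp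
      ring
    linarith
  · intro x hx
    have h1 : HasDerivAt (fun x => d + (t - x)) (-1) x :=
      ((hasDerivAt_id x).const_sub t).const_add d
    convert! (hasDerivAt_const x (4 * d)).div h1 (hpos x hx).ne' using 1
    ring

lemma lintegral_kernel_le {A : Set ℝ} {Y : ℝ → ℝ} (hA : A ⊆ Ioi 0) (hAm : MeasurableSet A)
    (hAdown : ∀ x ∈ A, ∀ x', 0 < x' → x' < x → x' ∈ A) (hY : MonotoneOn Y A)
    (hYx : ∀ x ∈ A, x < Y x) {N : ℕ} (hN : 1 ≤ N) {w : ℝ} (hw : -1 < w) {t : ℝ} (ht : 0 < t) :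
    ∫⁻ x in A, (Iio t).indicator
        (fun x => ENNReal.ofReal (x ^ w * (max (Y x - t) 0 ^ N / (Y x - x) ^ (N + 1)))) x ≤
      ENNReal.ofReal ((4 * 2 ^ |w| + 2 / (w + 1)) * t ^ w) := by
  obtain ⟨d, hd, hker⟩ := exists_crossing_kernel_bound hA hAdown hY hN ht
  obtain ⟨hint, hint4⟩ := integral_crossing_le hd ht
  have htw : 0 < t ^ w := Real.rpow_pos_of_pos ht w
  set b : ℝ → ℝ := fun x => 2 ^ |w| * t ^ w * (4 * d / (d + (t - x)) ^ 2) + 2 / t * x ^ w with hb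
  have hbound : ∀ x ∈ A, x < t →
      x ^ w * (max (Y x - t) 0 ^ N / (Y x - x) ^ (N + 1)) ≤ b x := by
    intro x hxA hxt
    have hx : 0 < x := hA hxA
    have hl : 0 < Y x - x := sub_pos.2 (hYx x hxA)
    have hxw : 0 < x ^ w := Real.rpow_pos_of_pos hx w
    have hK0 : 0 ≤ 4 * d / (d + (t - x)) ^ 2 := by positivity
    rcases le_or_gt (t / 2) x with hxt2 | hxt2
    · have hcmp : x ^ w ≤ 2 ^ |w| * t ^ w := by
        rcases le_or_gt 0 w with h | h
        · calc x ^ w ≤ t ^ w := Real.rpow_le_rpow hx.le hxt.le h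
            _ ≤ 2 ^ |w| * t ^ w := le_mul_of_one_le_left htw.le
                (Real.one_le_rpow (by norm_num) (abs_nonneg w))
        · calc x ^ w ≤ (t / 2) ^ w := Real.rpow_le_rpow_of_nonpos (by positivity) hxt2 h.le
            _ = 2 ^ |w| * t ^ w := by
                rw [Real.div_rpow ht.le (by norm_num), abs_of_neg h,
                  Real.rpow_neg (by norm_num)]
                ring
      calc _ ≤ 2 ^ |w| * t ^ w * (4 * d / (d + (t - x)) ^ 2) := by
            exact mul_le_mul hcmp (hker x hxA hxt) (by positivity) (by positivity)
        _ ≤ b x := le_add_of_nonneg_right (by positivity)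
    · have hk : max (Y x - t) 0 ^ N / (Y x - x) ^ (N + 1) ≤ 2 / t := by
        have h1 : max (Y x - t) 0 ≤ Y x - x := max_le (by linarith) hl.le
        rcases le_or_gt (Y x - t) 0 with hu | hu
        · rw [max_eq_right hu, zero_pow (by omega), zero_div]
          positivity
        calc max (Y x - t) 0 ^ N / (Y x - x) ^ (N + 1)
            ≤ (Y x - x) ^ N / (Y x - x) ^ (N + 1) := by gcongr
          _ = 1 / (Y x - x) := by
              rw [pow_succ]
              field_simp
          _ ≤ 1 / (t / 2) := by
              gcongr
              linarith
          _ = 2 / t := by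
              field_simp
      calc _ ≤ x ^ w * (2 / t) := by gcongr
        _ = 2 / t * x ^ w := mul_comm _ _
        _ ≤ b x := le_add_of_nonneg_left (by positivity)
  have hrint : IntervalIntegrable (fun x : ℝ => x ^ w) volume 0 t :=
    intervalIntegral.intervalIntegrable_rpow' hw
  have hbint : IntervalIntegrable b volume 0 t := (hint.const_mul _).add (hrint.const_mul _)
  have hb0 : ∀ x ∈ Ioc 0 t, 0 ≤ b x := fun x hx => by
    have := hx.1
    positivity
  have hbval : ∫ x in 0..t, b x ≤ (4 * 2 ^ |w| + 2 / (w + 1)) * t ^ w := by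
    have hw1 : 0 < w + 1 := by linarith
    rw [hb, intervalIntegral.integral_add (hint.const_mul _) (hrint.const_mul _),
      intervalIntegral.integral_const_mul, intervalIntegral.integral_const_mul,
      integral_rpow (Or.inl hw), Real.zero_rpow hw1.ne', sub_zero, Real.rpow_add_one ht.ne']
    calc _ ≤ 2 ^ |w| * t ^ w * 4 + 2 / t * (t ^ w * t / (w + 1)) := by gcongr
      _ = _ := by
        field_simp
  calc _ ≤ ∫⁻ x, (Ioc 0 t).indicator (fun x => ENNReal.ofReal (b x)) x := by
        rw [← lintegral_indicator hAm]
        refine lintegral_mono fun x => ?_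
        by_cases hxA : x ∈ A
        · by_cases hxt : x < t
          · rw [indicator_of_mem hxA, indicator_of_mem (show x ∈ Iio t from hxt),
              indicator_of_mem (show x ∈ Ioc 0 t from ⟨hA hxA, hxt.le⟩)]
            exact ENNReal.ofReal_le_ofReal (hbound x hxA hxt)
          · rw [indicator_of_mem hxA, indicator_of_notMem (show x ∉ Iio t from hxt)]
            exact zero_le
        · rw [indicator_of_notMem hxA]
          exact zero_le
    _ = ENNReal.ofReal (∫ x in 0..t, b x) := by
        rw [lintegral_indicator measurableSet_Ioc, intervalIntegral.integral_of_le ht.le,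
          ofReal_integral_eq_lintegral_ofReal hbint.1
            ((ae_restrict_iff' measurableSet_Ioc).2 (Filter.Eventually.of_forall hb0))]
    _ ≤ _ := ENNReal.ofReal_le_ofReal hbval

lemma exists_remainderEnergy_eq {g : ℝ → ℝ} (hg : ContinuousOn g (Ioi 0)) (n : ℕ) {M x y : ℝ}
    (hM : 0 < M) (hx : 0 < x) (hxy : x < y) (hE : M ^ 2 ≤ remainderEnergy n g x y) :
    ∃ z, x < z ∧ remainderEnergy n g x z = M ^ 2 := by
  have hcont : ContinuousOn (remainderEnergy n g x) (Icc x y) := by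
    have hg' : Continuous fun t => g (max t x) := by
      rw [← continuousOn_univ]
      exact hg.comp (by fun_prop) fun t _ => hx.trans_le (le_max_right t x)
    have hI : Continuous fun z => ∫ t in x..z, (z - t) ^ (2 * n) * g (max t x) ^ 2 :=
      intervalIntegral.continuous_parametric_intervalIntegral_of_continuous
        (f := fun z t => (z - t) ^ (2 * n) * g (max t x) ^ 2)
        (((continuous_fst.sub continuous_snd).pow _).mul ((hg'.comp continuous_snd).pow 2))
        continuous_id
    refine ContinuousOn.congr (f := fun z => (z - x) *
      ∫ t in x..z, (z - t) ^ (2 * n) * g (max t x) ^ 2) (by fun_prop) fun z hz => ?_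
    rw [remainderEnergy]
    congr 1
    refine intervalIntegral.integral_congr fun t ht => ?_
    rw [uIcc_of_le hz.1] at ht
    simp only [max_eq_left ht.1]
  obtain ⟨z, hz, hzE⟩ := intermediate_value_Icc hxy.le hcont
    (show M ^ 2 ∈ Icc _ _ from ⟨by simp [remainderEnergy, sq_nonneg], hE⟩)
  refine ⟨z, lt_of_le_of_ne hz.1 fun h => ?_, hzE⟩
  subst h
  simp only [remainderEnergy, sub_self, zero_mul] at hzE
  exact (pow_pos hM 2).ne hzE

/-- A choice of scale at which the energy is balanced against `M`, nondecreasing in the left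
endpoint; where no such scale exists, the energy stays below `M²`. -/
lemma exists_balanced_endpoint {g : ℝ → ℝ} (hg : ContinuousOn g (Ioi 0)) (n : ℕ) {M : ℝ}
    (hM : 0 < M) : ∃ (A : Set ℝ) (Y : ℝ → ℝ), A ⊆ Ioi 0 ∧
      (∀ x ∈ A, ∀ x', 0 < x' → x' < x → x' ∈ A) ∧ MonotoneOn Y A ∧
      (∀ x ∈ A, x < Y x ∧ remainderEnergy n g x (Y x) = M ^ 2) ∧
      ∀ x, 0 < x → x ∉ A → ∀ y, x < y → remainderEnergy n g x y ≤ M ^ 2 := by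
  set A : Set ℝ := {x | 0 < x ∧ ∃ y, x < y ∧ M ^ 2 ≤ remainderEnergy n g x y}
  have hex : ∀ x, ∃ z, x ∈ A → x < z ∧ remainderEnergy n g x z = M ^ 2 := by
    intro x
    by_cases hx : x ∈ A
    · obtain ⟨hx0, y, hxy, hE⟩ := hx
      obtain ⟨z, hz⟩ := exists_remainderEnergy_eq hg n hM hx0 hxy hE
      exact ⟨z, fun _ => hz⟩
    · exact ⟨0, fun h => absurd h hx⟩
  choose Y hYE using hex
  refine ⟨A, Y, fun x hx => hx.1, ?_, ?_, hYE, ?_⟩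
  · rintro x ⟨hx, y, hxy, hE⟩ x' hx' hxx'
    exact ⟨hx', y, hxx'.trans hxy, hE.trans (remainderEnergy_mono hg n hx' hxx'.le hxy.le le_rfl)⟩
  · intro x hxA x' hx'A hxx'
    by_contra! hlt
    obtain ⟨h1, h2⟩ := hYE x hxA
    obtain ⟨h3, h4⟩ := hYE x' hx'A
    have hmono := integral_energyDensity_mono hg n hxA.1 hxx' h3.le hlt.le
    have hI0 := integral_energyDensity_nonneg n g h1.le (Y x)
    rw [remainderEnergy] at h2 h4
    have hMM : 0 < M ^ 2 := by positivity
    have hI : 0 < ∫ t in x..Y x, (Y x - t) ^ (2 * n) * g t ^ 2 := by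
      refine lt_of_le_of_ne hI0 fun h => ?_
      rw [← h, mul_zero] at h2
      exact hMM.ne h2
    have h5 := mul_le_mul_of_nonneg_left hmono (sub_pos.2 h3).le
    have h6 := mul_lt_mul_of_pos_right (show Y x' - x' < Y x - x by linarith) hI
    linarith
  · intro x hx hxA y hxy
    by_contra! h
    exact hxA ⟨hx, y, hxy, h.le⟩

/-- Double counting: the balanced scales are controlled by the weighted energy. -/
lemma lintegral_balanced_scale_le {g Y : ℝ → ℝ} {A : Set ℝ} {n : ℕ} {M w : ℝ} (hn : 1 ≤ n)
    (hw : -1 < w) (hg : ContinuousOn g (Ioi 0)) (hA : A ⊆ Ioi 0)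
    (hAdown : ∀ x ∈ A, ∀ x', 0 < x' → x' < x → x' ∈ A) (hY : MonotoneOn Y A)
    (hYE : ∀ x ∈ A, x < Y x ∧ remainderEnergy n g x (Y x) = M ^ 2) :
    (∫⁻ x in A, ENNReal.ofReal (x ^ w / (Y x - x) ^ (2 * n + 2))) * ENNReal.ofReal (M ^ 2) ≤
      ENNReal.ofReal (4 * 2 ^ |w| + 2 / (w + 1)) *
        ∫⁻ t in Ioi 0, ENNReal.ofReal (t ^ w * g t ^ 2) := by
  have hAm : MeasurableSet A := by
    refine OrdConnected.measurableSet ⟨fun x hx y hy z hz => ?_⟩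
    rcases hz.2.eq_or_lt with h | h
    · exact h ▸ hy
    · exact hAdown y hy z ((hA hx).trans_le hz.1) h
  set k : ℝ → ℝ → ℝ := fun x t =>
    x ^ w * (max (Y x - t) 0 ^ (2 * n) / (Y x - x) ^ (2 * n + 1)) with hk
  set F : ℝ → ℝ → ℝ≥0∞ := fun x t =>
    (Iio t).indicator (fun x => ENNReal.ofReal (k x t)) x * ENNReal.ofReal (g t ^ 2) with hF
  have hFm : AEMeasurable (Function.uncurry F)
      ((volume.restrict A).prod (volume.restrict (Ioi 0))) := by
    have hYm : AEMeasurable (fun p : ℝ × ℝ => Y p.1)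
        ((volume.restrict A).prod (volume.restrict (Ioi 0))) :=
      (aemeasurable_restrict_of_monotoneOn hAm hY).comp_fst
    have hgm : AEMeasurable (fun p : ℝ × ℝ => g p.2)
        ((volume.restrict A).prod (volume.restrict (Ioi 0))) :=
      (hg.aemeasurable measurableSet_Ioi).comp_snd
    have hkm : AEMeasurable (fun p : ℝ × ℝ => ENNReal.ofReal (k p.1 p.2))
        ((volume.restrict A).prod (volume.restrict (Ioi 0))) :=
      ((measurable_fst.pow_const w).aemeasurable.mul
        ((((hYm.sub measurable_snd.aemeasurable).max aemeasurable_const).pow_const _).div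
          ((hYm.sub measurable_fst.aemeasurable).pow_const _))).ennreal_ofReal
    exact (hkm.indicator (measurableSet_lt measurable_fst measurable_snd)).mul
      (hgm.pow_const 2).ennreal_ofReal
  have hpt : ∀ x ∈ A, ENNReal.ofReal (x ^ w / (Y x - x) ^ (2 * n + 2)) * ENNReal.ofReal (M ^ 2) ≤
      ∫⁻ t in Ioi 0, F x t := by
    intro x hxA
    have hx : 0 < x := hA hxA
    obtain ⟨hxY, hE⟩ := hYE x hxA
    have hl : 0 < Y x - x := sub_pos.2 hxY
    have hxw : 0 < x ^ w := Real.rpow_pos_of_pos hx w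
    set c : ℝ := x ^ w / (Y x - x) ^ (2 * n + 1) with hc
    have hI := (continuousOn_energyDensity hg n hx (Y x) hxY.le).intervalIntegrable (μ := volume)
    calc _ = ENNReal.ofReal (∫ t in x..Y x, c * ((Y x - t) ^ (2 * n) * g t ^ 2)) := by
          rw [← ENNReal.ofReal_mul (by positivity), intervalIntegral.integral_const_mul, ← hE,
            remainderEnergy, hc]
          congr 1
          rw [pow_succ (Y x - x) (2 * n + 1)]
          field_simp
      _ = ∫⁻ t in Ioc x (Y x), ENNReal.ofReal (c * ((Y x - t) ^ (2 * n) * g t ^ 2)) := by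
          rw [intervalIntegral.integral_of_le hxY.le, ofReal_integral_eq_lintegral_ofReal
            (hI.const_mul c).1 (Filter.Eventually.of_forall fun t => ?_)]
          simp only [Pi.zero_apply, pow_mul]
          positivity
      _ = ∫⁻ t in Ioc x (Y x), F x t := by
          refine setLIntegral_congr_fun measurableSet_Ioc fun t ht => ?_
          simp only [hF, hk]
          rw [indicator_of_mem (show x ∈ Iio t from ht.1), max_eq_left (sub_nonneg.2 ht.2),
            ← ENNReal.ofReal_mul (mul_nonneg hxw.le (div_nonneg
              (pow_nonneg (sub_nonneg.2 ht.2) _) (pow_pos hl _).le))]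
          congr 1
          ring
      _ ≤ _ := lintegral_mono_set fun t ht => hx.trans ht.1
  calc _ = ∫⁻ x in A, ENNReal.ofReal (x ^ w / (Y x - x) ^ (2 * n + 2)) * ENNReal.ofReal (M ^ 2) :=
        (lintegral_mul_const' _ _ ENNReal.ofReal_ne_top).symm
    _ ≤ ∫⁻ x in A, ∫⁻ t in Ioi 0, F x t := setLIntegral_mono' hAm hpt
    _ = ∫⁻ t in Ioi 0, ∫⁻ x in A, F x t := lintegral_lintegral_swap hFm
    _ ≤ ∫⁻ t in Ioi 0, ENNReal.ofReal (4 * 2 ^ |w| + 2 / (w + 1)) *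
          ENNReal.ofReal (t ^ w * g t ^ 2) := by
        refine setLIntegral_mono' measurableSet_Ioi fun t ht => ?_
        have htw : 0 ≤ t ^ w := Real.rpow_nonneg (le_of_lt ht) w
        have hw1 : 0 < w + 1 := by linarith
        rw [lintegral_mul_const' _ _ ENNReal.ofReal_ne_top, ENNReal.ofReal_mul htw, ← mul_assoc,
          ← ENNReal.ofReal_mul (by positivity)]
        gcongr
        exact lintegral_kernel_le hA hAm hAdown hY (fun x hx => (hYE x hx).1) (by omega) hw ht
    _ = _ := lintegral_const_mul' _ _ ENNReal.ofReal_ne_top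

lemma abs_le_toReal_eLpNorm_top {f : ℝ → ℝ} (hf : ContinuousOn f (Ioi 0))
    (hfin : eLpNorm f ⊤ (volume.restrict (Ioi 0)) < ⊤) {x : ℝ} (hx : 0 < x) :
    |f x| ≤ (eLpNorm f ⊤ (volume.restrict (Ioi 0))).toReal := by
  set M := (eLpNorm f ⊤ (volume.restrict (Ioi 0))).toReal
  have hae : (fun x => max |f x| M) =ᵐ[volume.restrict (Ioi 0)] fun _ => M := by
    filter_upwards [ae_le_eLpNormEssSup (f := f) (μ := volume.restrict (Ioi 0))] with x hx
    refine max_eq_right ?_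
    rw [← eLpNorm_exponent_top] at hx
    simpa only [toReal_enorm, Real.norm_eq_abs] using ENNReal.toReal_mono hfin.ne hx
  have := Measure.eqOn_open_of_ae_eq hae isOpen_Ioi (by fun_prop) continuousOn_const
    (show x ∈ Ioi 0 from hx)
  exact max_eq_right_iff.1 this

lemma eq_zero_of_forall_abs_mul_pow_le {D C : ℝ} {j : ℕ} (hj : 0 < j) (hC : 0 ≤ C)
    (h : ∀ s, 0 < s → |D| * s ^ j ≤ C) : D = 0 := by
  by_contra hD
  have hD' : 0 < |D| := abs_pos.2 hD
  have hs : 1 ≤ C / |D| + 1 := le_add_of_nonneg_left (by positivity)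
  have h1 := h (C / |D| + 1) (by linarith)
  have h2 : |D| * (C / |D| + 1) ≤ |D| * (C / |D| + 1) ^ j := by
    gcongr
    exact le_self_pow₀ hs hj.ne'
  have h3 : |D| * (C / |D| + 1) = C + |D| := by field_simp
  linarith

lemma wLp_two_eq (σ : ℝ) (g : ℝ → ℝ) :
    wLp σ 2 g = (∫⁻ t in Ioi 0, ENNReal.ofReal (t ^ (2 * σ) * g t ^ 2)) ^ (1 / 2 : ℝ) := by
  rw [wLp, eLpNorm_eq_lintegral_rpow_enorm_toReal two_ne_zero ENNReal.ofNat_ne_top]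
  simp only [ENNReal.toReal_ofNat]
  congr 1
  refine setLIntegral_congr_fun measurableSet_Ioi fun t ht => ?_
  have ht' : (0 : ℝ) ≤ t := le_of_lt ht
  simp only [ENNReal.rpow_two]
  rw [Real.enorm_eq_ofReal_abs, ← ENNReal.ofReal_pow (abs_nonneg _), sq_abs, mul_pow,
    ← Real.rpow_natCast, ← Real.rpow_mul ht', Nat.cast_ofNat, mul_comm σ]

/-- Transfers a balanced pointwise bound into the weighted `L^q` norm. -/
lemma wLp_le_of_balanced {D Y : ℝ → ℝ} {A : Set ℝ} {σ B : ℝ} {j m : ℕ} (hj : 0 < j)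
    (hm : 0 < m) (hB : 0 ≤ B) (hYx : ∀ x ∈ A, x < Y x)
    (hDA : ∀ x ∈ A, |D x| * (Y x - x) ^ j ≤ B) (hD0 : ∀ x, 0 < x → x ∉ A → D x = 0) :
    wLp (σ * ((j : ℝ) / m)) (ENNReal.ofReal (2 * (m : ℝ) / j)) D ≤
      ENNReal.ofReal B * (∫⁻ x in A, ENNReal.ofReal (x ^ (2 * σ) / (Y x - x) ^ (2 * m))) ^
        ((j : ℝ) / (2 * m)) := by
  have hj' : (0 : ℝ) < j := by exact_mod_cast hj
  have hm' : (0 : ℝ) < m := by exact_mod_cast hm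
  set q : ℝ := 2 * (m : ℝ) / j with hq
  have hq0 : 0 < q := by positivity
  have hpt : ∀ x ∈ Ioi (0 : ℝ), ‖x ^ (σ * ((j : ℝ) / m)) * D x‖ₑ ^ q ≤
      A.indicator (fun x => ENNReal.ofReal B ^ q *
        ENNReal.ofReal (x ^ (2 * σ) / (Y x - x) ^ (2 * m))) x := by
    intro x hx
    have hx' : 0 < x := hx
    by_cases hxA : x ∈ A
    · have hl : 0 < Y x - x := sub_pos.2 (hYx x hxA)
      rw [indicator_of_mem hxA, Real.enorm_eq_ofReal_abs,
        ENNReal.ofReal_rpow_of_nonneg (abs_nonneg _) hq0.le,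
        ENNReal.ofReal_rpow_of_nonneg hB hq0.le, ← ENNReal.ofReal_mul (by positivity)]
      refine ENNReal.ofReal_le_ofReal ?_
      have hσ : σ * ((j : ℝ) / m) * q = 2 * σ := by
        rw [hq]
        field_simp
      rw [abs_mul, abs_of_nonneg (by positivity), Real.mul_rpow (by positivity) (abs_nonneg _),
        ← Real.rpow_mul hx'.le, hσ, mul_div_assoc', le_div_iff₀ (by positivity)]
      have hpow : (Y x - x) ^ (2 * m) = ((Y x - x) ^ j) ^ q := by
        rw [← Real.rpow_natCast (Y x - x) j, ← Real.rpow_mul hl.le, hq, mul_div_cancel₀ _ hj'.ne',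
          ← Real.rpow_natCast]
        norm_num
      rw [hpow, mul_assoc, ← Real.mul_rpow (abs_nonneg _) (by positivity), mul_comm]
      gcongr
      exact hDA x hxA
    · rw [hD0 x hx' hxA, mul_zero, enorm_zero, ENNReal.zero_rpow_of_pos hq0]
      exact zero_le
  rw [wLp, eLpNorm_eq_lintegral_rpow_enorm_toReal (ENNReal.ofReal_pos.2 hq0).ne'
    ENNReal.ofReal_ne_top, ENNReal.toReal_ofReal hq0.le]
  have hint : ∫⁻ x in Ioi 0, ‖x ^ (σ * ((j : ℝ) / m)) * D x‖ₑ ^ q ≤ ENNReal.ofReal B ^ q *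
      ∫⁻ x in A, ENNReal.ofReal (x ^ (2 * σ) / (Y x - x) ^ (2 * m)) :=
    calc _ ≤ ∫⁻ x in Ioi 0, A.indicator (fun x => ENNReal.ofReal B ^ q *
          ENNReal.ofReal (x ^ (2 * σ) / (Y x - x) ^ (2 * m))) x :=
          setLIntegral_mono' measurableSet_Ioi hpt
      _ ≤ ∫⁻ x, A.indicator (fun x => ENNReal.ofReal B ^ q *
          ENNReal.ofReal (x ^ (2 * σ) / (Y x - x) ^ (2 * m))) x := setLIntegral_le_lintegral _ _
      _ ≤ ∫⁻ x in A, ENNReal.ofReal B ^ q *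
          ENNReal.ofReal (x ^ (2 * σ) / (Y x - x) ^ (2 * m)) := lintegral_indicator_le _ _
      _ = _ := lintegral_const_mul' _ _ (by finiteness)
  have hq1 : 1 / q = (j : ℝ) / (2 * m) := by
    rw [hq, one_div_div]
  calc _ ≤ _ := ENNReal.rpow_le_rpow hint (by positivity : 0 ≤ 1 / q)
    _ = _ := by
      rw [ENNReal.mul_rpow_of_nonneg _ _ (by positivity), ← ENNReal.rpow_mul,
        mul_one_div_cancel hq0.ne', ENNReal.rpow_one, hq1]

/-- **Weighted interpolation between `L^∞` and a weighted `L²` norm of the top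
derivative** (Proposition 2.14 in the one-dimensional case): for `σ_m > -1/2` with
`m - σ_m - 1/2 > 0`, `θ_j = j/m`, `1/p_j = θ_j/2` (i.e. `p_j = 2m/j`), `σ_j = σ_m θ_j`:
`‖x^{σ_j} f^{(j)}‖_{L^{p_j}} ≤ C ‖f‖_{L^∞(0,∞)}^{1-θ_j} ‖x^{σ_m} f^{(m)}‖_{L²}^{θ_j}`. -/
theorem weighted_interpolation_Linfty_L2
    (m : ℕ) (hm : 2 ≤ m) (σm : ℝ) (hσm : -(1/2 : ℝ) < σm)
    (hmain : 0 < (m : ℝ) - σm - 1 / 2) :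
    ∃ C : ℝ≥0∞, C ≠ ⊤ ∧ ∀ f : ℝ → ℝ, ContDiffOn ℝ m f (Set.Ioi 0) →
      eLpNorm f ⊤ (volume.restrict (Set.Ioi 0)) < ⊤ →
      wLp σm 2 (iteratedDeriv m f) < ⊤ →
      ∀ j : ℕ, 0 < j → j < m →
        wLp (σm * ((j : ℝ) / m)) (ENNReal.ofReal (2 * (m : ℝ) / j)) (iteratedDeriv j f)
          ≤ C * eLpNorm f ⊤ (volume.restrict (Set.Ioi 0)) ^ (1 - (j : ℝ) / m) *
              wLp σm 2 (iteratedDeriv m f) ^ ((j : ℝ) / m) := by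
  obtain ⟨n, rfl⟩ : ∃ n, m = n + 1 := ⟨m - 1, by omega⟩
  obtain ⟨C₁, hC₁, hlocal⟩ := exists_abs_iteratedDeriv_le n
  set C₂ : ℝ≥0∞ := ENNReal.ofReal (4 * 2 ^ |2 * σm| + 2 / (2 * σm + 1)) with hC₂
  have hC₂1 : 1 ≤ C₂ := by
    have h1 : (1 : ℝ) ≤ 2 ^ |2 * σm| := Real.one_le_rpow (by norm_num) (abs_nonneg _)
    have h2 : 0 ≤ 2 / (2 * σm + 1) := div_nonneg (by norm_num) (by linarith)
    rw [hC₂, ENNReal.one_le_ofReal]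
    linarith
  refine ⟨ENNReal.ofReal C₁ * C₂, by finiteness, fun f hf hfin _ j hj hjm => ?_⟩
  have hcont : ContinuousOn f (Ioi 0) := hf.continuousOn
  have hbound := fun x (hx : 0 < x) => abs_le_toReal_eLpNorm_top hcont hfin hx
  have hg := continuousOn_iteratedDeriv_Ioi hf le_rfl
  set Me := eLpNorm f ⊤ (volume.restrict (Ioi 0))
  rcases eq_or_ne Me 0 with hM0 | hM0
  · have hzero : EqOn f 0 (Ioi 0) := fun x hx => by
      simpa [hM0] using hbound x hx
    have hj0 : ∀ x, 0 < x → iteratedDeriv j f x = 0 := fun x hx => by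
      rw [(hzero.eventuallyEq_of_mem (Ioi_mem_nhds hx)).iteratedDeriv_eq j]
      simp
    have := wLp_le_of_balanced (D := iteratedDeriv j f) (Y := id) (A := ∅) (σ := σm) (B := 0)
      hj (Nat.succ_pos n) le_rfl (by simp) (by simp) fun x hx _ => hj0 x hx
    rw [ENNReal.ofReal_zero, zero_mul] at this
    exact this.trans zero_le
  · set M := Me.toReal
    have hM : 0 < M := ENNReal.toReal_pos hM0 hfin.ne
    have hMM : ENNReal.ofReal M = Me := ENNReal.ofReal_toReal hfin.ne
    obtain ⟨A, Y, hA, hAdown, hY, hYE, hE⟩ := exists_balanced_endpoint hg n hM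
    have hnorm := wLp_le_of_balanced (D := iteratedDeriv j f) (Y := Y) (A := A) (σ := σm)
      (B := C₁ * M) hj (Nat.succ_pos n) (by positivity) (fun x hx => (hYE x hx).1)
      (fun x hx => hlocal f M hf hM hbound x (Y x) (hA hx) (hYE x hx).1 (hYE x hx).2.le j
        (by omega))
      fun x hx hxA => eq_zero_of_forall_abs_mul_pow_le (C := C₁ * M) hj (by positivity) fun s hs => by
        simpa using hlocal f M hf hM hbound x (x + s) hx (by linarith)
          (hE x hx hxA _ (by linarith)) j (by omega)
    have hscale := lintegral_balanced_scale_le (w := 2 * σm) (by omega : 1 ≤ n) (by linarith) hg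
      hA hAdown hY hYE
    set I := ∫⁻ x in A, ENNReal.ofReal (x ^ (2 * σm) / (Y x - x) ^ (2 * (n + 1)))
    rw [ENNReal.ofReal_pow hM.le, hMM, ← hC₂] at hscale
    set θ : ℝ := (j : ℝ) / (n + 1 : ℕ) with hθ
    have hθ0 : 0 ≤ θ := by positivity
    have hθ1 : θ ≤ 1 := (div_le_one (by positivity)).2 (by exact_mod_cast hjm.le)
    have hθ2 : (j : ℝ) / (2 * (n + 1 : ℕ)) = θ / 2 := by
      rw [hθ, div_div, mul_comm]
    have hC₂θ : C₂ ^ (θ / 2) ≤ C₂ := by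
      simpa using ENNReal.rpow_le_rpow_of_exponent_le hC₂1 (by linarith : θ / 2 ≤ 1)
    have hsplit : Me = Me ^ (1 - θ) * (Me ^ 2) ^ (θ / 2) := by
      rw [← ENNReal.rpow_two, ← ENNReal.rpow_mul, ← ENNReal.rpow_add _ _ hM0 hfin.ne]
      ring_nf
      rw [ENNReal.rpow_one]
    rw [hθ2] at hnorm
    calc _ ≤ _ := hnorm
      _ = ENNReal.ofReal C₁ * Me ^ (1 - θ) * (I * Me ^ 2) ^ (θ / 2) := by
          rw [ENNReal.ofReal_mul hC₁.le, hMM, ENNReal.mul_rpow_of_nonneg _ _ (by positivity)]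
          nth_rewrite 1 [hsplit]
          ring
      _ ≤ ENNReal.ofReal C₁ * Me ^ (1 - θ) * (C₂ * wLp σm 2 (iteratedDeriv (n + 1) f) ^ θ) := by
          gcongr
          refine (ENNReal.rpow_le_rpow hscale (by positivity)).trans ?_
          rw [ENNReal.mul_rpow_of_nonneg _ _ (by positivity), wLp_two_eq, ← ENNReal.rpow_mul,
            one_div_mul_eq_div]
          gcongr
      _ = _ := by ring
end

section
/- Weighted interpolation between the Hölder-1/2 seminorm and a weighted L² norm of the top derivative (Proposition 2.15 in the one-dimensional case): Let m ≥ 2 be an integer and σ_m > −1/2 with m − 1 − σ_m > 0. For 0 < j < m set θ_j = (2j−1)/(2m−1), σ_j = σ_m θ_j, 1/p_j = θ_j/2. Then there is a constant C, depending only on m and σ_m, such that for every f ∈ C^m((0,∞)) with ‖f‖_{Ċ^{1/2}} < ∞ and ‖x^{σ_m} f^{(m)}‖_{L²(0,∞)} < ∞, and every 0 < j < m, ‖x^{σ_j} f^{(j)}‖_{L^{p_j}(0,∞)} ≤ C ‖f‖_{Ċ^{1/2}}^{1−θ_j} ‖x^{σ_m} f^{(m)}‖_{L²(0,∞)}^{θ_j}.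 -/
open MeasureTheory Set
open scoped ENNReal

/-- The integral of the kernel `c / (c + t - x) ^ 2` against the weight `x ^ s` is bounded by a
multiple of `t ^ s`, uniformly in `c`. -/
lemma exists_lintegral_rpow_mul_kernel_le {s : ℝ} (hs : -1 < s) :
    ∃ A : ℝ, 1 ≤ A ∧ ∀ t c : ℝ, 0 < t → 0 < c →
      ∫⁻ x in Ioo 0 t, ENNReal.ofReal (x ^ s * (c / (c + t - x) ^ 2))
        ≤ ENNReal.ofReal (A * t ^ s) := by
  have hs1 : 0 < s + 1 := by linarith
  have hB : (0:ℝ) < 1 + 2 ^ (-s) := by positivity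
  refine ⟨2 * (s + 1)⁻¹ + (1 + 2 ^ (-s)) + 1, by
    have := inv_pos.2 hs1; linarith, fun t c ht hc => ?_⟩
  set F : ℝ → ℝ := fun x => 2 / t * x ^ s + (1 + 2 ^ (-s)) * t ^ s * (c / (c + t - x) ^ 2) with hF
  have hts : 0 < t ^ s := Real.rpow_pos_of_pos ht s
  have hpos : ∀ x ∈ Ioo 0 t, 0 ≤ F x := fun x hx => by
    have := Real.rpow_pos_of_pos hx.1 s
    simp only [hF]; positivity
  have hle : ∀ x ∈ Ioo 0 t, x ^ s * (c / (c + t - x) ^ 2) ≤ F x := by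
    intro x hx
    have hxs := Real.rpow_pos_of_pos hx.1 s
    have hd : 0 < c + t - x := by linarith [hx.2]
    have hk : 0 ≤ c / (c + t - x) ^ 2 := by positivity
    simp only [hF]
    rcases le_total x (t / 2) with h | h
    · have h1 : c / (c + t - x) ^ 2 ≤ 2 / t := by
        rw [div_le_div_iff₀ (by positivity) ht]
        nlinarith [mul_pos hc ht, mul_nonneg hc.le (sub_nonneg.2 h), sq_nonneg (t - x),
          mul_nonneg hc.le hc.le]
      have := mul_le_mul_of_nonneg_left h1 hxs.le
      have h2 : 0 ≤ (1 + 2 ^ (-s)) * t ^ s * (c / (c + t - x) ^ 2) := by positivity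
      linarith
    · have h1 : x ^ s ≤ (1 + 2 ^ (-s)) * t ^ s := by
        rcases le_total 0 s with h0 | h0
        · have := Real.rpow_le_rpow hx.1.le hx.2.le h0
          have h3 : (0:ℝ) < 2 ^ (-s) := by positivity
          nlinarith
        · have := Real.rpow_le_rpow_of_nonpos (by positivity) h h0
          rw [Real.div_rpow ht.le (by norm_num), div_eq_mul_inv,
            ← Real.rpow_neg (by norm_num)] at this
          linarith
      have := mul_le_mul_of_nonneg_right h1 hk
      have h2 : 0 ≤ 2 / t * x ^ s := by positivity
      linarith
  have hi1 : IntervalIntegrable (fun x : ℝ => 2 / t * x ^ s) volume 0 t :=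
    (intervalIntegral.intervalIntegrable_rpow' hs).const_mul _
  have hcont : ContinuousOn (fun x : ℝ => c / (c + t - x) ^ 2) (uIcc 0 t) := by
    refine ContinuousOn.div (by fun_prop) (by fun_prop) fun x hx => ?_
    rw [uIcc_of_le ht.le] at hx
    have : 0 < c + t - x := by linarith [hx.2]
    positivity
  have hi2 : IntervalIntegrable (fun x : ℝ => (1 + 2 ^ (-s)) * t ^ s * (c / (c + t - x) ^ 2))
      volume 0 t := hcont.intervalIntegrable.const_mul _
  have hk : ∫ x in (0:ℝ)..t, c / (c + t - x) ^ 2 = c / (c + t - t) - c / (c + t - 0) := by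
    refine intervalIntegral.integral_eq_sub_of_hasDerivAt (f := fun x => c / (c + t - x))
      (fun x hx => ?_) hcont.intervalIntegrable
    rw [uIcc_of_le ht.le] at hx
    have hd : c + t - x ≠ 0 := by linarith [hx.2]
    exact ((hasDerivAt_const x c).fun_div ((hasDerivAt_id x).const_sub (c + t)) hd).congr_deriv
      (by simp)
  have hInt : ∫ x in (0:ℝ)..t, F x ≤ (2 * (s + 1)⁻¹ + (1 + 2 ^ (-s)) + 1) * t ^ s := by
    simp only [hF]
    rw [intervalIntegral.integral_add hi1 hi2, intervalIntegral.integral_const_mul,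
      intervalIntegral.integral_const_mul, hk, integral_rpow (Or.inl hs),
      Real.zero_rpow hs1.ne', Real.rpow_add_one ht.ne']
    have e1 : 2 / t * ((t ^ s * t - 0) / (s + 1)) = 2 * (s + 1)⁻¹ * t ^ s := by
      field_simp; ring
    have e2 : c / (c + t - t) - c / (c + t - 0) ≤ 1 := by
      have : c / (c + t - t) = 1 := by rw [add_sub_cancel_right, div_self hc.ne']
      have h0 : 0 ≤ c / (c + t - 0) := by rw [sub_zero]; positivity
      linarith
    have := mul_le_mul_of_nonneg_left e2 (mul_pos hB hts).le
    rw [e1]; linarith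
  calc ∫⁻ x in Ioo 0 t, ENNReal.ofReal (x ^ s * (c / (c + t - x) ^ 2))
      ≤ ∫⁻ x in Ioo 0 t, ENNReal.ofReal (F x) :=
        setLIntegral_mono' measurableSet_Ioo fun x hx => ENNReal.ofReal_le_ofReal (hle x hx)
    _ = ENNReal.ofReal (∫ x in Ioo 0 t, F x) := by
        rw [ofReal_integral_eq_lintegral_ofReal]
        · exact (intervalIntegrable_iff_integrableOn_Ioo_of_le ht.le).1 (hi1.add hi2)
        · exact (ae_restrict_iff' measurableSet_Ioo).2 (ae_of_all _ hpos)
    _ ≤ _ := by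
        refine ENNReal.ofReal_le_ofReal ?_
        rwa [← integral_Ioc_eq_integral_Ioo, ← intervalIntegral.integral_of_le ht.le]

/-- Pointwise comparison: for a nondecreasing `E` the kernel `(E x - t) / (E x - x) ^ 2` is
dominated by a single kernel `c / (c + t - x) ^ 2`. -/
lemma MonotoneOn.exists_kernel_le {S : Set ℝ} {E : ℝ → ℝ} (hE : MonotoneOn E S) {t : ℝ} :
    ∃ c : ℝ, 0 < c ∧ ∀ x ∈ S, 0 < x → x < t →
      (E x - t) / (E x - x) ^ 2 ≤ 4 * (c / (c + t - x) ^ 2) := by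
  set T : Set ℝ := {x | x ∈ S ∧ 0 < x ∧ x < t ∧ t < E x} with hT
  set φ : ℝ → ℝ := fun x => min (E x - t) (t - x) with hφ
  rcases T.eq_empty_or_nonempty with h0 | ⟨x₀, hx₀⟩
  · refine ⟨1, one_pos, fun x hx hx0 hxt => ?_⟩
    have hEx : E x ≤ t := by
      by_contra! h
      have : x ∈ T := ⟨hx, hx0, hxt, h⟩
      rw [h0] at this
      exact this
    exact (div_nonpos_of_nonpos_of_nonneg (by linarith) (sq_nonneg _)).trans (by positivity)
  have hbdd : BddAbove (φ '' T) := ⟨t, by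
    rintro _ ⟨x, hx, rfl⟩
    exact (min_le_right _ _).trans (by linarith [hx.2.1])⟩
  have hne : (φ '' T).Nonempty := ⟨_, x₀, hx₀, rfl⟩
  set c := sSup (φ '' T) with hc
  have hle : ∀ x ∈ T, φ x ≤ c := fun x hx => le_csSup hbdd ⟨x, hx, rfl⟩
  have hcpos : 0 < c := lt_of_lt_of_le
    (lt_min (sub_pos.2 hx₀.2.2.2) (sub_pos.2 hx₀.2.2.1)) (hle x₀ hx₀)
  refine ⟨c, hcpos, fun x hx hx0 hxt => ?_⟩
  rcases le_or_gt (E x) t with hEx | hEx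
  · exact (div_nonpos_of_nonpos_of_nonneg (by linarith) (sq_nonneg _)).trans (by positivity)
  have hxT : x ∈ T := ⟨hx, hx0, hxt, hEx⟩
  obtain ⟨e, he⟩ : ∃ e, e = E x - t := ⟨_, rfl⟩
  obtain ⟨u, hu⟩ : ∃ u, u = t - x := ⟨_, rfl⟩
  have he0 : 0 < e := by linarith
  have hu0 : 0 < u := by linarith
  have h1 : E x - x = e + u := by linarith
  have h2 : c + t - x = c + u := by linarith
  rw [h1, h2, ← he, ← mul_div_assoc]
  rcases le_or_gt u e with h | h
  · have hce : c ≤ e := by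
      refine csSup_le hne ?_
      rintro _ ⟨y, hy, rfl⟩
      rcases le_total y x with hyx | hyx
      · exact (min_le_left _ _).trans (by linarith [hE hy.1 hx hyx])
      · exact (min_le_right _ _).trans (by linarith)
    have huc : u ≤ c := by
      have : min (E x - t) (t - x) ≤ c := hle x hxT
      rwa [min_eq_right (by linarith), ← hu] at this
    calc e / (e + u) ^ 2 ≤ 1 / c := by
          rw [div_le_div_iff₀ (by positivity) hcpos]; nlinarith
      _ ≤ 4 * c / (c + u) ^ 2 := by
          rw [div_le_div_iff₀ hcpos (by positivity)]; nlinarith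
  · have hcu : c ≤ u := by
      refine csSup_le hne ?_
      rintro _ ⟨y, hy, rfl⟩
      rcases le_total y x with hyx | hyx
      · exact (min_le_left _ _).trans (by linarith [hE hy.1 hx hyx])
      · exact (min_le_right _ _).trans (by linarith)
    have hec : e ≤ c := by
      have : min (E x - t) (t - x) ≤ c := hle x hxT
      rwa [min_eq_left (by linarith), ← he] at this
    calc e / (e + u) ^ 2 ≤ c / u ^ 2 := by
          gcongr; linarith
      _ ≤ 4 * c / (c + u) ^ 2 := by
          rw [div_le_div_iff₀ (by positivity) (by positivity)]
          nlinarith [mul_nonneg hcpos.le (mul_nonneg (sub_nonneg.2 hcu) (by linarith : 0 ≤ 3 * u + c))]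

/-- Weighted bound for averaging operators over the intervals `[x, E x]` with `E` nondecreasing. -/
lemma exists_lintegral_monotone_average_le {s : ℝ} (hs : -1 < s) :
    ∃ A : ℝ, 1 ≤ A ∧ ∀ (S : Set ℝ) (E : ℝ → ℝ) (g : ℝ → ℝ), MeasurableSet S → S ⊆ Ioi 0 →
      MonotoneOn E S → AEMeasurable g (volume.restrict (Ioi 0)) →
      ∫⁻ x in S, ∫⁻ t in Ioi x,
          ENNReal.ofReal (x ^ s * ((E x - t) / (E x - x) ^ 2)) * ENNReal.ofReal (g t ^ 2)
        ≤ ENNReal.ofReal A * ∫⁻ t in Ioi 0, ENNReal.ofReal (t ^ s * g t ^ 2) := by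
  obtain ⟨A, hA1, hA⟩ := exists_lintegral_rpow_mul_kernel_le hs
  refine ⟨4 * A, by linarith, fun S E g hS hS0 hE hg => ?_⟩
  have hEm : AEMeasurable E (volume.restrict S) := aemeasurable_restrict_of_monotoneOn hS hE
  set k : ℝ → ℝ → ℝ≥0∞ := fun x t => ENNReal.ofReal (x ^ s * ((E x - t) / (E x - x) ^ 2))
  have hK : ∀ t ∈ Ioi (0:ℝ), ∫⁻ x in S, (Iio t).indicator (fun x => k x t) x
      ≤ ENNReal.ofReal (4 * A * t ^ s) := by
    intro t ht
    obtain ⟨c, hc, hle⟩ := hE.exists_kernel_le (t := t)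
    calc ∫⁻ x in S, (Iio t).indicator (fun x => k x t) x
        ≤ ∫⁻ x in S, (Ioo 0 t).indicator
            (fun x => ENNReal.ofReal 4 * ENNReal.ofReal (x ^ s * (c / (c + t - x) ^ 2))) x := by
          refine setLIntegral_mono' hS fun x hx => ?_
          by_cases hxt : x < t
          · rw [indicator_of_mem (show x ∈ Iio t from hxt),
              indicator_of_mem (show x ∈ Ioo 0 t from ⟨hS0 hx, hxt⟩),
              ← ENNReal.ofReal_mul (by norm_num)]
            refine ENNReal.ofReal_le_ofReal ?_
            have := mul_le_mul_of_nonneg_left (hle x hx (hS0 hx) hxt)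
              (Real.rpow_pos_of_pos (hS0 hx) s).le
            linarith
          · rw [indicator_of_notMem (show x ∉ Iio t from hxt)]
            exact zero_le
      _ ≤ ∫⁻ x, (Ioo 0 t).indicator
            (fun x => ENNReal.ofReal 4 * ENNReal.ofReal (x ^ s * (c / (c + t - x) ^ 2))) x :=
          setLIntegral_le_lintegral _ _
      _ = ENNReal.ofReal 4 * ∫⁻ x in Ioo 0 t, ENNReal.ofReal (x ^ s * (c / (c + t - x) ^ 2)) := by
          rw [lintegral_indicator measurableSet_Ioo, lintegral_const_mul' _ _ ENNReal.ofReal_ne_top]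
      _ ≤ ENNReal.ofReal 4 * ENNReal.ofReal (A * t ^ s) := by gcongr; exact hA t c ht hc
      _ = _ := by rw [← ENNReal.ofReal_mul (by norm_num), mul_assoc]
  have hmeas : AEMeasurable (Function.uncurry fun x t =>
      (Ioi x).indicator (fun t => k x t * ENNReal.ofReal (g t ^ 2)) t)
      ((volume.restrict S).prod (volume.restrict (Ioi 0))) := by
    have hE1 : AEMeasurable (fun p : ℝ × ℝ => E p.1)
        ((volume.restrict S).prod (volume.restrict (Ioi 0))) := hEm.comp_fst
    have hg1 : AEMeasurable (fun p : ℝ × ℝ => g p.2)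
        ((volume.restrict S).prod (volume.restrict (Ioi 0))) := hg.comp_snd
    have : (Function.uncurry fun x t =>
        (Ioi x).indicator (fun t => k x t * ENNReal.ofReal (g t ^ 2)) t) =
        {p : ℝ × ℝ | p.1 < p.2}.indicator (fun p : ℝ × ℝ => ENNReal.ofReal
          (p.1 ^ s * ((E p.1 - p.2) / (E p.1 - p.1) ^ 2)) * ENNReal.ofReal (g p.2 ^ 2)) := by
      ext ⟨x, t⟩
      simp [Function.uncurry, indicator, k]
    rw [this]
    refine AEMeasurable.indicator ?_ (measurableSet_lt measurable_fst measurable_snd)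
    fun_prop
  calc ∫⁻ x in S, ∫⁻ t in Ioi x, k x t * ENNReal.ofReal (g t ^ 2)
      = ∫⁻ x in S, ∫⁻ t in Ioi 0,
          (Ioi x).indicator (fun t => k x t * ENNReal.ofReal (g t ^ 2)) t := by
        refine setLIntegral_congr_fun hS fun x hx => ?_
        rw [lintegral_indicator measurableSet_Ioi, Measure.restrict_restrict measurableSet_Ioi,
          inter_eq_left.2 (Ioi_subset_Ioi (le_of_lt (hS0 hx)))]
    _ = ∫⁻ t in Ioi 0, ∫⁻ x in S,
          (Ioi x).indicator (fun t => k x t * ENNReal.ofReal (g t ^ 2)) t :=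
        lintegral_lintegral_swap hmeas
    _ ≤ ∫⁻ t in Ioi 0, ENNReal.ofReal (4 * A) * ENNReal.ofReal (t ^ s * g t ^ 2) := by
        refine setLIntegral_mono' measurableSet_Ioi fun t ht => ?_
        have hts := (Real.rpow_pos_of_pos ht s).le
        calc ∫⁻ x in S, (Ioi x).indicator (fun t => k x t * ENNReal.ofReal (g t ^ 2)) t
            = ∫⁻ x in S, (Iio t).indicator (fun x => k x t) x * ENNReal.ofReal (g t ^ 2) := by
              refine lintegral_congr fun x => ?_
              by_cases h : x < t <;> simp [indicator, h]
          _ = (∫⁻ x in S, (Iio t).indicator (fun x => k x t) x) * ENNReal.ofReal (g t ^ 2) :=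
              lintegral_mul_const' _ _ ENNReal.ofReal_ne_top
          _ ≤ ENNReal.ofReal (4 * A * t ^ s) * ENNReal.ofReal (g t ^ 2) := by
              gcongr; exact hK t ht
          _ = _ := by
              rw [← ENNReal.ofReal_mul (by positivity), ← ENNReal.ofReal_mul (by positivity),
                mul_assoc]
    _ = _ := lintegral_const_mul' _ _ ENNReal.ofReal_ne_top

/-- The coefficients of a polynomial of degree `< n` are controlled by its values at the nodes
`(k + 1) / n`, `k < n`. -/
lemma exists_abs_coeff_le (n : ℕ) :
    ∃ C : ℝ, 0 ≤ C ∧ ∀ (a : Fin n → ℝ) (M : ℝ),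
      (∀ k : Fin n, |∑ i : Fin n, (((k : ℕ) + 1 : ℝ) / n) ^ (i : ℕ) * a i| ≤ M) →
      ∀ i, |a i| ≤ C * M := by
  set v : Fin n → ℝ := fun k => ((k : ℕ) + 1 : ℝ) / n with hv
  have hinj : Function.Injective v := by
    intro k k' h
    have hn : (n : ℝ) ≠ 0 := by
      have := k.pos
      positivity
    simp only [hv] at h
    rw [div_left_inj' hn] at h
    exact Fin.ext (by exact_mod_cast add_right_cancel h)
  set V := Matrix.vandermonde v
  have hdet : IsUnit V.det := isUnit_iff_ne_zero.2 (Matrix.det_vandermonde_ne_zero_iff.2 hinj)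
  refine ⟨∑ i, ∑ k, |V⁻¹ i k|, by positivity, fun a M h i => ?_⟩
  have hM : 0 ≤ M := (abs_nonneg _).trans (h i)
  have ha : a = V⁻¹.mulVec (V.mulVec a) := by
    rw [Matrix.mulVec_mulVec, Matrix.nonsing_inv_mul V hdet, Matrix.one_mulVec]
  have hVa : ∀ k, |V.mulVec a k| ≤ M := fun k => h k
  calc |a i| = |∑ k, V⁻¹ i k * V.mulVec a k| := congrArg abs (congrFun ha i)
    _ ≤ ∑ k, |V⁻¹ i k * V.mulVec a k| := Finset.abs_sum_le_sum_abs _ _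
    _ ≤ ∑ k, |V⁻¹ i k| * M := by
        refine Finset.sum_le_sum fun k _ => ?_
        rw [abs_mul]
        exact mul_le_mul_of_nonneg_left (hVa k) (abs_nonneg _)
    _ = (∑ k, |V⁻¹ i k|) * M := (Finset.sum_mul _ _ _).symm
    _ ≤ _ := by
        refine mul_le_mul_of_nonneg_right ?_ hM
        exact Finset.single_le_sum (f := fun i => ∑ k, |V⁻¹ i k|)
          (fun i _ => Finset.sum_nonneg fun k _ => abs_nonneg _) (Finset.mem_univ i)

lemma ContDiffOn.continuousOn_iteratedDeriv_of_isOpen {f : ℝ → ℝ} {s : Set ℝ} {m : ℕ}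
    (hf : ContDiffOn ℝ m f s) (hs : IsOpen s) : ContinuousOn (iteratedDeriv m f) s :=
  (hf.continuousOn_iteratedDerivWithin le_rfl hs.uniqueDiffOn).congr
    (iteratedDerivWithin_of_isOpen hs).symm

/-- Taylor's formula at a point of a half-line, with the `L¹` norm of the top derivative as
remainder. -/
lemma abs_sub_taylor_le_integral {f : ℝ → ℝ} {l : ℕ}
    (hf : ContDiffOn ℝ (l + 2 : ℕ) f (Ioi 0)) {x y h : ℝ} (hx : 0 < x) (hxy : x < y)
    (hyh : y ≤ x + h) :
    |f y - ∑ k ∈ Finset.range (l + 2), ((k.factorial : ℝ)⁻¹ * (y - x) ^ k) * iteratedDeriv k f x|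
      ≤ h ^ (l + 1) * ∫ t in x..(x + h), |iteratedDeriv (l + 2) f t| := by
  have hsub : ∀ {a b : ℝ}, x ≤ a → x ≤ b → uIcc a b ⊆ Ioi 0 := fun ha hb z hz =>
    lt_of_lt_of_le hx ((le_inf ha hb).trans hz.1)
  have hg : ContinuousOn (iteratedDeriv (l + 2) f) (Ioi 0) :=
    hf.continuousOn_iteratedDeriv_of_isOpen isOpen_Ioi
  obtain ⟨ξ, hξ, hT⟩ := taylor_mean_remainder_lagrange_iteratedDeriv (n := l) hxy.ne
    ((hf.mono (hsub le_rfl hxy.le)).of_le (by norm_cast; omega))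
  rw [uIoo_of_le hxy.le] at hξ
  have hder : ∀ t ∈ uIcc x ξ, HasDerivAt (iteratedDeriv (l + 1) f) (iteratedDeriv (l + 2) f t) t := by
    intro t ht
    have hd : DifferentiableOn ℝ (iteratedDeriv (l + 1) f) (Ioi 0) :=
      (hf.differentiableOn_iteratedDerivWithin (m := l + 1) (by norm_cast; omega)
        isOpen_Ioi.uniqueDiffOn).congr (iteratedDerivWithin_of_isOpen isOpen_Ioi).symm
    rw [iteratedDeriv_succ (n := l + 1)]
    exact (hd.differentiableAt (isOpen_Ioi.mem_nhds (hsub le_rfl hξ.1.le ht))).hasDerivAt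
  have hInt : ∀ {b : ℝ}, x ≤ b → IntervalIntegrable (iteratedDeriv (l + 2) f) volume x b :=
    fun hb => (hg.mono (hsub le_rfl hb)).intervalIntegrable
  have hftc := intervalIntegral.integral_eq_sub_of_hasDerivAt hder (hInt hξ.1.le)
  rw [taylor_within_apply] at hT
  have hsum : ∑ k ∈ Finset.range (l + 1),
        ((k.factorial : ℝ)⁻¹ * (y - x) ^ k) • iteratedDerivWithin k f (uIcc x y) x
      = ∑ k ∈ Finset.range (l + 1),
        ((k.factorial : ℝ)⁻¹ * (y - x) ^ k) * iteratedDeriv k f x := by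
    refine Finset.sum_congr rfl fun k hk => ?_
    rw [smul_eq_mul, iteratedDerivWithin_eq_iteratedDeriv (uniqueDiffOn_uIcc hxy.ne) _ left_mem_uIcc]
    refine ((hf.contDiffAt (isOpen_Ioi.mem_nhds hx)).of_le ?_)
    have := Finset.mem_range.1 hk
    norm_cast; omega
  rw [hsum] at hT
  rw [Finset.sum_range_succ, ← sub_sub, hT]
  have hI : |iteratedDeriv (l + 1) f ξ - iteratedDeriv (l + 1) f x|
      ≤ ∫ t in x..(x + h), |iteratedDeriv (l + 2) f t| := by
    rw [← hftc]
    refine (intervalIntegral.abs_integral_le_integral_abs hξ.1.le).trans ?_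
    exact intervalIntegral.integral_mono_interval le_rfl hξ.1.le (hξ.2.le.trans hyh)
      (ae_of_all _ fun t => abs_nonneg _) (hInt (hxy.le.trans hyh)).abs
  have hI0 := (abs_nonneg _).trans hI
  have hyx : 0 < y - x := sub_pos.2 hxy
  have hfac : (1:ℝ) ≤ (l + 1).factorial := by exact_mod_cast Nat.one_le_iff_ne_zero.2 (Nat.factorial_ne_zero _)
  have e : iteratedDeriv (l + 1) f ξ * (y - x) ^ (l + 1) / ((l + 1).factorial : ℝ)
      - (((l + 1).factorial : ℝ)⁻¹ * (y - x) ^ (l + 1)) * iteratedDeriv (l + 1) f x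
      = ((y - x) ^ (l + 1) / (l + 1).factorial)
        * (iteratedDeriv (l + 1) f ξ - iteratedDeriv (l + 1) f x) := by
    ring
  rw [e, abs_mul, abs_of_nonneg (by positivity)]
  refine mul_le_mul ((div_le_self (by positivity) hfac).trans ?_) hI (abs_nonneg _)
    (by have : 0 < h := by linarith
        positivity)
  exact pow_le_pow_left₀ hyx.le (by linarith) _

/-- Interpolation on a single interval `[x, x + r]` on which the weighted `L²` norm of the top
derivative is at most the (scaled) Hölder constant. -/
lemma exists_abs_iteratedDeriv_mul_pow_le (l : ℕ) :
    ∃ C : ℝ, 0 ≤ C ∧ ∀ (f : ℝ → ℝ) (H x r : ℝ), ContDiffOn ℝ (l + 2 : ℕ) f (Ioi 0) → 0 < H →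
      (∀ x ∈ Ioi (0:ℝ), ∀ y ∈ Ioi (0:ℝ), |f x - f y| ≤ H * Real.sqrt |x - y|) → 0 < x → 0 < r →
      r ^ (2 * l + 1) * (∫ t in x..(x + r), (x + r - t) * iteratedDeriv (l + 2) f t ^ 2) ≤ H ^ 2 →
      ∀ j : ℕ, 0 < j → j < l + 2 → |iteratedDeriv j f x| * r ^ j ≤ C * (H * Real.sqrt r) := by
  obtain ⟨C, hC0, hC⟩ := exists_abs_coeff_le (l + 2)
  refine ⟨2 ^ (l + 2) * (l + 2).factorial * (C * (9 / 4)), by positivity, ?_⟩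
  intro f H x r hf hH hhol hx hr hbal j hj hjl
  set g := iteratedDeriv (l + 2) f
  set ρ := Real.sqrt r
  have hρ : 0 < ρ := Real.sqrt_pos.2 hr
  have hρ2 : ρ ^ 2 = r := Real.sq_sqrt hr.le
  obtain ⟨h, hh⟩ : ∃ h, h = r / 2 := ⟨_, rfl⟩
  have hh0 : 0 < h := by linarith
  have hsub : ∀ {b : ℝ}, x ≤ b → uIcc x b ⊆ Ioi 0 := fun hb z hz =>
    lt_of_lt_of_le hx ((le_inf le_rfl hb).trans hz.1)
  have hgc : ContinuousOn g (Ioi 0) := hf.continuousOn_iteratedDeriv_of_isOpen isOpen_Ioi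
  have hgi : IntervalIntegrable g volume x (x + h) :=
    (hgc.mono (hsub (by linarith))).intervalIntegrable
  have hg2 : IntervalIntegrable (fun t => g t ^ 2) volume x (x + h) :=
    ((hgc.mono (hsub (by linarith))).pow 2).intervalIntegrable
  have hgk : IntervalIntegrable (fun t => (x + r - t) * g t ^ 2) volume x (x + r) :=
    (ContinuousOn.mul (by fun_prop) ((hgc.mono (hsub (by linarith))).pow 2)).intervalIntegrable
  have hhalf : h * ∫ t in x..(x + h), g t ^ 2 ≤ ∫ t in x..(x + r), (x + r - t) * g t ^ 2 := by
    rw [← intervalIntegral.integral_const_mul]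
    calc ∫ t in x..(x + h), h * g t ^ 2 ≤ ∫ t in x..(x + h), (x + r - t) * g t ^ 2 := by
          refine intervalIntegral.integral_mono_on (by linarith) (hg2.const_mul _)
            (hgk.mono_set ?_) fun t ht => ?_
          · rw [uIcc_of_le (by linarith), uIcc_of_le (by linarith)]
            exact Icc_subset_Icc le_rfl (by linarith)
          · exact mul_le_mul_of_nonneg_right (by linarith [ht.2]) (sq_nonneg _)
      _ ≤ _ := by
          refine intervalIntegral.integral_mono_interval le_rfl (by linarith) (by linarith) ?_ hgk
          refine (ae_restrict_iff' measurableSet_Ioc).2 (ae_of_all _ fun t ht => ?_)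
          exact mul_nonneg (by linarith [ht.2]) (sq_nonneg _)
  obtain ⟨q, hq⟩ : ∃ q, q = r ^ (l + 1) := ⟨_, rfl⟩
  have hq0 : 0 < q := by rw [hq]; positivity
  obtain ⟨μ, hμ⟩ : ∃ μ, μ = H * ρ / (q * r) := ⟨_, rfl⟩
  have hμ0 : 0 < μ := by rw [hμ]; positivity
  have hG2 : q ^ 2 * ∫ t in x..(x + h), g t ^ 2 ≤ 2 * H ^ 2 := by
    have e : q ^ 2 = 2 * (r ^ (2 * l + 1) * h) := by rw [hq, hh]; ring
    rw [e]
    have := mul_le_mul_of_nonneg_left hhalf (by positivity : 0 ≤ r ^ (2 * l + 1))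
    linarith
  have hG1 : h ^ (l + 1) * ∫ t in x..(x + h), |g t| ≤ 5 / 4 * (H * ρ) := by
    have hle : ∫ t in x..(x + h), |g t|
        ≤ (2 * μ)⁻¹ * (∫ t in x..(x + h), g t ^ 2) + μ / 2 * h := by
      have : ∫ t in x..(x + h), ((2 * μ)⁻¹ * g t ^ 2 + μ / 2)
          = (2 * μ)⁻¹ * (∫ t in x..(x + h), g t ^ 2) + μ / 2 * h := by
        rw [intervalIntegral.integral_add (hg2.const_mul _) intervalIntegrable_const,
          intervalIntegral.integral_const_mul, intervalIntegral.integral_const]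
        simp; ring
      rw [← this]
      refine intervalIntegral.integral_mono_on (by linarith) hgi.abs
        ((hg2.const_mul _).add intervalIntegrable_const) fun t _ => ?_
      rw [← sub_nonneg]
      have : (2 * μ)⁻¹ * g t ^ 2 + μ / 2 - |g t| = (2 * μ)⁻¹ * (|g t| - μ) ^ 2 := by
        rw [← sq_abs (g t)]; field_simp; ring
      rw [this]; positivity
    have hI0 : 0 ≤ ∫ t in x..(x + h), |g t| :=
      intervalIntegral.integral_nonneg (by linarith) fun t _ => abs_nonneg _
    have hhq : h ^ (l + 1) ≤ q := by
      rw [hq]; exact pow_le_pow_left₀ hh0.le (by linarith) _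
    calc h ^ (l + 1) * ∫ t in x..(x + h), |g t|
        ≤ q * ((2 * μ)⁻¹ * (∫ t in x..(x + h), g t ^ 2) + μ / 2 * h) :=
          mul_le_mul hhq hle hI0 hq0.le
      _ = (2 * μ * q)⁻¹ * (q ^ 2 * ∫ t in x..(x + h), g t ^ 2) + q * (μ / 2 * h) := by
          field_simp
      _ ≤ (2 * μ * q)⁻¹ * (2 * H ^ 2) + q * (μ / 2 * h) := by gcongr
      _ = 5 / 4 * (H * ρ) := by
          rw [hμ, hh, ← hρ2]; field_simp; ring
  set a : Fin (l + 2) → ℝ := fun i =>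
    if (i : ℕ) = 0 then 0 else ((i : ℕ).factorial : ℝ)⁻¹ * h ^ (i : ℕ) * iteratedDeriv i f x with ha
  have hnode : ∀ k : Fin (l + 2),
      |∑ i : Fin (l + 2), (((k : ℕ) + 1 : ℝ) / (l + 2 : ℕ)) ^ (i : ℕ) * a i| ≤ 9 / 4 * (H * ρ) := by
    intro k
    obtain ⟨s, hs⟩ : ∃ s : ℝ, s = ((k : ℕ) + 1 : ℝ) / (l + 2 : ℕ) := ⟨_, rfl⟩
    have hs0 : 0 < s := by rw [hs]; positivity
    have hs1 : s ≤ 1 := by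
      rw [hs, div_le_one (by positivity)]
      exact_mod_cast k.2
    have hsh : s * h ≤ h := by nlinarith
    have hshp : 0 < s * h := by positivity
    rw [← hs]
    have hT := abs_sub_taylor_le_integral hf hx (show x < x + s * h by linarith)
      (show x + s * h ≤ x + h by linarith)
    have hsum : ∑ i : Fin (l + 2), s ^ (i : ℕ) * a i =
        (∑ k ∈ Finset.range (l + 2),
          ((k.factorial : ℝ)⁻¹ * (x + s * h - x) ^ k) * iteratedDeriv k f x) - f x := by
      rw [Fin.sum_univ_succ, Finset.sum_range_succ', Finset.sum_range]
      simp only [ha, add_sub_cancel_left, Fin.val_zero, Fin.val_succ, if_true, Nat.succ_ne_zero,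
        if_false, Nat.factorial_zero, iteratedDeriv_zero, pow_zero, mul_zero, Nat.cast_one,
        inv_one, one_mul, mul_pow]
      rw [zero_add, add_sub_cancel_right]
      exact Finset.sum_congr rfl fun i _ => by ring
    have hosc := hhol x hx (x + s * h) (show (0:ℝ) < x + s * h by linarith)
    have hsq : Real.sqrt |x - (x + s * h)| ≤ ρ := by
      refine Real.sqrt_le_sqrt ?_
      rw [sub_add_cancel_left, abs_neg, abs_of_pos hshp]
      linarith
    have h1 : |f x - f (x + s * h)| ≤ H * ρ := hosc.trans (by gcongr)
    rw [hsum]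
    have h2 := hT.trans hG1
    rw [abs_le] at h1 h2 ⊢
    constructor <;> linarith [h1.1, h1.2, h2.1, h2.2]
  have hfin := hC a _ hnode ⟨j, hjl⟩
  simp only [ha, if_neg hj.ne', abs_mul, abs_inv, abs_pow, Nat.abs_cast, abs_of_pos hh0] at hfin
  have hjf : ((j.factorial : ℕ) : ℝ) ≤ (l + 2).factorial := by
    exact_mod_cast Nat.factorial_le hjl.le
  have hj0 : (0:ℝ) < j.factorial := by exact_mod_cast Nat.factorial_pos j
  have hr2 : r ^ j = 2 ^ j * h ^ j := by rw [← mul_pow, hh]; congr 1; ring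
  have h2j : (2:ℝ) ^ j ≤ 2 ^ (l + 2) := pow_le_pow_right₀ (by norm_num) hjl.le
  calc |iteratedDeriv j f x| * r ^ j
      = 2 ^ j * j.factorial * ((j.factorial : ℝ)⁻¹ * h ^ j * |iteratedDeriv j f x|) := by
        rw [hr2]; field_simp
    _ ≤ 2 ^ (l + 2) * (l + 2).factorial * (C * (9 / 4 * (H * ρ))) := by gcongr
    _ = _ := by ring

/-- Selection of balanced intervals: for `K > 0`, to each `x` in a measurable set `S` is attached
an endpoint `E x`, nondecreasing in `x`, for which the scaled weighted `L²` norm of `g` on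
`[x, E x]` equals `K`; off `S` that quantity never exceeds `K`. -/
lemma exists_monotoneOn_balance_eq {g : ℝ → ℝ} (hg : ContinuousOn g (Ioi 0)) (n : ℕ) {K : ℝ}
    (hK : 0 < K) :
    ∃ (S : Set ℝ) (E : ℝ → ℝ), MeasurableSet S ∧ S ⊆ Ioi 0 ∧ MonotoneOn E S ∧
      (∀ x ∈ S, x < E x ∧ (E x - x) ^ (n + 1) * (∫ t in x..E x, (E x - t) * g t ^ 2) = K) ∧
      ∀ x, 0 < x → x ∉ S → ∀ r, 0 < r →
        r ^ (n + 1) * (∫ t in x..(x + r), (x + r - t) * g t ^ 2) ≤ K := by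
  have hsub : ∀ {x b : ℝ}, 0 < x → x ≤ b → uIcc x b ⊆ Ioi 0 := fun hx hb z hz =>
    lt_of_lt_of_le hx ((le_inf le_rfl hb).trans hz.1)
  have hInt : ∀ {x b c : ℝ}, 0 < x → x ≤ b →
      IntervalIntegrable (fun t => (c - t) * g t ^ 2) volume x b := fun hx hb =>
    (ContinuousOn.mul (by fun_prop) ((hg.mono (hsub hx hb)).pow 2)).intervalIntegrable
  set I : ℝ → ℝ → ℝ := fun x e => ∫ t in x..e, (e - t) * g t ^ 2 with hI
  set A : ℝ → ℝ → ℝ := fun x e => (e - x) ^ (n + 1) * I x e with hA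
  have hI0 : ∀ {x e}, x ≤ e → 0 ≤ I x e := fun hxe =>
    intervalIntegral.integral_nonneg hxe fun t ht => mul_nonneg (by linarith [ht.2]) (sq_nonneg _)
  have hIright : ∀ {x e e'}, 0 < x → x ≤ e → e ≤ e' → I x e ≤ I x e' := by
    intro x e e' hx hxe hee
    calc I x e ≤ ∫ t in x..e, (e' - t) * g t ^ 2 :=
          intervalIntegral.integral_mono_on hxe (hInt hx hxe) (hInt hx hxe) fun t _ =>
            mul_le_mul_of_nonneg_right (by linarith) (sq_nonneg _)
      _ ≤ I x e' := by
          refine intervalIntegral.integral_mono_interval le_rfl hxe hee ?_ (hInt hx (hxe.trans hee))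
          refine (ae_restrict_iff' measurableSet_Ioc).2 (ae_of_all _ fun t ht => ?_)
          exact mul_nonneg (by linarith [ht.2]) (sq_nonneg _)
  have hIleft : ∀ {x y e}, 0 < x → x ≤ y → y ≤ e → I y e ≤ I x e := by
    intro x y e hx hxy hye
    refine intervalIntegral.integral_mono_interval hxy hye le_rfl ?_ (hInt hx (hxy.trans hye))
    refine (ae_restrict_iff' measurableSet_Ioc).2 (ae_of_all _ fun t ht => ?_)
    exact mul_nonneg (by linarith [ht.2]) (sq_nonneg _)
  have hAleft : ∀ {x y e}, 0 < x → x ≤ y → y ≤ e → A y e ≤ A x e := by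
    intro x y e hx hxy hye
    exact mul_le_mul (pow_le_pow_left₀ (by linarith) (by linarith) _) (hIleft hx hxy hye)
      (hI0 hye) (pow_nonneg (by linarith) _)
  have hAright : ∀ {x e e'}, 0 < x → x < e → e < e' → 0 < A x e → A x e < A x e' := by
    intro x e e' hx hxe hee hpos
    have hIpos : 0 < I x e := pos_of_mul_pos_right hpos (pow_nonneg (by linarith) _)
    have := hIright hx hxe.le hee.le
    exact mul_lt_mul (pow_lt_pow_left₀ (by linarith) (by linarith) (Nat.succ_ne_zero n)) this
      hIpos (pow_nonneg (by linarith) _)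
  have hAcont : ∀ {x b}, 0 < x → x ≤ b → ContinuousOn (A x) (Icc x b) := by
    intro x b hx hb
    have hc1 : ContinuousOn (fun e => ∫ t in x..e, g t ^ 2) (Icc x b) := by
      rw [← uIcc_of_le hb]
      exact intervalIntegral.continuousOn_primitive_interval
        (((hg.mono (hsub hx hb)).pow 2).integrableOn_compact isCompact_uIcc)
    have hc2 : ContinuousOn (fun e => ∫ t in x..e, t * g t ^ 2) (Icc x b) := by
      rw [← uIcc_of_le hb]
      exact intervalIntegral.continuousOn_primitive_interval
        ((continuousOn_id.mul ((hg.mono (hsub hx hb)).pow 2)).integrableOn_compact isCompact_uIcc)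
    have hc : ContinuousOn (fun e => (e - x) ^ (n + 1) *
        (e * (∫ t in x..e, g t ^ 2) - ∫ t in x..e, t * g t ^ 2)) (Icc x b) :=
      ContinuousOn.mul (by fun_prop) ((continuousOn_id.mul hc1).sub hc2)
    refine hc.congr fun e he => ?_
    simp only [hA, hI]
    congr 1
    rw [← intervalIntegral.integral_const_mul, ← intervalIntegral.integral_sub]
    · exact intervalIntegral.integral_congr fun t _ => by ring
    · exact ((hg.mono (hsub hx he.1)).pow 2).intervalIntegrable.const_mul _
    · exact (continuousOn_id.mul ((hg.mono (hsub hx he.1)).pow 2)).intervalIntegrable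
  have hivt : ∀ {x b}, 0 < x → x < b → K ≤ A x b → ∃ e, x < e ∧ A x e = K := by
    intro x b hx hxb hKb
    have hAx : A x x = 0 := by simp [hA]
    obtain ⟨e, he, hAe⟩ := intermediate_value_Icc hxb.le (hAcont hx hxb.le)
      (show K ∈ Icc (A x x) (A x b) from ⟨by linarith, hKb⟩)
    refine ⟨e, lt_of_le_of_ne he.1 ?_, hAe⟩
    rintro rfl
    linarith
  set S : Set ℝ := {x | 0 < x ∧ ∃ e, x < e ∧ A x e = K} with hS
  have hex : ∀ x, ∃ e, x ∈ S → x < e ∧ A x e = K := by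
    intro x
    by_cases hx : x ∈ S
    · obtain ⟨e, he⟩ := hx.2
      exact ⟨e, fun _ => he⟩
    · exact ⟨0, fun h => absurd h hx⟩
  choose E hE using hex
  refine ⟨S, E, ?_, fun x hx => hx.1, ?_, hE, ?_⟩
  · refine OrdConnected.measurableSet ⟨fun a ha b hb z hz => ?_⟩
    obtain ⟨e, hbe, hAe⟩ := hb.2
    have hz0 : 0 < z := lt_of_lt_of_le ha.1 hz.1
    exact ⟨hz0, hivt hz0 (lt_of_le_of_lt hz.2 hbe) (hAe.ge.trans (hAleft hz0 hz.2 hbe.le))⟩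
  · intro x hx y hy hxy
    by_contra! h
    obtain ⟨hyE, hAy⟩ := hE y hy
    obtain ⟨hxE, hAx⟩ := hE x hx
    have h1 := hAright hy.1 hyE h (by rw [hAy]; exact hK)
    have h2 := hAleft hx.1 hxy (hyE.trans h).le
    linarith
  · intro x hx hxS r hr
    by_contra! h
    refine hxS ⟨hx, hivt (b := x + r) hx (by linarith) ?_⟩
    simp only [hA, hI, add_sub_cancel_left]
    exact h.le

lemma eq_zero_of_forall_abs_mul_pow_le_s13 {d M : ℝ} {j : ℕ} (hj : 0 < j) (hM : 0 ≤ M)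
    (h : ∀ r : ℝ, 0 < r → |d| * r ^ j ≤ M * Real.sqrt r) : d = 0 := by
  by_contra hd
  have hd0 : 0 < |d| := abs_pos.2 hd
  obtain ⟨q, hq⟩ : ∃ q, q = 1 + M / |d| := ⟨_, rfl⟩
  have hq1 : 1 ≤ q := by
    have : 0 ≤ M / |d| := by positivity
    linarith
  have h1 := h (q ^ 2) (by positivity)
  rw [Real.sqrt_sq (by linarith)] at h1
  have h2 : q ^ 2 ≤ (q ^ 2) ^ j := le_self_pow₀ (by nlinarith) hj.ne'
  have h3 : |d| * q = |d| + M := by rw [hq]; field_simp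
  have h4 : |d| * q ^ 2 ≤ M * q := (mul_le_mul_of_nonneg_left h2 hd0.le).trans h1
  nlinarith

lemma wLp_rpow_eq_lintegral {σ p : ℝ} (hp : 0 < p) (f : ℝ → ℝ) :
    wLp σ (ENNReal.ofReal p) f ^ p
      = ∫⁻ x in Ioi 0, ENNReal.ofReal (x ^ (σ * p) * |f x| ^ p) := by
  rw [wLp, eLpNorm_eq_lintegral_rpow_enorm_toReal (by simpa using hp) ENNReal.ofReal_ne_top,
    ENNReal.toReal_ofReal hp.le, ← ENNReal.rpow_mul, one_div, inv_mul_cancel₀ hp.ne',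
    ENNReal.rpow_one]
  refine setLIntegral_congr_fun measurableSet_Ioi fun x (hx : 0 < x) => ?_
  have hxσ := Real.rpow_nonneg hx.le σ
  rw [← ofReal_norm, ENNReal.ofReal_rpow_of_nonneg (norm_nonneg _) hp.le, norm_mul,
    Real.norm_of_nonneg hxσ, Real.norm_eq_abs, Real.mul_rpow hxσ (abs_nonneg _),
    ← Real.rpow_mul hx.le]

/-- The weighted `L^p` bound for a function controlled on balanced intervals. -/
lemma lintegral_rpow_mul_abs_rpow_le {s A : ℝ} {l j : ℕ} {C H p : ℝ} {d g E : ℝ → ℝ} {S : Set ℝ}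
    (hC : 0 < C) (hH : 0 < H) (hp : 0 < p)
    (hpj : (2 * (j : ℝ) - 1) * p = 2 * (2 * l + 3))
    (hA : ∫⁻ x in S, ∫⁻ t in Ioi x,
          ENNReal.ofReal (x ^ s * ((E x - t) / (E x - x) ^ 2)) * ENNReal.ofReal (g t ^ 2)
        ≤ ENNReal.ofReal A * ∫⁻ t in Ioi 0, ENNReal.ofReal (t ^ s * g t ^ 2))
    (hg : ContinuousOn g (Ioi 0)) (hS : MeasurableSet S) (hS0 : S ⊆ Ioi 0)
    (hE : ∀ x ∈ S, x < E x ∧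
      (E x - x) ^ (2 * l + 1) * (∫ t in x..E x, (E x - t) * g t ^ 2) = H ^ 2)
    (hd : ∀ x ∈ S, |d x| * (E x - x) ^ j ≤ C * (H * Real.sqrt (E x - x)))
    (hd0 : ∀ x, 0 < x → x ∉ S → d x = 0) :
    ∫⁻ x in Ioi 0, ENNReal.ofReal (x ^ s * |d x| ^ p)
      ≤ ENNReal.ofReal (C ^ p * H ^ (p - 2)) *
        (ENNReal.ofReal A * ∫⁻ t in Ioi 0, ENNReal.ofReal (t ^ s * g t ^ 2)) := by
  have hkey : ∀ x ∈ S, ENNReal.ofReal (x ^ s * |d x| ^ p) ≤ ENNReal.ofReal (C ^ p * H ^ (p - 2)) *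
      ∫⁻ t in Ioi x,
        ENNReal.ofReal (x ^ s * ((E x - t) / (E x - x) ^ 2)) * ENNReal.ofReal (g t ^ 2) := by
    intro x hx
    have hx0 : 0 < x := hS0 hx
    obtain ⟨hxE, hbal⟩ := hE x hx
    obtain ⟨r, hr⟩ : ∃ r, r = E x - x := ⟨_, rfl⟩
    have hr0 : 0 < r := by linarith
    set I := ∫ t in x..E x, (E x - t) * g t ^ 2 with hI
    have hdx := hd x hx
    rw [← hr] at hbal hdx
    have hxs : 0 < x ^ s := Real.rpow_pos_of_pos hx0 s
    have hdp : |d x| ^ p ≤ C ^ p * H ^ (p - 2) * (I / r ^ 2) := by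
      have h1 := Real.rpow_le_rpow (by positivity) hdx hp.le
      rw [Real.mul_rpow (abs_nonneg _) (by positivity), Real.mul_rpow hC.le (by positivity),
        Real.mul_rpow hH.le (Real.sqrt_nonneg _), Real.sqrt_eq_rpow, ← Real.rpow_mul hr0.le,
        ← Real.rpow_natCast r j, ← Real.rpow_mul hr0.le] at h1
      have e1 : (j : ℝ) * p = 1 / 2 * p + ((2 * l + 3 : ℕ) : ℝ) := by
        push_cast; linarith
      have e2 : H ^ p = H ^ (p - 2) * H ^ 2 := by
        rw [← Real.rpow_natCast H 2, ← Real.rpow_add hH]; norm_num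
      rw [e1, Real.rpow_add hr0, Real.rpow_natCast, e2, ← hbal] at h1
      have hrp : 0 < r ^ (1 / 2 * p) := Real.rpow_pos_of_pos hr0 _
      have hrl : 0 < r ^ (2 * l + 3) := by positivity
      have e3 : C ^ p * H ^ (p - 2) * (I / r ^ 2)
          = C ^ p * (H ^ (p - 2) * (r ^ (2 * l + 1) * I) * r ^ (1 / 2 * p))
            / (r ^ (1 / 2 * p) * r ^ (2 * l + 3)) := by
        have : r ^ (2 * l + 3) = r ^ (2 * l + 1) * r ^ 2 := by ring
        rw [this]
        field_simp
      rw [e3, le_div_iff₀ (by positivity)]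
      exact h1
    have hsub : uIcc x (E x) ⊆ Ioi 0 := fun z hz =>
      lt_of_lt_of_le hx0 ((le_inf le_rfl hxE.le).trans hz.1)
    have hInt : IntervalIntegrable (fun t => x ^ s * ((E x - t) / r ^ 2) * g t ^ 2) volume
        x (E x) :=
      (ContinuousOn.mul (by fun_prop) ((hg.mono hsub).pow 2)).intervalIntegrable
    have hIeq : x ^ s * (I / r ^ 2)
        = ∫ t in Ioc x (E x), x ^ s * ((E x - t) / r ^ 2) * g t ^ 2 := by
      rw [hI, ← intervalIntegral.integral_of_le hxE.le, mul_div_assoc', div_eq_mul_inv, mul_comm,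
        ← mul_assoc, ← intervalIntegral.integral_const_mul]
      exact intervalIntegral.integral_congr fun t _ => by ring
    have hnn : ∀ t ∈ Ioc x (E x), 0 ≤ x ^ s * ((E x - t) / r ^ 2) := fun t ht =>
      mul_nonneg hxs.le (div_nonneg (by linarith [ht.2]) (sq_nonneg _))
    calc ENNReal.ofReal (x ^ s * |d x| ^ p)
        ≤ ENNReal.ofReal (C ^ p * H ^ (p - 2) * (x ^ s * (I / r ^ 2))) := by
          refine ENNReal.ofReal_le_ofReal ?_
          have := mul_le_mul_of_nonneg_left hdp hxs.le
          linarith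
      _ = ENNReal.ofReal (C ^ p * H ^ (p - 2)) *
          ∫⁻ t in Ioc x (E x), ENNReal.ofReal (x ^ s * ((E x - t) / r ^ 2) * g t ^ 2) := by
          rw [ENNReal.ofReal_mul (by positivity), hIeq, ofReal_integral_eq_lintegral_ofReal hInt.1]
          exact (ae_restrict_iff' measurableSet_Ioc).2 (ae_of_all _ fun t ht =>
            mul_nonneg (hnn t ht) (sq_nonneg _))
      _ = ENNReal.ofReal (C ^ p * H ^ (p - 2)) *
          ∫⁻ t in Ioc x (E x),
            ENNReal.ofReal (x ^ s * ((E x - t) / r ^ 2)) * ENNReal.ofReal (g t ^ 2) := by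
          congr 1
          exact setLIntegral_congr_fun measurableSet_Ioc fun t ht => ENNReal.ofReal_mul (hnn t ht)
      _ ≤ _ := by
          rw [← hr]
          gcongr
          exact Ioc_subset_Ioi_self
  calc ∫⁻ x in Ioi 0, ENNReal.ofReal (x ^ s * |d x| ^ p)
      = ∫⁻ x in Ioi 0, S.indicator (fun x => ENNReal.ofReal (x ^ s * |d x| ^ p)) x := by
        refine setLIntegral_congr_fun measurableSet_Ioi fun x hx => ?_
        by_cases hxS : x ∈ S
        · rw [indicator_of_mem hxS]
        · rw [indicator_of_notMem hxS, hd0 x hx hxS, abs_zero, Real.zero_rpow hp.ne', mul_zero,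
            ENNReal.ofReal_zero]
    _ ≤ ∫⁻ x, S.indicator (fun x => ENNReal.ofReal (x ^ s * |d x| ^ p)) x :=
        setLIntegral_le_lintegral _ _
    _ = ∫⁻ x in S, ENNReal.ofReal (x ^ s * |d x| ^ p) := lintegral_indicator hS _
    _ ≤ ∫⁻ x in S, ENNReal.ofReal (C ^ p * H ^ (p - 2)) * ∫⁻ t in Ioi x,
          ENNReal.ofReal (x ^ s * ((E x - t) / (E x - x) ^ 2)) * ENNReal.ofReal (g t ^ 2) :=
        setLIntegral_mono' hS hkey
    _ = ENNReal.ofReal (C ^ p * H ^ (p - 2)) * ∫⁻ x in S, ∫⁻ t in Ioi x,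
          ENNReal.ofReal (x ^ s * ((E x - t) / (E x - x) ^ 2)) * ENNReal.ofReal (g t ^ 2) :=
        lintegral_const_mul' _ _ ENNReal.ofReal_ne_top
    _ ≤ _ := by gcongr

/-- Extraction of the `p`-th root from the integral bound, with a constant independent of `p`. -/
lemma ENNReal.le_of_rpow_le_mul_rpow {L W : ℝ≥0∞} {C H A p : ℝ} (hC : 0 < C) (hH : 0 < H)
    (hA : 1 ≤ A) (hp : 1 ≤ p)
    (h : L ^ p ≤ ENNReal.ofReal (C ^ p * H ^ (p - 2)) * (ENNReal.ofReal A * W ^ (2 : ℝ))) :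
    L ≤ ENNReal.ofReal (C * A) * ENNReal.ofReal H ^ (1 - 2 / p) * W ^ (2 / p) := by
  have hp0 : 0 < p := by linarith
  have hip : 0 ≤ p⁻¹ := (inv_pos.2 hp0).le
  have h1 := ENNReal.rpow_le_rpow h hip
  rw [ENNReal.rpow_rpow_inv hp0.ne', ENNReal.mul_rpow_of_nonneg _ _ hip,
    ENNReal.mul_rpow_of_nonneg _ _ hip, ← ENNReal.rpow_mul, ← div_eq_mul_inv,
    ENNReal.ofReal_rpow_of_nonneg (by positivity) hip,
    Real.mul_rpow (by positivity) (by positivity), ← Real.rpow_mul hC.le,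
    mul_inv_cancel₀ hp0.ne', Real.rpow_one, ← Real.rpow_mul hH.le,
    ENNReal.ofReal_mul hC.le] at h1
  have e : (p - 2) * p⁻¹ = 1 - 2 / p := by field_simp
  rw [e, ← ENNReal.ofReal_rpow_of_pos hH] at h1
  have hA' : ENNReal.ofReal A ^ p⁻¹ ≤ ENNReal.ofReal A := by
    conv_rhs => rw [← ENNReal.rpow_one (ENNReal.ofReal A)]
    exact ENNReal.rpow_le_rpow_of_exponent_le (by simpa using hA) (inv_le_one_of_one_le₀ hp)
  rw [ENNReal.ofReal_mul hC.le]
  calc L ≤ ENNReal.ofReal C * ENNReal.ofReal H ^ (1 - 2 / p) *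
        (ENNReal.ofReal A ^ p⁻¹ * W ^ (2 / p)) := h1
    _ ≤ ENNReal.ofReal C * ENNReal.ofReal H ^ (1 - 2 / p) *
        (ENNReal.ofReal A * W ^ (2 / p)) := by gcongr
    _ = _ := by ring

/-- **Weighted interpolation between the Hölder-1/2 seminorm and a weighted `L²` norm
of the top derivative** (Proposition 2.15 in the one-dimensional case): for
`σ_m > -1/2` with `m - 1 - σ_m > 0`, `θ_j = (2j-1)/(2m-1)`, `σ_j = σ_m θ_j`,
`1/p_j = θ_j/2` (i.e. `p_j = 2(2m-1)/(2j-1)`):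
`‖x^{σ_j} f^{(j)}‖_{L^{p_j}} ≤ C ‖f‖_{Ċ^{1/2}}^{1-θ_j} ‖x^{σ_m} f^{(m)}‖_{L²}^{θ_j}`,
the Hölder seminorm being expressed through an arbitrary bound `H`. -/
theorem weighted_interpolation_holder_L2
    (m : ℕ) (hm : 2 ≤ m) (σm : ℝ) (hσm : -(1/2 : ℝ) < σm)
    (hmain : 0 < (m : ℝ) - 1 - σm) :
    ∃ C : ℝ≥0∞, C ≠ ⊤ ∧ ∀ f : ℝ → ℝ, ContDiffOn ℝ m f (Set.Ioi 0) →
      ∀ H : ℝ, 0 ≤ H →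
      (∀ x ∈ Set.Ioi (0:ℝ), ∀ y ∈ Set.Ioi (0:ℝ),
        |f x - f y| ≤ H * Real.sqrt |x - y|) →
      wLp σm 2 (iteratedDeriv m f) < ⊤ →
      ∀ j : ℕ, 0 < j → j < m →
        wLp (σm * ((2 * (j : ℝ) - 1) / (2 * (m : ℝ) - 1)))
            (ENNReal.ofReal (2 * (2 * (m : ℝ) - 1) / (2 * (j : ℝ) - 1)))
            (iteratedDeriv j f)
          ≤ C * ENNReal.ofReal H ^ (1 - (2 * (j : ℝ) - 1) / (2 * (m : ℝ) - 1)) *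
              wLp σm 2 (iteratedDeriv m f) ^ ((2 * (j : ℝ) - 1) / (2 * (m : ℝ) - 1)) := by
  obtain ⟨l, rfl⟩ : ∃ l, m = l + 2 := ⟨m - 2, by omega⟩
  obtain ⟨A, hA1, hA⟩ := exists_lintegral_monotone_average_le (s := σm * 2) (by linarith)
  obtain ⟨C₀, hC₀, hpt⟩ := exists_abs_iteratedDeriv_mul_pow_le l
  refine ⟨ENNReal.ofReal ((C₀ + 1) * A), ENNReal.ofReal_ne_top, ?_⟩
  intro f hf H hH hhol _ j hj hjm
  have hj1 : (1:ℝ) ≤ j := by exact_mod_cast hj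
  have hjl : (j:ℝ) + 1 ≤ l + 2 := by exact_mod_cast hjm
  have hm2 : ((l + 2 : ℕ) : ℝ) = l + 2 := by push_cast; ring
  have h2j : 0 < 2 * (j : ℝ) - 1 := by linarith
  have h2m : 0 < 2 * ((l + 2 : ℕ) : ℝ) - 1 := by rw [hm2]; linarith
  obtain ⟨p, hp⟩ : ∃ p, p = 2 * (2 * ((l + 2 : ℕ) : ℝ) - 1) / (2 * (j : ℝ) - 1) := ⟨_, rfl⟩
  have hθ : (2 * (j : ℝ) - 1) / (2 * ((l + 2 : ℕ) : ℝ) - 1) = 2 / p := by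
    rw [hp]; field_simp
  have hp1 : 1 ≤ p := by
    rw [hp, one_le_div h2j, hm2]; linarith
  have hp0 : 0 < p := by linarith
  rw [hθ, ← hp]
  rcases hH.eq_or_lt with rfl | hH
  · have hconst : EqOn f (fun _ => f 1) (Ioi 0) := fun x hx => by
      have := hhol x hx 1 (mem_Ioi.2 one_pos)
      rw [zero_mul] at this
      exact sub_eq_zero.1 (abs_nonpos_iff.1 this)
    have hz := hconst.iteratedDeriv_of_isOpen isOpen_Ioi j
    have : wLp (σm * (2 / p)) (ENNReal.ofReal p) (iteratedDeriv j f) = 0 := by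
      rw [wLp, ← eLpNorm_zero (ε := ℝ) (p := ENNReal.ofReal p)
        (μ := volume.restrict (Ioi (0:ℝ)))]
      refine eLpNorm_congr_ae ((ae_restrict_iff' measurableSet_Ioi).2 (ae_of_all _ fun x hx => ?_))
      simp [hz hx, iteratedDeriv_const, hj.ne']
    rw [this]
    exact zero_le
  have hg : ContinuousOn (iteratedDeriv (l + 2) f) (Ioi 0) :=
    hf.continuousOn_iteratedDeriv_of_isOpen isOpen_Ioi
  obtain ⟨S, E, hS, hS0, hEmono, hE, hout⟩ :=
    exists_monotoneOn_balance_eq hg (2 * l) (K := H ^ 2) (by positivity)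
  refine ENNReal.le_of_rpow_le_mul_rpow (by positivity) hH hA1 hp1 ?_
  have hW := wLp_rpow_eq_lintegral (σ := σm) (two_pos) (iteratedDeriv (l + 2) f)
  rw [ENNReal.ofReal_ofNat] at hW
  simp only [Real.rpow_two, sq_abs] at hW
  rw [wLp_rpow_eq_lintegral hp0, hW, mul_assoc, div_mul_cancel₀ _ hp0.ne']
  refine lintegral_rpow_mul_abs_rpow_le (l := l) (j := j) (S := S) (E := E) (by positivity) hH hp0 ?_
    (hA S E _ hS hS0 hEmono (hg.aemeasurable measurableSet_Ioi)) hg hS hS0 hE ?_ ?_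
  · rw [hp, hm2]; field_simp; ring
  · intro x hx
    obtain ⟨hxE, hbal⟩ := hE x hx
    have h := hpt f H x (E x - x) hf hH hhol (hS0 hx) (sub_pos.2 hxE)
      (by rw [add_sub_cancel]; exact hbal.le) j hj hjm
    refine h.trans ?_
    gcongr
    linarith
  · intro x hx hxS
    refine eq_zero_of_forall_abs_mul_pow_le_s13 (M := C₀ * H) hj (by positivity) fun r hr => ?_
    rw [mul_assoc]
    exact hpt f H x r hf hH hhol hx hr (hout x hx hxS r hr) j hj hjm
end
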